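/- arXiv:1311.1616 — 4 statements merged into one kernel-verified Lean document; each statement's English description precedes it below -/
import Mathlib

section
/- There exist constants c, C > 0 such that for all sufficiently large n there is a Boolean function F : {-1,1}^n → {-1,1} which is a block composition OR_t(ED_N,…,ED_N) of OR_t with disjoint copies of the Element Distinctness function (for suitable t and N with t·N·log₂N ≤ n, the remaining variables being irrelevant), such that the function F' : {-1,1}^{3n} → {-1,1} defined by F'(x, y, z) = F(Sel_z(x, y)), where Sel_z(x, y)_i = x_i if z_i = 1 and y_i if z_i = −1, satisfies W(F') ≥ 2^{c·n^{2/5}/(log₂n)^C}. -/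
open Finset

noncomputable section

/-- The real value of a Boolean bit: `true` encodes `-1` (logical TRUE), `false` encodes `1`. -/
def bval (b : Bool) : ℝ := if b then -1 else 1

/-- The parity character `χ_S(x) = ∏_{i ∈ S} x_i`. -/
def chi {ι : Type*} (S : Finset ι) (x : ι → Bool) : ℝ := ∏ i ∈ S, bval (x i)

/-- The multilinear polynomial with coefficient family `c`. -/
def polyOf {ι : Type*} [Fintype ι] (c : Finset ι → ℝ) (x : ι → Bool) : ℝ :=
  ∑ S : Finset ι, c S * chi S x

/-- Read an input `x ∈ {-1,1}^{N·k}` (indexed as `N` blocks of `k` bits) as a function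
`g_x : [N] → [2^k]`, each block giving the binary representation of its value. -/
def gOf {N k : ℕ} (x : Fin N × Fin k → Bool) (i : Fin N) : Fin (2 ^ k) :=
  finFunctionFinEquiv (fun j => if x (i, j) then 1 else 0)

/-- The Element Distinctness function on `N = 2^k` blocks of `k` bits: it is TRUE
(`true`, i.e. `-1`) iff the `N` encoded numbers are pairwise distinct. -/
def ED (k : ℕ) (x : Fin (2 ^ k) × Fin k → Bool) : Bool :=
  decide (Function.Injective (gOf x))

/-- The block composition `OR_t(f, …, f)`; it is TRUE (`true`, i.e. `-1`) iff some copy of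
`f` is TRUE. -/
def orBlock (t : ℕ) {ι : Type*} [Fintype ι] [DecidableEq ι]
    (f : (ι → Bool) → Bool) (x : Fin t × ι → Bool) : Bool :=
  decide (∃ i : Fin t, f (fun j => x (i, j)) = true)

/-- `F` is (up to irrelevant variables) the block composition of `OR_t` with disjoint
copies of Element Distinctness, on some subset of the `n` variables. -/
def IsOrED {n : ℕ} (F : (Fin n → Bool) → Bool) : Prop :=
  ∃ t k : ℕ, ∃ e : Fin t × (Fin (2 ^ k) × Fin k) → Fin n, Function.Injective e ∧
    t * (2 ^ k * k) ≤ n ∧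
    ∀ x : Fin n → Bool, F x = orBlock t (ED k) (fun p => x (e p))

/-- The selector composition `F'(x, y, z) = F(Sel_z(x, y))`, where the input is indexed as
a triple `(x, y, z)` of `n`-bit strings (coordinates `(0,i)`, `(1,i)`, `(2,i)`), and
`Sel_z(x,y)_i = x_i` if `z_i = 1` and `y_i` if `z_i = -1`. -/
def selComp {n : ℕ} (F : (Fin n → Bool) → Bool) (w : Fin 3 × Fin n → Bool) : Bool :=
  F (fun i => if w (2, i) then w (1, i) else w (0, i))

lemma abs_bval (b : Bool) : |bval b| = 1 := by cases b <;> simp [bval]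

lemma abs_chi {ι : Type*} (S : Finset ι) (x : ι → Bool) : |chi S x| = 1 := by
  unfold chi
  rw [Finset.abs_prod]
  exact Finset.prod_eq_one (fun i _ => abs_bval _)

lemma abs_polyOf_le {ι : Type*} [Fintype ι] (c : Finset ι → ℝ) (x : ι → Bool) :
    |polyOf c x| ≤ ∑ S, |c S| := by
  unfold polyOf
  refine (Finset.abs_sum_le_sum_abs _ _).trans (le_of_eq ?_)
  refine Finset.sum_congr rfl (fun S _ => ?_)
  rw [abs_mul, abs_chi, mul_one]

/-- integer version of `bval`. -/
def ibval (b : Bool) : ℤ := if b then -1 else 1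

lemma bval_cast (b : Bool) : bval b = ((ibval b : ℤ) : ℝ) := by cases b <;> simp [bval, ibval]

lemma one_le_of_pos_int {ι : Type*} [Fintype ι] (q : Finset ι → ℤ) (b : Bool) (x : ι → Bool)
    (h : 0 < bval b * polyOf (fun S => (q S : ℝ)) x) :
    1 ≤ bval b * polyOf (fun S => (q S : ℝ)) x := by
  have : bval b * polyOf (fun S => (q S : ℝ)) x
      = ((ibval b * ∑ S : Finset ι, q S * ∏ i ∈ S, ibval (x i) : ℤ) : ℝ) := by
    simp [polyOf, chi, bval_cast]
  rw [this] at h ⊢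
  exact_mod_cast h

/-- the input to the selector composition with hidden bits `y = (z, v)`. -/
def selIn {n : ℕ} (u : Fin n → Bool) (y : Fin n → Bool × Bool) (p : Fin 3 × Fin n) : Bool :=
  if p.1 = 2 then (y p.2).1
  else if p.1 = 1 then (if (y p.2).1 then u p.2 else (y p.2).2)
  else (if (y p.2).1 then (y p.2).2 else u p.2)

lemma selComp_selIn {n : ℕ} (F : (Fin n → Bool) → Bool) (u : Fin n → Bool)
    (y : Fin n → Bool × Bool) : selComp F (selIn u y) = F u := by
  unfold selComp
  congr 1
  funext i
  cases h : (y i).1 <;> simp [selIn, h]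

/-- coordinates touched by the `x` or `y` part of `S`. -/
def selT {n : ℕ} (S : Finset (Fin 3 × Fin n)) : Finset (Fin n) :=
  Finset.univ.filter (fun i => ((0 : Fin 3), i) ∈ S ∨ ((1 : Fin 3), i) ∈ S)

def selS {n : ℕ} (S : Finset (Fin 3 × Fin n)) (i : Fin n) : ℝ :=
  if ((0 : Fin 3), i) ∈ S then (if ((1 : Fin 3), i) ∈ S then 0 else 1)
  else if ((1 : Fin 3), i) ∈ S then (if ((2 : Fin 3), i) ∈ S then -1 else 1)
  else (if ((2 : Fin 3), i) ∈ S then 0 else 1)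

lemma abs_selS_le {n : ℕ} (S : Finset (Fin 3 × Fin n)) (i : Fin n) : |selS S i| ≤ 1 := by
  unfold selS
  split_ifs <;> simp

lemma chi_selIn_sum {n : ℕ} (S : Finset (Fin 3 × Fin n)) (u : Fin n → Bool) :
    ∑ y : Fin n → Bool × Bool, chi S (selIn u y)
      = 4 ^ n * ((∏ i, selS S i) * (1 / 2) ^ (selT S).card * chi (selT S) u) := by
  have h1 : ∀ y : Fin n → Bool × Bool, chi S (selIn u y)
      = ∏ i, ∏ a : Fin 3, if (a, i) ∈ S then bval (selIn u (fun _ => y i) (a, i)) else 1 := by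
    intro y
    unfold chi
    rw [Finset.prod_comm, ← Finset.prod_product' (f := fun a i =>
      if (a, i) ∈ S then bval (selIn u (fun _ => y i) (a, i)) else 1)]
    rw [Finset.univ_product_univ, Finset.prod_ite_mem, Finset.univ_inter]
    rfl
  simp_rw [h1]
  have h2 := Finset.prod_univ_sum (fun _ : Fin n => (Finset.univ : Finset (Bool × Bool)))
    (fun i w => ∏ a : Fin 3, if (a, i) ∈ S then bval (selIn u (fun _ => w) (a, i)) else (1 : ℝ))
  rw [Fintype.piFinset_univ] at h2
  rw [← h2]
  have h3 : ∀ i : Fin n, (∑ w : Bool × Bool,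
      ∏ a : Fin 3, if (a, i) ∈ S then bval (selIn u (fun _ => w) (a, i)) else (1 : ℝ))
      = 4 * (selS S i * (if i ∈ selT S then (1 / 2) * bval (u i) else 1)) := by
    intro i
    rw [Fintype.sum_prod_type]
    simp only [Fin.prod_univ_three, Fintype.sum_bool, selS, selT, Finset.mem_filter,
      Finset.mem_univ, true_and, selIn]
    by_cases h0 : ((0 : Fin 3), i) ∈ S <;> by_cases h1 : ((1 : Fin 3), i) ∈ S <;>
      by_cases h2 : ((2 : Fin 3), i) ∈ S <;> simp [h0, h1, h2, bval] <;> (try split_ifs) <;> norm_num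
  simp_rw [h3]
  rw [Finset.prod_mul_distrib, Finset.prod_mul_distrib, Finset.prod_ite_mem, Finset.univ_inter,
    Finset.prod_mul_distrib]
  simp [chi, mul_assoc]

lemma krause {n : ℕ} (F : (Fin n → Bool) → Bool) (q : Finset (Fin 3 × Fin n) → ℤ)
    (hq : ∀ x, 0 < bval (selComp F x) * polyOf (fun S => (q S : ℝ)) x) (L : ℕ)
    (hW : ∑ S, |(q S : ℝ)| ≤ 2 ^ L) :
    ∃ c : Finset (Fin n) → ℝ, (∀ T, L < T.card → c T = 0) ∧ ∑ T, |c T| ≤ ∑ S, |(q S : ℝ)| ∧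
      ∀ u, 1 / 2 ≤ bval (F u) * polyOf c u := by
  classical
  set d : Finset (Fin 3 × Fin n) → ℝ := fun S =>
    (q S : ℝ) * ((∏ i, selS S i) * (1 / 2) ^ (selT S).card) with hd
  have hdle : ∀ S, |d S| ≤ |(q S : ℝ)| * (1 / 2) ^ (selT S).card := by
    intro S
    rw [hd]
    simp only [abs_mul, Finset.abs_prod, abs_pow]
    have : ∏ i, |selS S i| ≤ 1 := Finset.prod_le_one (fun _ _ => abs_nonneg _)
      (fun i _ => abs_selS_le S i)
    have h12 : |(1 / 2 : ℝ)| = 1 / 2 := by norm_num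
    rw [h12]
    gcongr
    nlinarith [show (0 : ℝ) ≤ (1 / 2) ^ (selT S).card by positivity]
  set c : Finset (Fin n) → ℝ := fun T =>
    if L < T.card then 0 else ∑ S, if selT S = T then d S else 0 with hc
  have hp1 : ∀ k : ℕ, ((1 : ℝ) / 2) ^ k ≤ 1 := fun k => pow_le_one₀ (by norm_num) (by norm_num)
  refine ⟨c, ?_, ?_, ?_⟩
  · intro T hT
    simp [hc, hT]
  · calc ∑ T, |c T| ≤ ∑ T, ∑ S, if selT S = T then |d S| else 0 := by
          refine Finset.sum_le_sum (fun T _ => ?_)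
          simp only [hc]
          split_ifs with h
          · rw [abs_zero]
            refine Finset.sum_nonneg (fun S _ => ?_)
            split_ifs <;> simp
          · refine (Finset.abs_sum_le_sum_abs _ _).trans (le_of_eq ?_)
            refine Finset.sum_congr rfl (fun S _ => ?_)
            split_ifs <;> simp
      _ = ∑ S, |d S| := by
          rw [Finset.sum_comm]
          simp
      _ ≤ _ := by
          refine Finset.sum_le_sum (fun S _ => (hdle S).trans ?_)
          nlinarith [hp1 (selT S).card, abs_nonneg (q S : ℝ)]
  · intro u
    -- the averaged polynomial
    have hfull : 1 ≤ bval (F u) * ∑ S, d S * chi (selT S) u := by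
      have h1 : ∀ y : Fin n → Bool × Bool,
          1 ≤ bval (F u) * polyOf (fun S => (q S : ℝ)) (selIn u y) := by
        intro y
        have h := one_le_of_pos_int q _ _ (hq (selIn u y))
        rwa [selComp_selIn] at h
      have h2 := Finset.sum_le_sum (fun y (_ : y ∈ (Finset.univ : Finset (Fin n → Bool × Bool))) => h1 y)
      rw [← Finset.mul_sum] at h2
      unfold polyOf at h2
      rw [Finset.sum_comm] at h2
      simp_rw [← Finset.mul_sum, chi_selIn_sum] at h2
      have h3 : ∑ S : Finset (Fin 3 × Fin n), (q S : ℝ) * (4 ^ n * ((∏ i, selS S i) *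
          (1 / 2) ^ (selT S).card * chi (selT S) u)) = 4 ^ n * ∑ S, d S * chi (selT S) u := by
        rw [Finset.mul_sum]
        refine Finset.sum_congr rfl (fun S _ => ?_)
        simp only [hd]; ring
      rw [h3] at h2
      simp only [Finset.sum_const, Finset.card_univ, Fintype.card_pi, Fintype.card_prod,
        Fintype.card_bool, Finset.prod_const, Fintype.card_fin, nsmul_eq_mul, mul_one] at h2
      push_cast at h2
      have h4 : (0 : ℝ) < 4 ^ n := by positivity
      have : (4 : ℝ) ^ n * 1 ≤ 4 ^ n * (bval (F u) * ∑ S, d S * chi (selT S) u) := by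
        linarith
      exact le_of_mul_le_mul_left this h4
    have hpoly : polyOf c u = ∑ S, if L < (selT S).card then 0 else d S * chi (selT S) u := by
      unfold polyOf
      have : ∀ T, c T * chi T u = ∑ S, if selT S = T then
          (if L < (selT S).card then 0 else d S * chi (selT S) u) else 0 := by
        intro T
        simp only [hc]
        split_ifs with h
        · rw [zero_mul]
          symm
          refine Finset.sum_eq_zero (fun S _ => ?_)
          split_ifs with h5 h6 <;> simp_all
        · rw [Finset.sum_mul]
          refine Finset.sum_congr rfl (fun S _ => ?_)
          by_cases h5 : selT S = T
          · subst h5; simp [h]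
          · simp [h5]
      simp_rw [this]
      rw [Finset.sum_comm]
      simp
    have hdiff : |∑ S, d S * chi (selT S) u - polyOf c u| ≤ 1 / 2 := by
      rw [hpoly, ← Finset.sum_sub_distrib]
      calc _ ≤ ∑ S, |(q S : ℝ)| * (1 / 2) ^ (L + 1) := by
            refine (Finset.abs_sum_le_sum_abs _ _).trans (Finset.sum_le_sum (fun S _ => ?_))
            split_ifs with h
            · rw [sub_zero, abs_mul, abs_chi, mul_one]
              refine (hdle S).trans ?_
              refine mul_le_mul_of_nonneg_left ?_ (abs_nonneg _)
              exact pow_le_pow_of_le_one (by norm_num) (by norm_num) h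
            · rw [sub_self, abs_zero]; positivity
        _ = (∑ S, |(q S : ℝ)|) * (1 / 2) ^ (L + 1) := by rw [Finset.sum_mul]
        _ ≤ 2 ^ L * (1 / 2) ^ (L + 1) := by gcongr
        _ = 1 / 2 := by
            rw [pow_succ, ← mul_assoc, ← mul_pow]; norm_num
    have hb := abs_bval (F u)
    have h6 : |bval (F u) * (∑ S, d S * chi (selT S) u - polyOf c u)| ≤ 1 / 2 := by
      rw [abs_mul, hb, one_mul]; exact hdiff
    have := (abs_le.mp h6).2
    rw [mul_sub] at this
    linarith

lemma or_step {n t : ℕ} {ι : Type*} [Fintype ι] [DecidableEq ι] (f : (ι → Bool) → Bool)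
    (e : Fin t × ι → Fin n) (he : Function.Injective e) (F : (Fin n → Bool) → Bool)
    (hF : ∀ x, F x = orBlock t f (fun p => x (e p))) (L : ℕ)
    (a b : (ι → Bool) → ℝ) (ha0 : ∀ x, 0 ≤ a x) (hb0 : ∀ x, 0 ≤ b x)
    (ha1 : ∑ x, a x = 1) (hb1 : ∑ x, b x = 1)
    (hab : ∀ S : Finset ι, S.card ≤ L → ∑ x, a x * chi S x = ∑ x, b x * chi S x)
    (hbf : ∀ x, f x = true → b x = 0)
    (haf : ∑ x, (if f x = true then 0 else a x) ≤ 1 / 2)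
    (c : Finset (Fin n) → ℝ) (hc : ∀ T, L < T.card → c T = 0)
    (hpos : ∀ u, 1 / 2 ≤ bval (F u) * polyOf c u) :
    (2 : ℝ) ^ t ≤ 2 * ∑ T, |c T| := by
  classical
  set W := ∑ T, |c T| with hWdef
  have hW0 : 0 ≤ W := Finset.sum_nonneg (fun _ _ => abs_nonneg _)
  let ext : (Fin t → ι → Bool) → Fin n → Bool := fun Y =>
    Function.extend e (fun p => Y p.1 p.2) (fun _ => false)
  have hext : ∀ Y p, ext Y (e p) = Y p.1 p.2 := fun Y p => he.extend_apply _ _ p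
  have hFext : ∀ Y, F (ext Y) = decide (∃ i, f (Y i) = true) := by
    intro Y
    rw [hF]
    simp only [orBlock, hext]
  have hprodsum : ∀ g : Fin t → (ι → Bool) → ℝ,
      ∑ Y : Fin t → ι → Bool, ∏ i, g i (Y i) = ∏ i, ∑ x, g i x := by
    intro g
    have h := Finset.prod_univ_sum (fun _ : Fin t => (Finset.univ : Finset (ι → Bool))) g
    rw [Fintype.piFinset_univ] at h
    exact h.symm
  let Ti : Finset (Fin n) → Fin t → Finset ι := fun T i => Finset.univ.filter (fun j => e (i, j) ∈ T)
  have hTi : ∀ T i, (Ti T i).card ≤ T.card := by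
    intro T i
    refine Finset.card_le_card_of_injOn (fun j => e (i, j)) ?_ ?_
    · intro j hj
      have := (Finset.mem_filter.mp (Finset.mem_coe.mp hj)).2
      exact this
    · intro j _ j' _ h
      have := he h
      simpa using this
  have hchi : ∀ T Y, chi T (ext Y) = ∏ i, chi (Ti T i) (Y i) := by
    intro T Y
    have h1 : chi T (ext Y) = ∏ j ∈ T ∩ Finset.univ.image e, bval (ext Y j) := by
      unfold chi
      symm
      refine Finset.prod_subset Finset.inter_subset_left ?_
      intro j hj hj'
      have : ¬ ∃ p, e p = j := by
        rintro ⟨p, rfl⟩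
        exact hj' (by simp [hj])
      simp only [ext, Function.extend_apply' _ _ _ this, bval]
      simp
    have h2 : T ∩ Finset.univ.image e = (Finset.univ.filter (fun p => e p ∈ T)).image e := by
      ext j
      simp only [Finset.mem_inter, Finset.mem_image, Finset.mem_univ, true_and, Finset.mem_filter]
      constructor
      · rintro ⟨h, p, rfl⟩; exact ⟨p, h, rfl⟩
      · rintro ⟨p, h, rfl⟩; exact ⟨h, p, rfl⟩
    rw [h1, h2, Finset.prod_image (fun p _ p' _ h => he h)]
    simp_rw [hext]
    rw [Finset.prod_filter, Fintype.prod_prod_type]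
    refine Finset.prod_congr rfl (fun i _ => ?_)
    simp only [chi, Ti]
    rw [Finset.prod_filter]
  have hexp : ∀ w : (ι → Bool) → ℝ, ∑ Y : Fin t → ι → Bool, (∏ i, w (Y i)) * polyOf c (ext Y)
      = ∑ T, c T * ∏ i, ∑ x, w x * chi (Ti T i) x := by
    intro w
    unfold polyOf
    simp_rw [Finset.mul_sum]
    rw [Finset.sum_comm]
    refine Finset.sum_congr rfl (fun T _ => ?_)
    rw [← hprodsum, Finset.mul_sum]
    refine Finset.sum_congr rfl (fun Y _ => ?_)
    rw [hchi, Finset.prod_mul_distrib]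
    ring
  have heq : ∑ Y : Fin t → ι → Bool, (∏ i, a (Y i)) * polyOf c (ext Y)
      = ∑ Y : Fin t → ι → Bool, (∏ i, b (Y i)) * polyOf c (ext Y) := by
    rw [hexp, hexp]
    refine Finset.sum_congr rfl (fun T _ => ?_)
    by_cases hT : L < T.card
    · rw [hc T hT]; simp
    · congr 1
      refine Finset.prod_congr rfl (fun i _ => hab _ ((hTi T i).trans (not_lt.mp hT)))
  have hlow : 1 / 2 ≤ ∑ Y : Fin t → ι → Bool, (∏ i, b (Y i)) * polyOf c (ext Y) := by
    have h1 : ∑ Y : Fin t → ι → Bool, (∏ i, b (Y i)) * (1 / 2) = 1 / 2 := by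
      rw [← Finset.sum_mul, hprodsum (fun _ => b)]
      simp [hb1]
    rw [← h1]
    refine Finset.sum_le_sum (fun Y _ => ?_)
    by_cases hY : ∃ i, f (Y i) = true
    · obtain ⟨i, hi⟩ := hY
      rw [Finset.prod_eq_zero (Finset.mem_univ i) (hbf _ hi)]
      simp
    · refine mul_le_mul_of_nonneg_left ?_ (Finset.prod_nonneg (fun i _ => hb0 _))
      have := hpos (ext Y)
      rw [hFext] at this
      simpa [hY, bval] using this
  have hup : ∑ Y : Fin t → ι → Bool, (∏ i, a (Y i)) * polyOf c (ext Y) ≤ (1 / 2) ^ t * W := by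
    calc _ ≤ ∑ Y : Fin t → ι → Bool, (∏ i, (if f (Y i) = true then 0 else a (Y i))) * W := by
          refine Finset.sum_le_sum (fun Y _ => ?_)
          by_cases hY : ∃ i, f (Y i) = true
          · have := hpos (ext Y)
            rw [hFext] at this
            simp only [hY, bval] at this
            simp only [decide_true, if_true] at this
            obtain ⟨i, hi⟩ := hY
            rw [Finset.prod_eq_zero (i := i) (f := fun i => if f (Y i) = true then 0 else a (Y i))
              (Finset.mem_univ i) (by simp [hi])]
            rw [zero_mul]
            exact mul_nonpos_of_nonneg_of_nonpos (Finset.prod_nonneg (fun i _ => ha0 _))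
              (by linarith)
          · push Not at hY
            have : ∏ i, (if f (Y i) = true then 0 else a (Y i)) = ∏ i, a (Y i) :=
              Finset.prod_congr rfl (fun i _ => by simp [hY i])
            rw [this]
            refine mul_le_mul_of_nonneg_left ?_ (Finset.prod_nonneg (fun i _ => ha0 _))
            exact (le_abs_self _).trans (abs_polyOf_le c _)
      _ = (∑ x, (if f x = true then 0 else a x)) ^ t * W := by
          rw [← Finset.sum_mul, hprodsum (fun _ x => if f x = true then 0 else a x)]
          simp
      _ ≤ _ := by
          have h0 : 0 ≤ ∑ x, (if f x = true then 0 else a x) :=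
            Finset.sum_nonneg (fun x _ => by split_ifs <;> simp [ha0])
          gcongr
  have h : 1 / 2 ≤ (1 / 2) ^ t * W := by linarith
  have h2 : (0 : ℝ) < 2 ^ t := by positivity
  have h3 := mul_le_mul_of_nonneg_left h h2.le
  have h4 : (2 : ℝ) ^ t * ((1 / 2) ^ t * W) = W := by
    rw [← mul_assoc, ← mul_pow]; norm_num
  linarith

/-- factors of the unperturbed Lagrange weights. -/
def facT (a l : ℕ) : ℝ :=
  if l = a then 1 else ((l : ℝ) + 1) ^ 2 / |((l : ℝ) + 1) ^ 2 - ((a : ℝ) + 1) ^ 2|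

lemma facT_phase1 (a l : ℕ) (h : l ≤ a) :
    (∏ j ∈ range l, facT a j) * ((a + 1 + l).factorial * a.factorial)
      = (l.factorial : ℝ) ^ 2 * (a + 1).factorial * (a - l).factorial := by
  induction l with
  | zero => simp
  | succ l ih =>
    have ih := ih (by omega)
    obtain ⟨b, rfl⟩ : ∃ b, a = l + 1 + b := ⟨a - (l + 1), by omega⟩
    rw [Finset.prod_range_succ]
    have e1 : l + 1 + b - l = b + 1 := by omega
    have e2 : l + 1 + b - (l + 1) = b := by omega
    have hT : facT (l + 1 + b) l = ((l : ℝ) + 1) ^ 2 / (((b : ℝ) + 1) * (2 * l + b + 3)) := by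
      unfold facT
      rw [if_neg (by omega)]
      congr 1
      rw [abs_of_neg]
      · push_cast; ring
      · push_cast
        nlinarith [Nat.cast_nonneg (α := ℝ) l, Nat.cast_nonneg (α := ℝ) b]
    rw [e1] at ih
    rw [e2, hT]
    have f1 : ((l + 1 + b + 1 + (l + 1)).factorial : ℝ)
        = (2 * l + b + 3) * (l + 1 + b + 1 + l).factorial := by
      rw [show l + 1 + b + 1 + (l + 1) = (l + 1 + b + 1 + l) + 1 by ring, Nat.factorial_succ]
      push_cast; ring
    have f2 : ((l + 1).factorial : ℝ) = (l + 1) * l.factorial := by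
      rw [Nat.factorial_succ]; push_cast; ring
    have f3 : ((b + 1).factorial : ℝ) = (b + 1) * b.factorial := by
      rw [Nat.factorial_succ]; push_cast; ring
    rw [f1, f2]
    rw [f3] at ih
    have p1 : ((b : ℝ) + 1) ≠ 0 := by positivity
    have p2 : (2 * (l : ℝ) + b + 3) ≠ 0 := by positivity
    generalize ((l + 1 + b + 1 + l).factorial : ℝ) = X at *
    generalize ((l + 1 + b).factorial : ℝ) = Y at *
    generalize ((l + 1 + b + 1).factorial : ℝ) = Z at *
    generalize ∏ j ∈ range l, facT (l + 1 + b) j = P at *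
    field_simp
    have ih' : P * (X * Y) = (l.factorial : ℝ) ^ 2 * Z * b.factorial * (b + 1) := by
      linarith
    linear_combination ih'

lemma facT_phase2 (a s : ℕ) :
    (∏ j ∈ range (a + 1 + s), facT a j) * ((2 * a + 2 + s).factorial * s.factorial)
      = 2 * ((a + 1 + s).factorial : ℝ) ^ 2 := by
  induction s with
  | zero =>
    have h := facT_phase1 a a le_rfl
    rw [add_zero, Finset.prod_range_succ]
    have hT : facT a a = 1 := by simp [facT]
    rw [hT]
    have f1 : ((2 * a + 2 + 0).factorial : ℝ) = (2 * a + 2) * (a + 1 + a).factorial := by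
      rw [show 2 * a + 2 + 0 = (a + 1 + a) + 1 by ring, Nat.factorial_succ]; push_cast; ring
    have f2 : ((a + 1).factorial : ℝ) = (a + 1) * a.factorial := by
      rw [Nat.factorial_succ]; push_cast; ring
    rw [f1, f2]
    rw [f2] at h
    have p : (a.factorial : ℝ) ≠ 0 := by positivity
    simp only [Nat.sub_self, Nat.factorial_zero, Nat.cast_one, mul_one] at h ⊢
    have h' : (∏ j ∈ range a, facT a j) * ((a + 1 + a).factorial : ℝ)
        = a.factorial * ((a + 1) * a.factorial) := by
      apply mul_right_cancel₀ p
      linear_combination h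
    linear_combination (2 * a + 2) * h'
  | succ s ih =>
    rw [← add_assoc, Finset.prod_range_succ]
    have hT : facT a (a + 1 + s) = ((a : ℝ) + 2 + s) ^ 2 / (((s : ℝ) + 1) * (2 * a + s + 3)) := by
      unfold facT
      rw [if_neg (by omega), abs_of_pos]
      · push_cast
        congr 1 <;> ring
      · push_cast
        nlinarith [Nat.cast_nonneg (α := ℝ) a, Nat.cast_nonneg (α := ℝ) s]
    rw [hT]
    have f1 : ((2 * a + 2 + (s + 1)).factorial : ℝ) = (2 * a + s + 3) * (2 * a + 2 + s).factorial := by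
      rw [show 2 * a + 2 + (s + 1) = (2 * a + 2 + s) + 1 by ring, Nat.factorial_succ]
      push_cast; ring
    have f2 : ((a + 1 + s + 1).factorial : ℝ) = (a + 2 + s) * (a + 1 + s).factorial := by
      rw [Nat.factorial_succ]; push_cast; ring
    have f3 : ((s + 1).factorial : ℝ) = (s + 1) * s.factorial := by
      rw [Nat.factorial_succ]; push_cast; ring
    rw [← add_assoc] at f1
    rw [← add_assoc, f1, f2, f3]
    have p1 : ((s : ℝ) + 1) ≠ 0 := by positivity
    have p2 : (2 * (a : ℝ) + s + 3) ≠ 0 := by positivity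
    field_simp
    linear_combination ih

lemma facT_prod_le (a L : ℕ) (h : a < L) : ∏ j ∈ range L, facT a j ≤ 2 := by
  obtain ⟨s, rfl⟩ : ∃ s, L = a + 1 + s := ⟨L - (a + 1), by omega⟩
  have h2 := facT_phase2 a s
  have hf : ((a + 1 + s).factorial : ℝ) ^ 2 ≤ (2 * a + 2 + s).factorial * s.factorial := by
    have hc := Nat.choose_le_centralBinom s (a + 1 + s)
    rw [Nat.centralBinom_eq_two_mul_choose] at hc
    have k1 := Nat.choose_mul_factorial_mul_factorial (n := 2 * (a + 1 + s)) (k := s) (by omega)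
    have k2 := Nat.choose_mul_factorial_mul_factorial (n := 2 * (a + 1 + s)) (k := a + 1 + s)
      (by omega)
    rw [show 2 * (a + 1 + s) - s = 2 * a + 2 + s by omega] at k1
    rw [show 2 * (a + 1 + s) - (a + 1 + s) = a + 1 + s by omega] at k2
    have hpos : 0 < (2 * (a + 1 + s)).choose s := Nat.choose_pos (by omega)
    have : (a + 1 + s).factorial ^ 2 ≤ (2 * a + 2 + s).factorial * s.factorial := by
      have e : (2 * (a + 1 + s)).choose s * ((2 * a + 2 + s).factorial * s.factorial)
          = (2 * (a + 1 + s)).choose (a + 1 + s) * (a + 1 + s).factorial ^ 2 := by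
        linarith
      have : (2 * (a + 1 + s)).choose s * (a + 1 + s).factorial ^ 2
          ≤ (2 * (a + 1 + s)).choose s * ((2 * a + 2 + s).factorial * s.factorial) := by
        rw [e]; gcongr
      exact Nat.le_of_mul_le_mul_left this hpos
    exact_mod_cast this
  have hp : (0 : ℝ) < (2 * a + 2 + s).factorial * s.factorial := by positivity
  refine le_of_mul_le_mul_right ?_ hp
  rw [h2]
  linarith

lemma harm_le (L M : ℕ) (h : L ≤ M) : ∑ j ∈ range L, 1 / ((j : ℝ) + 1) ≤ 1 + Real.log M := by
  have h1 : ∑ j ∈ range L, 1 / ((j : ℝ) + 1) ≤ ∑ j ∈ range M, 1 / ((j : ℝ) + 1) := by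
    refine Finset.sum_le_sum_of_subset_of_nonneg (Finset.range_mono h) (fun _ _ _ => by positivity)
  have h2 := harmonic_le_one_add_log M
  refine h1.trans (le_trans (le_of_eq ?_) h2)
  simp [harmonic]

lemma sum_inv_dist_le (a L : ℕ) (h : a < L) :
    ∑ j ∈ range L, (if j = a then 0 else 1 / |(j : ℝ) - a|) ≤ 2 * (1 + Real.log L) := by
  obtain ⟨s, rfl⟩ : ∃ s, L = a + 1 + s := ⟨L - (a + 1), by omega⟩
  rw [Finset.sum_range_add, Finset.sum_range_succ]
  have h1 : ∑ j ∈ range a, (if j = a then 0 else 1 / |(j : ℝ) - a|)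
      = ∑ j ∈ range a, 1 / ((j : ℝ) + 1) := by
    rw [← Finset.sum_range_reflect]
    refine Finset.sum_congr rfl (fun j hj => ?_)
    have hj := Finset.mem_range.mp hj
    rw [if_neg (by omega)]
    congr 1
    rw [abs_of_neg]
    · rw [Nat.cast_sub (by omega), Nat.cast_sub (by omega)]; push_cast; ring
    · have : ((a - 1 - j : ℕ) : ℝ) < a := by exact_mod_cast (by omega : a - 1 - j < a)
      linarith
  have h2 : ∑ j ∈ range s, (if a + 1 + j = a then 0 else 1 / |((a + 1 + j : ℕ) : ℝ) - a|)
      = ∑ j ∈ range s, 1 / ((j : ℝ) + 1) := by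
    refine Finset.sum_congr rfl (fun j hj => ?_)
    rw [if_neg (by omega)]
    congr 1
    rw [abs_of_pos] <;> push_cast
    · ring
    · have := Nat.cast_nonneg (α := ℝ) j; linarith
  rw [h1, h2, if_pos rfl]
  have := harm_le a (a + 1 + s) (by omega)
  have := harm_le s (a + 1 + s) (by omega)
  linarith

/-- the range sizes used as interpolation nodes. -/
def rnode (A : ℕ) : ℕ → ℕ
  | 0 => 128 * A
  | (a + 1) => A / (a + 1) ^ 2

def wnode (A L i : ℕ) : ℝ :=
  ∏ j ∈ range (L + 1), if j = i then 1 else (rnode A i : ℝ) / (rnode A i - rnode A j)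

lemma rnode_le (A a : ℕ) : (rnode A (a + 1) : ℝ) ≤ A / ((a : ℝ) + 1) ^ 2 := by
  unfold rnode
  refine Nat.cast_div_le.trans (le_of_eq ?_)
  push_cast; rfl

lemma lt_rnode (A a : ℕ) : A / ((a : ℝ) + 1) ^ 2 - 1 < (rnode A (a + 1) : ℝ) := by
  have := Nat.lt_floor_add_one ((A : ℝ) / (((a + 1) ^ 2 : ℕ) : ℝ))
  rw [Nat.floor_div_natCast, Nat.floor_natCast] at this
  unfold rnode
  push_cast at this ⊢
  linarith

lemma factor_le (A L a l : ℕ) (ha : a < L) (hl : l < L) (hne : l ≠ a)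
    (hA : (L : ℝ) ^ 3 / A * (1 / |(l : ℝ) - a|) < 1) (hA0 : 0 < A) :
    |(rnode A (a + 1) : ℝ) - rnode A (l + 1)| > 0 ∧
    |(rnode A (a + 1) : ℝ) / (rnode A (a + 1) - rnode A (l + 1))|
      ≤ facT a l * (1 - (L : ℝ) ^ 3 / A * (1 / |(l : ℝ) - a|))⁻¹ := by
  set x : ℝ := (a : ℝ) + 1 with hx
  set y : ℝ := (l : ℝ) + 1 with hy
  have hx0 : 0 < x := by positivity
  have hy0 : 0 < y := by positivity
  have hxL : x ≤ L := by rw [hx]; exact_mod_cast ha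
  have hyL : y ≤ L := by rw [hy]; exact_mod_cast hl
  have hA0' : (0 : ℝ) < A := by exact_mod_cast hA0
  have hxy : (l : ℝ) - a = y - x := by rw [hx, hy]; ring
  have hyx : y - x ≠ 0 := by
    rw [← hxy, sub_ne_zero]; exact_mod_cast hne
  rw [hxy] at hA ⊢
  set ε := (L : ℝ) ^ 3 / A * (1 / |y - x|) with hε
  set D := |(A : ℝ) / x ^ 2 - A / y ^ 2| with hD
  have hab : 0 < |y - x| := abs_pos.mpr hyx
  have hD' : D = A * (|y - x| * (x + y)) / (x ^ 2 * y ^ 2) := by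
    rw [hD]
    have : (A : ℝ) / x ^ 2 - A / y ^ 2 = (y - x) * (A * (x + y) / (x ^ 2 * y ^ 2)) := by
      field_simp; ring
    rw [this, abs_mul, abs_of_pos (a := A * (x + y) / (x ^ 2 * y ^ 2)) (by positivity)]
    ring
  have hDpos : 0 < D := by rw [hD']; positivity
  have h1 : 1 ≤ ε * D := by
    rw [hε, hD']
    have : (L : ℝ) ^ 3 / A * (1 / |y - x|) * (A * (|y - x| * (x + y)) / (x ^ 2 * y ^ 2))
        = (L : ℝ) ^ 3 * (x + y) / (x ^ 2 * y ^ 2) := by field_simp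
    rw [this, le_div_iff₀ (by positivity), one_mul]
    have k1 : x ^ 2 * y ≤ (L : ℝ) ^ 2 * L := by gcongr
    nlinarith [mul_le_mul_of_nonneg_right k1 hy0.le, show (0 : ℝ) ≤ L ^ 3 * x by positivity]
  have h2 : D * (1 - ε) ≤ |(rnode A (a + 1) : ℝ) - rnode A (l + 1)| := by
    have a1 := rnode_le A a
    have a2 := lt_rnode A a
    have b1 := rnode_le A l
    have b2 := lt_rnode A l
    rw [← hx] at a1 a2
    rw [← hy] at b1 b2
    have : D - 1 ≤ |(rnode A (a + 1) : ℝ) - rnode A (l + 1)| := by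
      rcases abs_cases ((A : ℝ) / x ^ 2 - A / y ^ 2) with ⟨e, _⟩ | ⟨e, _⟩
      · have := le_abs_self ((rnode A (a + 1) : ℝ) - rnode A (l + 1)); rw [hD]; linarith
      · have := neg_le_abs ((rnode A (a + 1) : ℝ) - rnode A (l + 1)); rw [hD]; linarith
    nlinarith
  have h3 : 0 < D * (1 - ε) := mul_pos hDpos (by linarith)
  refine ⟨by linarith, ?_⟩
  rw [abs_div, abs_of_nonneg (a := (rnode A (a + 1) : ℝ)) (by positivity)]
  have hT : facT a l = (A / x ^ 2) / D := by
    unfold facT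
    rw [if_neg hne, hD', ← hx, ← hy]
    have : |y ^ 2 - x ^ 2| = |y - x| * (x + y) := by
      rw [show y ^ 2 - x ^ 2 = (y - x) * (x + y) by ring, abs_mul,
        abs_of_pos (a := x + y) (by positivity)]
    rw [this]
    field_simp
  rw [hT, ← div_eq_mul_inv, div_div]
  have a1 := rnode_le A a
  gcongr

lemma facT_nonneg (a l : ℕ) : 0 ≤ facT a l := by
  unfold facT; split_ifs <;> positivity

lemma sum_inv_sq_le (L : ℕ) : ∑ a ∈ range L, 1 / ((a : ℝ) + 1) ^ 2 ≤ 2 := by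
  have : ∀ L : ℕ, ∑ a ∈ range (L + 1), 1 / ((a : ℝ) + 1) ^ 2 ≤ 2 - 1 / ((L : ℝ) + 1) := by
    intro L
    induction L with
    | zero => norm_num
    | succ n ih =>
      rw [Finset.sum_range_succ]
      push_cast
      have e : 1 / ((n : ℝ) + 1) - 1 / ((n : ℝ) + 1 + 1) = 1 / (((n : ℝ) + 1) * ((n : ℝ) + 2)) := by
        field_simp; ring
      have : 1 / ((n : ℝ) + 1 + 1) ^ 2 ≤ 1 / (((n : ℝ) + 1) * ((n : ℝ) + 2)) := by
        apply one_div_le_one_div_of_le (by positivity)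
        nlinarith [Nat.cast_nonneg (α := ℝ) n]
      linarith
  have h2 := this L
  rw [Finset.sum_range_succ] at h2
  have h3 : (0 : ℝ) ≤ 1 / ((L : ℝ) + 1) := by positivity
  have h4 : (0 : ℝ) ≤ 1 / ((L : ℝ) + 1) ^ 2 := by positivity
  linarith

lemma rnode_zero_sub_pos (A a : ℕ) (hA0 : 0 < A) : (0 : ℝ) < 128 * A - rnode A (a + 1) := by
  have h := rnode_le A a
  have hA0' : (0 : ℝ) < A := by exact_mod_cast hA0
  have : (A : ℝ) / ((a : ℝ) + 1) ^ 2 ≤ A := by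
    apply div_le_self hA0'.le
    nlinarith [Nat.cast_nonneg (α := ℝ) a]
  linarith

lemma one_sub_sum_le_prod (s : Finset ℕ) (f : ℕ → ℝ) (h0 : ∀ i ∈ s, 0 ≤ f i)
    (h1 : ∀ i ∈ s, f i ≤ 1) : 1 - ∑ i ∈ s, f i ≤ ∏ i ∈ s, (1 - f i) := by
  classical
  induction s using Finset.induction_on with
  | empty => simp
  | insert a s ha ih =>
    rw [Finset.sum_insert ha, Finset.prod_insert ha]
    have h2 := ih (fun i hi => h0 i (Finset.mem_insert_of_mem hi))
      (fun i hi => h1 i (Finset.mem_insert_of_mem hi))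
    have h3 := h0 a (Finset.mem_insert_self _ _)
    have h4 := h1 a (Finset.mem_insert_self _ _)
    have h5 : 0 ≤ ∑ i ∈ s, f i :=
      Finset.sum_nonneg (fun i hi => h0 i (Finset.mem_insert_of_mem hi))
    nlinarith [mul_le_mul_of_nonneg_left h2 (sub_nonneg.mpr h4)]

lemma wnode_succ_le (A L a : ℕ) (ha : a < L) (hA0 : 0 < A)
    (hA : 4 * (L : ℝ) ^ 3 * (1 + Real.log L) ≤ A) :
    |wnode A L (a + 1)| ≤ 1 / 127 * (1 / ((a : ℝ) + 1) ^ 2) * 4 := by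
  have hA0' : (0 : ℝ) < A := by exact_mod_cast hA0
  have hL1 : (1 : ℝ) ≤ L := by exact_mod_cast (by omega : 1 ≤ L)
  have hlog : 0 ≤ Real.log L := Real.log_nonneg hL1
  set ε : ℕ → ℝ := fun l => (L : ℝ) ^ 3 / A * (if l = a then 0 else 1 / |(l : ℝ) - a|) with hε
  have hε0 : ∀ l, 0 ≤ ε l := by
    intro l; simp only [hε]; split_ifs <;> positivity
  have hsum : ∑ l ∈ range L, ε l ≤ 1 / 2 := by
    simp only [hε]
    rw [← Finset.mul_sum]
    have h1 := sum_inv_dist_le a L ha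
    calc _ ≤ (L : ℝ) ^ 3 / A * (2 * (1 + Real.log L)) := by gcongr
      _ = (4 * (L : ℝ) ^ 3 * (1 + Real.log L)) / A / 2 := by ring
      _ ≤ 1 / 2 := by
          have : (4 * (L : ℝ) ^ 3 * (1 + Real.log L)) / A ≤ 1 := by
            rw [div_le_one hA0']; exact hA
          linarith
  have hε1 : ∀ l ∈ range L, ε l ≤ 1 / 2 := fun l hl =>
    (Finset.single_le_sum (fun l _ => hε0 l) hl).trans hsum
  have hprod : 1 / 2 ≤ ∏ l ∈ range L, (1 - ε l) := by
    have := one_sub_sum_le_prod (range L) ε (fun l _ => hε0 l)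
      (fun l hl => by linarith [hε1 l hl])
    linarith
  have hmain : |∏ l ∈ range L, (if l = a then (1 : ℝ) else
      (rnode A (a + 1) : ℝ) / (rnode A (a + 1) - rnode A (l + 1)))| ≤ 4 := by
    rw [Finset.abs_prod]
    calc _ ≤ ∏ l ∈ range L, (facT a l * (1 - ε l)⁻¹) := by
          refine Finset.prod_le_prod (fun _ _ => abs_nonneg _) (fun l hl => ?_)
          by_cases hla : l = a
          · simp [hla, facT, hε]
          · have h := hε1 l hl
            simp only [hε, hla, if_false] at h ⊢
            exact (factor_le A L a l ha (Finset.mem_range.mp hl) hla (by linarith) hA0).2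
      _ = (∏ l ∈ range L, facT a l) * (∏ l ∈ range L, (1 - ε l))⁻¹ := by
          rw [Finset.prod_mul_distrib, Finset.prod_inv_distrib]
      _ ≤ 2 * (1 / 2)⁻¹ := by
          gcongr
          exact facT_prod_le a L ha
      _ = 4 := by norm_num
  unfold wnode
  rw [Finset.prod_range_succ']
  simp only [Nat.add_right_cancel_iff]
  rw [if_neg (by omega), abs_mul, mul_comm]
  refine mul_le_mul ?_ hmain (abs_nonneg _) (by positivity)
  have h1 := rnode_zero_sub_pos A a hA0
  have h2 := rnode_le A a
  have h0 : (rnode A 0 : ℝ) = 128 * A := by simp [rnode]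
  rw [h0, abs_div, abs_sub_comm, abs_of_pos h1, abs_of_nonneg (by positivity)]
  rw [div_le_iff₀ h1]
  have h3 : (A : ℝ) / ((a : ℝ) + 1) ^ 2 ≤ A := by
    apply div_le_self hA0'.le
    nlinarith [Nat.cast_nonneg (α := ℝ) a]
  have h4 : (127 : ℝ) * A ≤ 128 * A - rnode A (a + 1) := by linarith
  calc (rnode A (a + 1) : ℝ) ≤ A / ((a : ℝ) + 1) ^ 2 := h2
    _ = 1 / 127 * (1 / ((a : ℝ) + 1) ^ 2) * (127 * A) := by ring
    _ ≤ _ := by gcongr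

lemma sum_wnode_succ_le (A L : ℕ) (hA0 : 0 < A)
    (hA : 4 * (L : ℝ) ^ 3 * (1 + Real.log L) ≤ A) :
    ∑ a ∈ range L, |wnode A L (a + 1)| ≤ 1 / 10 := by
  calc _ ≤ ∑ a ∈ range L, 1 / 127 * (1 / ((a : ℝ) + 1) ^ 2) * 4 :=
        Finset.sum_le_sum (fun a ha => wnode_succ_le A L a (Finset.mem_range.mp ha) hA0 hA)
    _ = 4 / 127 * ∑ a ∈ range L, 1 / ((a : ℝ) + 1) ^ 2 := by
        rw [Finset.mul_sum]; refine Finset.sum_congr rfl (fun a _ => by ring)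
    _ ≤ 4 / 127 * 2 := by gcongr; exact sum_inv_sq_le L
    _ ≤ 1 / 10 := by norm_num

lemma rnode_injOn (A L : ℕ) (hA0 : 0 < A)
    (hA : 4 * (L : ℝ) ^ 3 * (1 + Real.log L) ≤ A) (i j : ℕ) (hi : i < L + 1) (hj : j < L + 1)
    (hij : i ≠ j) : (rnode A i : ℝ) ≠ rnode A j := by
  have hA0' : (0 : ℝ) < A := by exact_mod_cast hA0
  have h0 : (rnode A 0 : ℝ) = 128 * A := by simp [rnode]
  rcases i with _ | a <;> rcases j with _ | l
  · exact absurd rfl hij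
  · have := rnode_zero_sub_pos A l hA0
    rw [h0]; intro h; linarith
  · have := rnode_zero_sub_pos A a hA0
    rw [h0]; intro h; linarith
  · have hL1 : (1 : ℝ) ≤ L := by exact_mod_cast (by omega : 1 ≤ L)
    have hlog : 0 ≤ Real.log L := Real.log_nonneg hL1
    have hne : l ≠ a := by omega
    have hd : (1 : ℝ) ≤ |(l : ℝ) - a| := by
      have : (1 : ℤ) ≤ |(l : ℤ) - a| := Int.one_le_abs (by omega)
      exact_mod_cast this
    have h := (factor_le A L a l (by omega) (by omega) hne ?_ hA0).1
    · intro h'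
      rw [h', sub_self, abs_zero] at h
      exact lt_irrefl _ h
    · have h1 : (L : ℝ) ^ 3 / A ≤ 1 / 4 := by
        rw [div_le_iff₀ hA0']
        nlinarith [show (0 : ℝ) ≤ L ^ 3 * Real.log L by positivity]
      have h2 : 1 / |(l : ℝ) - a| ≤ 1 := by
        rw [div_le_one (by linarith)]; exact hd
      have h3 : (0 : ℝ) ≤ 1 / |(l : ℝ) - a| := by positivity
      nlinarith

lemma rnode_pos (A L : ℕ) (hA0 : 0 < A)
    (hA : 4 * (L : ℝ) ^ 3 * (1 + Real.log L) ≤ A) (i : ℕ) (hi : i < L + 1) : 0 < rnode A i := by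
  rcases i with _ | a
  · simp [rnode, hA0]
  · have hL1 : (1 : ℝ) ≤ L := by exact_mod_cast (by omega : 1 ≤ L)
    have hlog : 0 ≤ Real.log L := Real.log_nonneg hL1
    have h1 : (L : ℝ) ^ 3 ≤ A := by
      nlinarith [show (0 : ℝ) ≤ L ^ 3 * Real.log L by positivity, show (0 : ℝ) ≤ L ^ 3 by positivity]
    have h2 : L ^ 3 ≤ A := by exact_mod_cast h1
    unfold rnode
    apply Nat.div_pos _ (by positivity)
    calc (a + 1) ^ 2 ≤ L ^ 2 := by gcongr; omega
      _ ≤ L ^ 3 := Nat.pow_le_pow_right (by omega) (by norm_num)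
      _ ≤ A := h2

lemma rnode_le_zero (A i : ℕ) : rnode A i ≤ 128 * A := by
  rcases i with _ | a
  · simp [rnode]
  · unfold rnode
    exact (Nat.div_le_self _ _).trans (by omega)

lemma lagrange_zero (A L : ℕ) (hA0 : 0 < A)
    (hA : 4 * (L : ℝ) ^ 3 * (1 + Real.log L) ≤ A) (Q : Polynomial ℝ) (hQ : Q.natDegree ≤ L) :
    Q.eval 0 = ∑ i ∈ range (L + 1), wnode A L i * Q.eval (1 / (rnode A i : ℝ)) := by
  have hpos : ∀ i ∈ range (L + 1), (0 : ℝ) < rnode A i := fun i hi => by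
    exact_mod_cast rnode_pos A L hA0 hA i (Finset.mem_range.mp hi)
  have hinj : Set.InjOn (fun i => 1 / (rnode A i : ℝ)) (range (L + 1)) := by
    intro i hi j hj h
    by_contra hij
    have hi' := Finset.mem_range.mp (Finset.mem_coe.mp hi)
    have hj' := Finset.mem_range.mp (Finset.mem_coe.mp hj)
    apply rnode_injOn A L hA0 hA i j hi' hj' hij
    simpa using h
  have hdeg : Q.degree < ((range (L + 1)).card : WithBot ℕ) := by
    rw [Finset.card_range]
    refine lt_of_le_of_lt Polynomial.degree_le_natDegree ?_
    exact_mod_cast Nat.lt_succ_of_le hQ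
  have h := Lagrange.eq_interpolate hinj hdeg
  have h2 := congrArg (Polynomial.eval 0) h
  rw [h2, Lagrange.interpolate_apply, Polynomial.eval_finsetSum]
  refine Finset.sum_congr rfl (fun i hi => ?_)
  rw [Polynomial.eval_mul, Polynomial.eval_C, mul_comm]
  congr 1
  unfold Lagrange.basis wnode
  rw [Polynomial.eval_prod]
  rw [← Finset.mul_prod_erase _ _ hi, if_pos rfl, one_mul]
  refine Finset.prod_congr rfl (fun j hj => ?_)
  have hji := Finset.ne_of_mem_erase hj
  have hjm := Finset.mem_of_mem_erase hj
  rw [if_neg hji]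
  have p1 := hpos i hi
  have p2 := hpos j hjm
  have p3 := rnode_injOn A L hA0 hA i j (Finset.mem_range.mp hi) (Finset.mem_range.mp hjm)
    (Ne.symm hji)
  unfold Lagrange.basisDivisor
  simp only [Polynomial.eval_mul, Polynomial.eval_C, Polynomial.eval_sub, Polynomial.eval_X]
  have p4 : (rnode A i : ℝ) - rnode A j ≠ 0 := sub_ne_zero.mpr p3
  have p5 : 1 / (rnode A i : ℝ) - 1 / rnode A j = - ((rnode A i : ℝ) - rnode A j) / (rnode A i * rnode A j) := by
    field_simp; ring
  rw [p5]
  field_simp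
  ring

lemma wnode_zero_nonneg (A L : ℕ) (hA0 : 0 < A) : 0 ≤ wnode A L 0 := by
  unfold wnode
  refine Finset.prod_nonneg (fun j _ => ?_)
  rcases j with _ | a
  · simp
  · have := rnode_zero_sub_pos A a hA0
    have h0 : (rnode A 0 : ℝ) = 128 * A := by simp [rnode]
    rw [if_neg (by omega), h0]
    positivity

/-- the weights sum to one, and the positive one dominates. -/
lemma wnode_zero_le (A L : ℕ) (hA0 : 0 < A)
    (hA : 4 * (L : ℝ) ^ 3 * (1 + Real.log L) ≤ A) :
    ∑ i ∈ range (L + 1), wnode A L i = 1 ∧ ∑ i ∈ range (L + 1), |wnode A L i| ≤ 6 / 5 := by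
  have h := lagrange_zero A L hA0 hA (Polynomial.C 1) (by simp)
  simp only [Polynomial.eval_C, mul_one] at h
  refine ⟨h.symm, ?_⟩
  rw [Finset.sum_range_succ'] at h ⊢
  rw [abs_of_nonneg (wnode_zero_nonneg A L hA0)]
  have h1 := sum_wnode_succ_le A L hA0 hA
  have h2 := Finset.abs_sum_le_sum_abs (fun a => wnode A L (a + 1)) (range L)
  have h3 := neg_le_abs (∑ a ∈ range L, wnode A L (a + 1))
  linarith

/-- canonical representative of the fibre of `h`. -/
def canon {N : ℕ} {α : Type*} (h : Fin N → α) (i : Fin N) : Fin N :=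
  (Quotient.mk (Setoid.ker h) i).out

lemma canon_eq_iff {N : ℕ} {α : Type*} (h : Fin N → α) (i j : Fin N) :
    canon h i = canon h j ↔ h i = h j := by
  unfold canon
  constructor
  · intro H
    have := congrArg h H
    exact ((Setoid.ker_apply_mk_out (f := h) i).symm.trans this).trans
      (Setoid.ker_apply_mk_out (f := h) j)
  · intro H
    have : (Quotient.mk (Setoid.ker h) i) = Quotient.mk (Setoid.ker h) j := Quotient.sound H
    rw [this]

lemma canon_of_injective {N : ℕ} {α : Type*} (h : Fin N → α) (hh : Function.Injective h) :
    canon h = id := by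
  funext i
  apply hh
  exact Setoid.ker_apply_mk_out i

/-- average over relabelings. -/
def avgL {N : ℕ} {α : Type*} (h : Fin N → α) : ((Fin N → Fin N) → ℝ) →ₗ[ℝ] ℝ :=
  ((N.factorial : ℝ)⁻¹) • ∑ τ : Equiv.Perm (Fin N), LinearMap.proj (fun i => τ (canon h i))

lemma avgL_apply {N : ℕ} {α : Type*} (h : Fin N → α) (G : (Fin N → Fin N) → ℝ) :
    avgL h G = (N.factorial : ℝ)⁻¹ * ∑ τ : Equiv.Perm (Fin N), G (fun i => τ (canon h i)) := by
  simp [avgL]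

/-- average over uniformly random `h` with range of size `r`. -/
def erL (N r : ℕ) : ((Fin N → Fin N) → ℝ) →ₗ[ℝ] ℝ :=
  (((r : ℝ) ^ N)⁻¹) • ∑ h : Fin N → Fin r, avgL h

lemma erL_apply (N r : ℕ) (G : (Fin N → Fin N) → ℝ) :
    erL N r G = ((r : ℝ) ^ N)⁻¹ * ∑ h : Fin N → Fin r, avgL h G := by
  simp [erL]

lemma exists_perm {N : ℕ} {β : Type*} (f g : β → Fin N) (h : ∀ i j, f i = f j ↔ g i = g j) :
    ∃ σ : Equiv.Perm (Fin N), ∀ i, σ (f i) = g i := by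
  classical
  let e : {x // x ∈ Set.range f} ≃ {x // x ∈ Set.range g} :=
    (Setoid.quotientKerEquivRange f).symm.trans
      ((Quotient.congrRight (fun i j => h i j)).trans (Setoid.quotientKerEquivRange g))
  refine ⟨e.extendSubtype, fun i => ?_⟩
  have hi : f i ∈ Set.range f := ⟨i, rfl⟩
  rw [Equiv.extendSubtype_apply_of_mem e (f i) hi]
  have : (Setoid.quotientKerEquivRange f).symm ⟨f i, hi⟩ = Quotient.mk _ i := by
    rw [Equiv.symm_apply_eq]; rfl
  simp only [e, Equiv.trans_apply, this]
  rfl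

lemma avgL_congr {N : ℕ} {α α' : Type*} (B : Finset (Fin N)) (h : Fin N → α) (h' : Fin N → α')
    (hh : ∀ i ∈ B, ∀ j ∈ B, (h i = h j ↔ h' i = h' j)) (G : (Fin N → Fin N) → ℝ)
    (hG : ∀ g g', (∀ i ∈ B, g i = g' i) → G g = G g') : avgL h G = avgL h' G := by
  obtain ⟨σ, hσ⟩ := exists_perm (fun i : B => canon h' i) (fun i : B => canon h i) (by
    intro i j
    rw [canon_eq_iff, canon_eq_iff]
    exact (hh i i.2 j j.2).symm)
  rw [avgL_apply, avgL_apply]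
  congr 1
  rw [← Equiv.sum_comp (Equiv.mulRight σ)
    (fun τ : Equiv.Perm (Fin N) => G (fun i => τ (canon h' i)))]
  refine Finset.sum_congr rfl (fun τ _ => hG _ _ (fun i hi => ?_))
  simp only [Equiv.coe_mulRight, Equiv.Perm.mul_apply]
  rw [hσ ⟨i, hi⟩]

lemma avgL_mono {N : ℕ} {α : Type*} (h : Fin N → α) (G : (Fin N → Fin N) → ℝ)
    (hG : ∀ g, 0 ≤ G g) : 0 ≤ avgL h G := by
  rw [avgL_apply]
  exact mul_nonneg (by positivity) (Finset.sum_nonneg (fun _ _ => hG _))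

lemma erL_nonneg (N r : ℕ) (G : (Fin N → Fin N) → ℝ)
    (hG : ∀ g, 0 ≤ G g) : 0 ≤ erL N r G := by
  rw [erL_apply]
  exact mul_nonneg (by positivity) (Finset.sum_nonneg (fun _ _ => avgL_mono _ _ hG))

lemma avgL_one {N : ℕ} {α : Type*} (h : Fin N → α) : avgL h (fun _ => 1) = 1 := by
  rw [avgL_apply]
  simp only [Finset.sum_const, Finset.card_univ, Fintype.card_perm, Fintype.card_fin,
    nsmul_eq_mul, mul_one]
  exact inv_mul_cancel₀ (by positivity)

lemma erL_one (N r : ℕ) (hr : 0 < r) : erL N r (fun _ => 1) = 1 := by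
  rw [erL_apply]
  simp only [avgL_one, Finset.sum_const, Finset.card_univ, Fintype.card_pi, Finset.prod_const,
    Fintype.card_fin, nsmul_eq_mul, mul_one]
  push_cast
  exact inv_mul_cancel₀ (by positivity)

lemma cast_descFactorial_real (r c : ℕ) :
    (r.descFactorial c : ℝ) = ∏ i ∈ range c, ((r : ℝ) - i) := by
  induction c with
  | zero => simp
  | succ c ih =>
    rw [Nat.descFactorial_succ, Finset.prod_range_succ, ← ih]
    by_cases h : c ≤ r
    · rw [Nat.cast_mul, Nat.cast_sub h]; ring
    · rw [Nat.descFactorial_of_lt (by omega)]; simp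

lemma card_ker_eq {β : Type*} [Fintype β] (s : Setoid β) (r : ℕ) :
    Nat.card {h : β → Fin r // Setoid.ker h = s} = r.descFactorial (Nat.card (Quotient s)) := by
  classical
  have e : {h : β → Fin r // Setoid.ker h = s} ≃ (Quotient s ↪ Fin r) :=
    { toFun := fun h => ⟨Quotient.lift h.1 (fun a b hab => by
          have h2 : Setoid.ker h.1 a b := by rw [h.2]; exact hab
          exact h2), by
          intro a b
          induction a using Quotient.inductionOn
          induction b using Quotient.inductionOn
          intro hab
          apply Quotient.sound
          rename_i x y
          have h2 : Setoid.ker h.1 x y := hab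
          rw [h.2] at h2
          exact h2⟩
      invFun := fun f => ⟨fun b => f (Quotient.mk s b), by
          ext x y
          rw [Setoid.ker_def, f.injective.eq_iff]
          exact Quotient.eq⟩
      left_inv := fun h => by ext; rfl
      right_inv := fun f => by
        ext a
        induction a using Quotient.inductionOn
        rfl }
  rw [Nat.card_congr e]
  have : Fintype (Quotient s) := Fintype.ofFinite _
  rw [Nat.card_eq_fintype_card, Fintype.card_embedding_eq, Fintype.card_fin,
    Nat.card_eq_fintype_card]

lemma ker_poly {β : Type*} [Fintype β] [DecidableEq β] (Ψ : Setoid β → ℝ) :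
    ∃ Q : Polynomial ℝ, Q.natDegree ≤ Fintype.card β ∧
      (∀ r : ℕ, 0 < r → ∑ h : β → Fin r, Ψ (Setoid.ker h)
        = (r : ℝ) ^ Fintype.card β * Q.eval (1 / (r : ℝ))) ∧ Q.eval 0 = Ψ ⊥ := by
  classical
  have hfin : Finite (Setoid β) :=
    Finite.of_injective (fun s : Setoid β => (fun a b => s a b)) (by
      intro s t h
      ext a b
      exact iff_of_eq (congrFun (congrFun h a) b))
  have : Fintype (Setoid β) := Fintype.ofFinite _
  set b := Fintype.card β with hb
  let cc : Setoid β → ℕ := fun s => Nat.card (Quotient s)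
  have hcc : ∀ s, cc s ≤ b := by
    intro s
    have := Nat.card_le_card_of_surjective (Quotient.mk s) Quotient.mk_surjective
    rwa [Nat.card_eq_fintype_card (α := β)] at this
  let P : Setoid β → Polynomial ℝ := fun s =>
    Polynomial.X ^ (b - cc s) * ∏ i ∈ range (cc s), (1 - Polynomial.C (i : ℝ) * Polynomial.X)
  refine ⟨∑ s, Polynomial.C (Ψ s) * P s, ?_, ?_, ?_⟩
  · refine Polynomial.natDegree_sum_le_of_forall_le _ _ (fun s _ => ?_)
    refine (Polynomial.natDegree_C_mul_le _ _).trans ?_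
    refine Polynomial.natDegree_mul_le.trans ?_
    have h1 : (∏ i ∈ range (cc s), (1 - Polynomial.C (i : ℝ) * Polynomial.X)).natDegree ≤ cc s := by
      refine (Polynomial.natDegree_prod_le _ _).trans ?_
      refine (Finset.sum_le_card_nsmul _ _ 1 (fun i _ => ?_)).trans (by simp)
      compute_degree
    have h2 : (Polynomial.X ^ (b - cc s) : Polynomial ℝ).natDegree ≤ b - cc s :=
      Polynomial.natDegree_X_pow_le _
    have := hcc s
    omega
  · intro r hr
    have hr' : (r : ℝ) ≠ 0 := by positivity
    have h1 : ∑ h : β → Fin r, Ψ (Setoid.ker h)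
        = ∑ s, ∑ h : β → Fin r, if Setoid.ker h = s then Ψ s else 0 := by
      rw [Finset.sum_comm]
      simp
    rw [h1, Polynomial.eval_finsetSum, Finset.mul_sum]
    refine Finset.sum_congr rfl (fun s _ => ?_)
    rw [← Finset.sum_filter, Finset.sum_const, nsmul_eq_mul]
    have h2 : (Finset.univ.filter (fun h : β → Fin r => Setoid.ker h = s)).card
        = r.descFactorial (cc s) := by
      rw [← card_ker_eq s r, Nat.card_eq_fintype_card, Fintype.card_subtype]
    rw [h2, cast_descFactorial_real]
    simp only [P, Polynomial.eval_mul, Polynomial.eval_C, Polynomial.eval_pow, Polynomial.eval_X,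
      Polynomial.eval_prod, Polynomial.eval_sub, Polynomial.eval_one]
    have h3 : ∏ i ∈ range (cc s), ((r : ℝ) - i)
        = (r : ℝ) ^ (cc s) * ∏ i ∈ range (cc s), (1 - (i : ℝ) * (1 / r)) := by
      rw [show (r : ℝ) ^ (cc s) = ∏ i ∈ range (cc s), (r : ℝ) by simp, ← Finset.prod_mul_distrib]
      refine Finset.prod_congr rfl (fun i _ => ?_)
      field_simp
    have h4 : (r : ℝ) ^ b * (1 / (r : ℝ)) ^ (b - cc s) = (r : ℝ) ^ cc s := by
      have : b = cc s + (b - cc s) := by have := hcc s; omega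
      nth_rewrite 1 [this]
      rw [pow_add, mul_assoc, ← mul_pow, mul_one_div_cancel hr', one_pow, mul_one]
    rw [h3, ← h4]
    ring
  · rw [Polynomial.eval_finsetSum]
    rw [Finset.sum_eq_single (⊥ : Setoid β)]
    · have h1 : cc ⊥ = b := by
        have h2 : Function.Bijective (Quotient.mk (⊥ : Setoid β)) :=
          ⟨fun x y hxy => Quotient.exact hxy, Quotient.mk_surjective⟩
        have := Nat.card_congr (Equiv.ofBijective _ h2)
        rw [Nat.card_eq_fintype_card (α := β)] at this
        exact this.symm
      simp [P, h1, Polynomial.eval_prod]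
    · intro s _ hs
      have h1 : cc s ≠ b := by
        intro h
        apply hs
        have : Fintype (Quotient s) := Fintype.ofFinite _
        have hc : Fintype.card β = Fintype.card (Quotient s) := by
          rw [← Nat.card_eq_fintype_card (α := Quotient s)]; exact h.symm
        have hbij := (Fintype.bijective_iff_surjective_and_card (Quotient.mk s)).mpr
          ⟨Quotient.mk_surjective, hc⟩
        rw [eq_bot_iff]
        intro x y hxy
        exact hbij.1 (Quotient.sound hxy)
      have h2 := hcc s
      have h3 : b - cc s ≠ 0 := by omega
      simp [P, h3]
    · simp

lemma er_poly {N : ℕ} (B : Finset (Fin N)) (G : (Fin N → Fin N) → ℝ)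
    (hG : ∀ g g', (∀ i ∈ B, g i = g' i) → G g = G g') :
    ∃ Q : Polynomial ℝ, Q.natDegree ≤ B.card ∧
      (∀ r : ℕ, 0 < r → erL N r G = Q.eval (1 / (r : ℝ))) ∧
      Q.eval 0 = avgL (id : Fin N → Fin N) G := by
  classical
  let hs : (s : Setoid B) → Fin N → Option (Quotient s) := fun s i =>
    if hi : i ∈ B then some (Quotient.mk s ⟨i, hi⟩) else none
  let Ψ : Setoid B → ℝ := fun s => avgL (hs s) G
  have hΨ : ∀ {α : Type} (h : Fin N → α), avgL h G = Ψ (Setoid.ker (fun i : B => h i)) := by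
    intro α h
    refine avgL_congr B _ _ ?_ G hG
    intro i hi j hj
    simp only [hs, hi, hj, dif_pos, Option.some.injEq]
    rw [Quotient.eq]
    rfl
  obtain ⟨Q, hQ1, hQ2, hQ3⟩ := ker_poly Ψ
  refine ⟨Q, by simpa using hQ1, ?_, ?_⟩
  · intro r hr
    have hr' : (r : ℝ) ≠ 0 := by positivity
    rw [erL_apply]
    simp_rw [hΨ]
    have h1 : ∑ h : Fin N → Fin r, Ψ (Setoid.ker (fun i : B => h i))
        = (r : ℝ) ^ (N - B.card) * ∑ h : B → Fin r, Ψ (Setoid.ker h) := by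
      rw [← Equiv.sum_comp (Equiv.piEquivPiSubtypeProd (fun i => i ∈ B) (fun _ => Fin r)).symm]
      rw [Fintype.sum_prod_type]
      rw [Finset.mul_sum]
      refine Finset.sum_congr rfl (fun h _ => ?_)
      have : ∀ h' : {i // i ∉ B} → Fin r, (fun i : B =>
          ((Equiv.piEquivPiSubtypeProd (fun i => i ∈ B) (fun _ => Fin r)).symm (h, h')) i) = h := by
        intro h'
        funext i
        simp [Equiv.piEquivPiSubtypeProd]
      simp_rw [this]
      rw [Finset.sum_const, nsmul_eq_mul, Finset.card_univ, Fintype.card_pi]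
      simp
    rw [h1, hQ2 r hr]
    have hb : B.card ≤ N := by simpa using Finset.card_le_univ B
    have h2 : (r : ℝ) ^ N = (r : ℝ) ^ (N - B.card) * (r : ℝ) ^ B.card := by
      rw [← pow_add]; congr 1; omega
    rw [h2, Fintype.card_coe]
    field_simp
  · rw [hQ3, hΨ]
    congr 1
    symm
    rw [Setoid.ker_eq_bot_iff]
    exact fun i j h => Subtype.ext h

/-- probability that a random function is injective. -/
def etaR (N r : ℕ) : ℝ := ((r : ℝ) ^ N)⁻¹ * (r.descFactorial N : ℝ)

open Classical in
lemma erL_inj (N r : ℕ) (G : (Fin N → Fin N) → ℝ) :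
    erL N r (fun g => if Function.Injective g then G g else 0)
      = etaR N r * avgL (id : Fin N → Fin N) G := by
  have h1 : ∀ h : Fin N → Fin r, avgL h (fun g => if Function.Injective g then G g else 0)
      = if Function.Injective h then avgL (id : Fin N → Fin N) G else 0 := by
    intro h
    by_cases hh : Function.Injective h
    · rw [if_pos hh, avgL_apply, avgL_apply, canon_of_injective h hh,
        canon_of_injective id Function.injective_id]
      congr 1
      refine Finset.sum_congr rfl (fun τ _ => ?_)
      rw [if_pos]
      exact τ.injective
    · rw [if_neg hh, avgL_apply]
      rw [Finset.sum_eq_zero, mul_zero]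
      intro τ _
      rw [if_neg]
      intro H
      apply hh
      intro i j hij
      apply H
      simp only
      rw [(canon_eq_iff h i j).mpr hij]
  rw [erL_apply]
  simp_rw [h1]
  rw [← Finset.sum_filter, Finset.sum_const, nsmul_eq_mul, etaR, mul_assoc]
  congr 3
  rw [← Fintype.card_subtype, Fintype.card_congr (Equiv.subtypeInjectiveEquivEmbedding _ _),
    Fintype.card_embedding_eq]
  simp

lemma etaR_nonneg (N r : ℕ) : 0 ≤ etaR N r := by unfold etaR; positivity

lemma etaR_le (N r : ℕ) (hr : 0 < r) (h : 18 * (r : ℝ) ≤ N * (N - 1)) : etaR N r ≤ 1 / 10 := by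
  unfold etaR
  have hr' : (0 : ℝ) < r := by positivity
  by_cases hN : r < N
  · rw [Nat.descFactorial_of_lt hN]; norm_num
  · rw [cast_descFactorial_real]
    have hN := not_lt.mp hN
    calc ((r : ℝ) ^ N)⁻¹ * ∏ i ∈ range N, ((r : ℝ) - i)
        = ∏ i ∈ range N, (1 - (i : ℝ) / r) := by
          rw [show (r : ℝ) ^ N = ∏ i ∈ range N, (r : ℝ) by simp, ← Finset.prod_inv_distrib,
            ← Finset.prod_mul_distrib]
          refine Finset.prod_congr rfl (fun i _ => ?_)
          field_simp
      _ ≤ ∏ i ∈ range N, Real.exp (-((i : ℝ) / r)) := by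
          refine Finset.prod_le_prod (fun i hi => ?_) (fun i _ => ?_)
          · rw [sub_nonneg, div_le_one hr']
            have := Finset.mem_range.mp hi
            exact_mod_cast (by omega : i ≤ r)
          · have := Real.add_one_le_exp (-((i : ℝ) / r)); linarith
      _ = Real.exp (-(N * (N - 1) / 2 / r)) := by
          rw [← Real.exp_sum, Finset.sum_neg_distrib, ← Finset.sum_div]
          congr 3
          have : ∀ n : ℕ, ∑ i ∈ range n, (i : ℝ) = n * (n - 1) / 2 := by
            intro n
            induction n with
            | zero => simp
            | succ n ih => rw [Finset.sum_range_succ, ih]; push_cast; ring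
          exact this N
      _ ≤ 1 / 10 := by
          have h9 : (9 : ℝ) ≤ N * (N - 1) / 2 / r := by
            rw [le_div_iff₀ hr']; linarith
          have := Real.add_one_le_exp ((N : ℝ) * (N - 1) / 2 / r)
          rw [Real.exp_neg, one_div]
          apply inv_anti₀ (by norm_num)
          linarith

/-- binary encoding of a function as a bit string. -/
def encF {N k : ℕ} (g : Fin N → Fin (2 ^ k)) (p : Fin N × Fin k) : Bool :=
  decide ((finFunctionFinEquiv (m := 2) (n := k)).symm (g p.1) p.2 = 1)

lemma gOf_encF {N k : ℕ} (g : Fin N → Fin (2 ^ k)) : gOf (encF g) = g := by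
  funext i
  unfold gOf encF
  rw [← Equiv.eq_symm_apply]
  funext j
  simp only [decide_eq_true_eq]
  generalize (finFunctionFinEquiv (m := 2) (n := k)).symm (g i) j = b
  fin_cases b <;> simp

lemma ED_encF {k : ℕ} (g : Fin (2 ^ k) → Fin (2 ^ k)) :
    ED k (encF g) = true ↔ Function.Injective g := by
  unfold ED
  rw [gOf_encF, decide_eq_true_eq]

open Classical in
/-- push a linear functional forward along the encoding. -/
def pushW {X Y : Type*} (en : X → Y) (Φ : (X → ℝ) →ₗ[ℝ] ℝ) (x : Y) : ℝ :=
  Φ (fun g => if en g = x then 1 else 0)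

lemma pushW_sum {X Y : Type*} [Fintype Y] (en : X → Y) (Φ : (X → ℝ) →ₗ[ℝ] ℝ) (F : Y → ℝ) :
    ∑ x, pushW en Φ x * F x = Φ (fun g => F (en g)) := by
  classical
  unfold pushW
  have : (fun g => F (en g)) = ∑ x, F x • (fun g => if en g = x then (1 : ℝ) else 0) := by
    funext g
    simp [Finset.sum_apply]
  rw [this, map_sum]
  refine Finset.sum_congr rfl (fun x _ => ?_)
  rw [map_smul, smul_eq_mul, mul_comm]

lemma ed_dual_core (k A L : ℕ) (hA0 : 0 < A)
    (hA : 4 * (L : ℝ) ^ 3 * (1 + Real.log L) ≤ A)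
    (hR : 18 * (128 * (A : ℝ)) ≤ ((2 ^ k : ℕ) : ℝ) * (((2 ^ k : ℕ) : ℝ) - 1)) :
    ∃ a b : (Fin (2 ^ k) × Fin k → Bool) → ℝ, (∀ x, 0 ≤ a x) ∧ (∀ x, 0 ≤ b x) ∧
      ∑ x, a x = 1 ∧ ∑ x, b x = 1 ∧
      (∀ S : Finset (Fin (2 ^ k) × Fin k), S.card ≤ L →
        ∑ x, a x * chi S x = ∑ x, b x * chi S x) ∧
      (∀ x, ED k x = true → b x = 0) ∧
      ∑ x, (if ED k x = true then 0 else a x) ≤ 1 / 2 := by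
  classical
  obtain ⟨N, hN⟩ : ∃ N : ℕ, N = 2 ^ k := ⟨_, rfl⟩
  rw [← hN] at hR
  set I := range (L + 1) with hI
  set w := wnode A L with hw
  set r := rnode A with hr
  set wp : ℕ → ℝ := fun i => max (w i) 0 with hwp
  set wm : ℕ → ℝ := fun i => max (-w i) 0 with hwm
  have hwp0 : ∀ i, 0 ≤ wp i := fun i => le_max_right _ _
  have hwm0 : ∀ i, 0 ≤ wm i := fun i => le_max_right _ _
  have hwsub : ∀ i, wp i - wm i = w i := by
    intro i
    simp only [hwp, hwm]
    rcases le_total (w i) 0 with h | h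
    · rw [max_eq_right h, max_eq_left (by linarith)]; ring
    · rw [max_eq_left h, max_eq_right (by linarith)]; ring
  have hwadd : ∀ i, wp i + wm i = |w i| := by
    intro i
    simp only [hwp, hwm]
    rcases le_total (w i) 0 with h | h
    · rw [max_eq_right h, max_eq_left (by linarith), abs_of_nonpos h]; ring
    · rw [max_eq_left h, max_eq_right (by linarith), abs_of_nonneg h]; ring
  obtain ⟨hs1, hs2⟩ := wnode_zero_le A L hA0 hA
  have hS1 : ∑ i ∈ I, wp i - ∑ i ∈ I, wm i = 1 := by
    rw [← Finset.sum_sub_distrib, Finset.sum_congr rfl (fun i _ => hwsub i)]; exact hs1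
  have hS2 : ∑ i ∈ I, wp i + ∑ i ∈ I, wm i ≤ 6 / 5 := by
    rw [← Finset.sum_add_distrib, Finset.sum_congr rfl (fun i _ => hwadd i)]; exact hs2
  have hrpos : ∀ i ∈ I, 0 < r i := fun i hi => rnode_pos A L hA0 hA i (Finset.mem_range.mp hi)
  have heta : ∀ i ∈ I, etaR N (r i) ≤ 1 / 10 := by
    intro i hi
    refine etaR_le N (r i) (hrpos i hi) (le_trans ?_ hR)
    have : (r i : ℝ) ≤ 128 * A := by exact_mod_cast rnode_le_zero A i
    linarith
  set κ := ∑ i ∈ I, wp i * etaR N (r i) with hκ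
  have hκ1 : κ ≤ 11 / 100 := by
    calc κ ≤ ∑ i ∈ I, wp i * (1 / 10) :=
          Finset.sum_le_sum (fun i hi => mul_le_mul_of_nonneg_left (heta i hi) (hwp0 i))
      _ = (∑ i ∈ I, wp i) * (1 / 10) := by rw [Finset.sum_mul]
      _ ≤ 11 / 100 := by linarith
  let av : ((Fin N → Fin N) → ℝ) →ₗ[ℝ] ℝ := avgL (id : Fin N → Fin N)
  let Φ : ((Fin N → Fin N) → ℝ) →ₗ[ℝ] ℝ := (1 - κ) • av + ∑ i ∈ I, wm i • erL N (r i)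
  let Ψ : ((Fin N → Fin N) → ℝ) →ₗ[ℝ] ℝ := (∑ i ∈ I, wp i • erL N (r i)) - κ • av
  have hΦ : ∀ G, Φ G = (1 - κ) * av G + ∑ i ∈ I, wm i * erL N (r i) G := by
    intro G; simp [Φ]
  have hΨ : ∀ G, Ψ G = ∑ i ∈ I, wp i * erL N (r i) G - κ * av G := by
    intro G; simp [Ψ]
  have hΨ' : ∀ G, Ψ G = ∑ i ∈ I, wp i * erL N (r i)
      (fun g => if Function.Injective g then 0 else G g) := by
    intro G
    rw [hΨ, hκ, Finset.sum_mul, ← Finset.sum_sub_distrib]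
    refine Finset.sum_congr rfl (fun i _ => ?_)
    rw [mul_assoc, ← erL_inj, ← mul_sub, ← map_sub]
    congr 2
    funext g
    by_cases h : Function.Injective g <;> simp [h]
  have havinj : ∀ G G' : (Fin N → Fin N) → ℝ, (∀ g, Function.Injective g → G g = G' g) →
      av G = av G' := by
    intro G G' h
    simp only [av]
    rw [avgL_apply, avgL_apply, canon_of_injective id Function.injective_id]
    congr 1
    refine Finset.sum_congr rfl (fun τ _ => h _ τ.injective)
  have hΦ0 : ∀ G, (∀ g, 0 ≤ G g) → 0 ≤ Φ G := by
    intro G hG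
    rw [hΦ]
    refine add_nonneg (mul_nonneg (by linarith) (avgL_mono _ _ hG)) ?_
    exact Finset.sum_nonneg (fun i _ => mul_nonneg (hwm0 i) (erL_nonneg _ _ _ hG))
  have hΨ0 : ∀ G, (∀ g, 0 ≤ G g) → 0 ≤ Ψ G := by
    intro G hG
    rw [hΨ']
    refine Finset.sum_nonneg (fun i _ => mul_nonneg (hwp0 i) (erL_nonneg _ _ _ (fun g => ?_)))
    split_ifs
    · exact le_rfl
    · exact hG g
  have heq : ∀ (B : Finset (Fin N)) G, B.card ≤ L → (∀ g g', (∀ i ∈ B, g i = g' i) → G g = G g') →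
      Φ G = Ψ G := by
    intro B G hB hG
    obtain ⟨Q, hQ1, hQ2, hQ3⟩ := er_poly B G hG
    have h := lagrange_zero A L hA0 hA Q (hQ1.trans hB)
    have h2 : av G = ∑ i ∈ I, w i * erL N (r i) G := by
      simp only [av]
      rw [← hQ3, h]
      refine Finset.sum_congr rfl (fun i hi => ?_)
      rw [hQ2 (r i) (hrpos i hi)]
    have h3 : ∑ i ∈ I, w i * erL N (r i) G
        = ∑ i ∈ I, wp i * erL N (r i) G - ∑ i ∈ I, wm i * erL N (r i) G := by
      rw [← Finset.sum_sub_distrib]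
      refine Finset.sum_congr rfl (fun i _ => ?_)
      rw [← hwsub i]; ring
    rw [hΦ, hΨ]
    linarith
  set Z := Φ (fun _ => 1) with hZ
  have hav1 : av (fun _ => 1) = 1 := avgL_one _
  have hZ1 : Z = (1 - κ) + ∑ i ∈ I, wm i := by
    rw [hZ, hΦ, hav1, mul_one]
    congr 1
    refine Finset.sum_congr rfl (fun i hi => ?_)
    rw [erL_one N _ (hrpos i hi), mul_one]
  have hZ2 : Ψ (fun _ => 1) = Z := (heq ∅ _ (by simp) (by simp)).symm
  have hwmS : 0 ≤ ∑ i ∈ I, wm i := Finset.sum_nonneg (fun i _ => hwm0 i)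
  have hZpos : 8 / 10 ≤ Z := by linarith
  have hZp : 0 < Z := by linarith
  subst hN
  let en : (Fin (2 ^ k) → Fin (2 ^ k)) → (Fin (2 ^ k) × Fin k → Bool) := encF
  have hdiv : ∀ (Θ : ((Fin (2 ^ k) → Fin (2 ^ k)) → ℝ) →ₗ[ℝ] ℝ)
      (F : (Fin (2 ^ k) × Fin k → Bool) → ℝ), ∑ x, pushW en Θ x / Z * F x
        = Θ (fun g => F (en g)) / Z := by
    intro Θ F
    rw [← pushW_sum, Finset.sum_div]
    refine Finset.sum_congr rfl (fun x _ => ?_)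
    ring
  refine ⟨fun x => pushW en Φ x / Z, fun x => pushW en Ψ x / Z, ?_, ?_, ?_, ?_, ?_, ?_, ?_⟩
  · intro x
    refine div_nonneg (hΦ0 _ (fun g => ?_)) hZp.le
    split_ifs <;> norm_num
  · intro x
    refine div_nonneg (hΨ0 _ (fun g => ?_)) hZp.le
    split_ifs <;> norm_num
  · have := hdiv Φ (fun _ => 1)
    simp only [mul_one] at this
    rw [this, ← hZ]
    exact div_self hZp.ne'
  · have := hdiv Ψ (fun _ => 1)
    simp only [mul_one] at this
    rw [this, hZ2]
    exact div_self hZp.ne'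
  · intro S hS
    rw [hdiv, hdiv]
    congr 1
    refine heq (S.image Prod.fst) _ (Finset.card_image_le.trans hS) ?_
    intro g g' h
    unfold chi
    refine Finset.prod_congr rfl (fun p hp => ?_)
    have := h p.1 (Finset.mem_image_of_mem _ hp)
    simp only [en, encF, this]
  · intro x hx
    have : pushW en Ψ x = 0 := by
      unfold pushW
      rw [hΨ']
      refine Finset.sum_eq_zero (fun i _ => ?_)
      refine mul_eq_zero_of_right _ ?_
      refine Eq.trans (congrArg _ ?_) (map_zero (erL (2 ^ k) (r i)))
      · funext g
        by_cases h : Function.Injective g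
        · simp [h]
        · have : en g ≠ x := by
            rintro rfl
            exact h ((ED_encF g).mp hx)
          simp [h, this]
    simp only [this, zero_div]
  · have h1 := hdiv Φ (fun x => if ED k x = true then 0 else 1)
    simp only [mul_ite, mul_zero, mul_one] at h1
    rw [h1, div_le_iff₀ hZp, hΦ]
    have h2 : av (fun g => if ED k (en g) = true then 0 else 1) = av 0 := by
      apply havinj
      intro g hg
      simp only [en]
      rw [if_pos ((ED_encF g).mpr hg)]
      rfl
    rw [h2, map_zero, mul_zero, zero_add]
    have h3 : ∑ i ∈ I, wm i * erL (2 ^ k) (r i) (fun g => if ED k (en g) = true then 0 else 1)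
        ≤ ∑ i ∈ I, wm i := by
      refine Finset.sum_le_sum (fun i hi => ?_)
      have h4 : 0 ≤ erL (2 ^ k) (r i) ((fun _ => 1) -
          (fun g => if ED k (en g) = true then 0 else 1)) := by
        apply erL_nonneg
        intro g
        simp only [Pi.sub_apply]
        split_ifs <;> norm_num
      rw [map_sub, erL_one _ _ (hrpos i hi)] at h4
      have := mul_le_mul_of_nonneg_left (sub_nonneg.mp h4) (hwm0 i)
      linarith
    linarith

lemma node_cond (m L : ℕ) (hm : 2 ≤ m) (hL : 40 * m * L ≤ 4 ^ m) :
    4 * (L : ℝ) ^ 3 * (1 + Real.log L) ≤ ((2 ^ (6 * m - 12) : ℕ) : ℝ) := by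
  rcases Nat.eq_zero_or_pos L with h0 | hpos
  · subst h0
    have : (0 : ℝ) ≤ ((2 ^ (6 * m - 12) : ℕ) : ℝ) := Nat.cast_nonneg _
    simpa using this
  have hLr : (0 : ℝ) < L := by exact_mod_cast hpos
  have hmr : (2 : ℝ) ≤ m := by exact_mod_cast hm
  have hL' : 40 * (m : ℝ) * L ≤ 4 ^ m := by exact_mod_cast hL
  have hLle : (L : ℝ) ≤ 4 ^ m := by nlinarith
  have hlog : Real.log L ≤ m * 2 := by
    calc Real.log L ≤ Real.log ((4 : ℝ) ^ m) := Real.log_le_log hLr hLle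
      _ = m * Real.log 4 := by rw [Real.log_pow]
      _ ≤ m * 2 := by
        have : Real.log 4 = 2 * Real.log 2 := by
          rw [show (4 : ℝ) = 2 ^ 2 by norm_num, Real.log_pow]; norm_num
        have h2 := Real.log_two_lt_d9
        have : Real.log 4 ≤ 2 := by linarith
        gcongr
  have hA : (4096 : ℝ) * ((2 ^ (6 * m - 12) : ℕ) : ℝ) = (4 ^ m) ^ 3 := by
    push_cast
    rw [show (4096 : ℝ) = 2 ^ 12 by norm_num, show (4 : ℝ) = 2 ^ 2 by norm_num, ← pow_add,
      ← pow_mul, ← pow_mul]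
    congr 1
    omega
  have hcube : (40 * (m : ℝ) * L) ^ 3 ≤ (4 ^ m) ^ 3 := by gcongr
  have h1 : 4 * (L : ℝ) ^ 3 * (1 + Real.log L) ≤ 4 * (L : ℝ) ^ 3 * (3 * m) := by
    gcongr
    linarith
  have hm3 : (m : ℝ) ≤ m ^ 3 := by nlinarith [mul_nonneg (by linarith : (0:ℝ) ≤ m) (by linarith : (0:ℝ) ≤ (m:ℝ) - 2)]
  have h2 : (m : ℝ) * (L : ℝ) ^ 3 ≤ m ^ 3 * (L : ℝ) ^ 3 := by gcongr
  have h3 : (40 * (m : ℝ) * L) ^ 3 = 64000 * (m ^ 3 * (L : ℝ) ^ 3) := by ring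
  have h4 : 0 ≤ (m : ℝ) * (L : ℝ) ^ 3 := by positivity
  nlinarith

lemma range_cond (m : ℕ) (hm : 2 ≤ m) :
    18 * (128 * ((2 ^ (6 * m - 12) : ℕ) : ℝ)) ≤
      ((2 ^ (3 * m) : ℕ) : ℝ) * (((2 ^ (3 * m) : ℕ) : ℝ) - 1) := by
  have hA : (4096 : ℝ) * ((2 ^ (6 * m - 12) : ℕ) : ℝ) = ((2 ^ (3 * m) : ℕ) : ℝ) ^ 2 := by
    push_cast
    rw [show (4096 : ℝ) = 2 ^ 12 by norm_num, ← pow_add, ← pow_mul]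
    congr 1
    omega
  have hN : (64 : ℝ) ≤ ((2 ^ (3 * m) : ℕ) : ℝ) := by
    have : 2 ^ 6 ≤ 2 ^ (3 * m) := Nat.pow_le_pow_right (by norm_num) (by omega)
    exact_mod_cast this
  nlinarith

lemma weight_bound (n m L : ℕ) (hm : 2 ≤ m) (hL : 40 * m * L ≤ 4 ^ m)
    (e : Fin (4 ^ m) × (Fin (2 ^ (3 * m)) × Fin (3 * m)) → Fin n) (he : Function.Injective e)
    (F : (Fin n → Bool) → Bool)
    (hF : ∀ x, F x = orBlock (4 ^ m) (ED (3 * m)) (fun p => x (e p)))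
    (q : Finset (Fin 3 × Fin n) → ℤ)
    (hq : ∀ x, 0 < bval (selComp F x) * polyOf (fun S => (q S : ℝ)) x) :
    (2 : ℝ) ^ L ≤ ∑ S, |(q S : ℝ)| := by
  by_contra hcon
  have hcon := not_le.mp hcon
  obtain ⟨c, hc1, hc2, hc3⟩ := krause F q hq L hcon.le
  obtain ⟨a, b, ha0, hb0, ha1, hb1, hab, hbf, haf⟩ := ed_dual_core (3 * m) (2 ^ (6 * m - 12)) L
    (by positivity) (node_cond m L hm hL) (range_cond m hm)
  have h := or_step (ED (3 * m)) e he F hF L a b ha0 hb0 ha1 hb1 hab hbf haf c hc1 hc3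
  have h4 : 16 ≤ 4 ^ m := by
    calc 16 = 4 ^ 2 := by norm_num
      _ ≤ 4 ^ m := Nat.pow_le_pow_right (by norm_num) hm
  have hLt : L + 1 ≤ 4 ^ m := by nlinarith
  have h5 : (2 : ℝ) ^ (L + 1) ≤ 2 ^ (4 ^ m) := pow_le_pow_right₀ (by norm_num) hLt
  rw [pow_succ] at h5
  linarith

lemma exponent_bound (n m L : ℕ) (hm : 4 ≤ m) (h1 : 3 * m * 32 ^ m ≤ n)
    (h2 : n < 3 * (m + 1) * 32 ^ (m + 1)) (hL : L = 4 ^ m / (40 * m)) :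
    (1 / 15360 : ℝ) * (n : ℝ) ^ ((2 : ℝ) / 5) / (Real.logb 2 (n : ℝ)) ^ (2 : ℝ) ≤ L := by
  have hmr : (4 : ℝ) ≤ m := by exact_mod_cast hm
  have hlow : (m : ℝ) ≤ Real.logb 2 n := by
    have hn : (2 : ℝ) ^ m ≤ n := by
      have : 2 ^ m ≤ n := by
        calc 2 ^ m ≤ 32 ^ m := Nat.pow_le_pow_left (by norm_num) m
          _ ≤ 3 * m * 32 ^ m := Nat.le_mul_of_pos_left _ (by omega)
          _ ≤ n := h1
      exact_mod_cast this
    have h := Real.logb_le_logb_of_le (b := 2) (by norm_num) (by positivity) hn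
    rwa [Real.logb_pow, Real.logb_self_eq_one (by norm_num), mul_one] at h
  have hLlow : (4 : ℝ) ^ m / (80 * m) ≤ L := by
    have h40 : 40 * m ≤ 4 ^ m := by
      clear h1 h2 hL hmr hlow
      induction m, hm using Nat.le_induction with
      | base => norm_num
      | succ m hm ih => rw [pow_succ]; omega
    have hlt : 4 ^ m < 40 * m * (L + 1) := by
      rw [hL]; exact Nat.lt_mul_div_succ _ (by omega)
    have hLpos : 1 ≤ L := by
      rw [hL]; exact (Nat.one_le_div_iff (by omega)).mpr h40
    have hlt' : (4 : ℝ) ^ m < 40 * m * (L + 1) := by exact_mod_cast hlt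
    have hLp' : (1 : ℝ) ≤ L := by exact_mod_cast hLpos
    rw [div_le_iff₀ (by positivity)]
    nlinarith
  have hup : (n : ℝ) ^ ((2 : ℝ) / 5) ≤ 96 * (m + 1) * 4 ^ m := by
    have hn : (n : ℝ) ≤ 96 * (m + 1) * 32 ^ m := by
      have : (n : ℝ) < 3 * (m + 1) * 32 ^ (m + 1) := by exact_mod_cast h2
      rw [pow_succ] at this
      linarith
    calc (n : ℝ) ^ ((2 : ℝ) / 5) ≤ (96 * (m + 1) * 32 ^ m) ^ ((2 : ℝ) / 5) :=
          Real.rpow_le_rpow (by positivity) hn (by norm_num)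
      _ = (96 * (m + 1)) ^ ((2 : ℝ) / 5) * ((32 : ℝ) ^ m) ^ ((2 : ℝ) / 5) :=
          Real.mul_rpow (by positivity) (by positivity)
      _ = (96 * (m + 1)) ^ ((2 : ℝ) / 5) * 4 ^ m := by
          congr 1
          rw [show (32 : ℝ) ^ m = (2 ^ m) ^ 5 by rw [← pow_mul, mul_comm, pow_mul]; norm_num,
            ← Real.rpow_natCast ((2 : ℝ) ^ m) 5, ← Real.rpow_mul (by positivity)]
          norm_num
          rw [← pow_mul, mul_comm, pow_mul]; norm_num
      _ ≤ (96 * (m + 1)) ^ (1 : ℝ) * 4 ^ m := by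
          gcongr
          · nlinarith
          · norm_num
      _ = 96 * (m + 1) * 4 ^ m := by rw [Real.rpow_one]
  rw [Real.rpow_two]
  refine le_trans ?_ hLlow
  have hm0 : (0 : ℝ) < m := by linarith
  have hsq : (m : ℝ) ^ 2 ≤ Real.logb 2 n ^ 2 := by gcongr
  calc (1 / 15360 : ℝ) * (n : ℝ) ^ ((2 : ℝ) / 5) / Real.logb 2 n ^ 2
      ≤ (1 / 15360 : ℝ) * (96 * (m + 1) * 4 ^ m) / (m : ℝ) ^ 2 := by gcongr
    _ ≤ (1 / 15360 : ℝ) * (96 * (m + m) * 4 ^ m) / (m : ℝ) ^ 2 := by gcongr; linarith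
    _ = (4 : ℝ) ^ m / (80 * m) := by field_simp; norm_num

/-- there are constants `c, C > 0` such that for all large `n` there is
an `OR ∘ ED` circuit `F` on `n` variables whose selector composition `F'` has threshold
weight at least `2^{c·n^{2/5}/(log₂ n)^C}`: every integer polynomial threshold function
for `F'` (of any degree) has at least this weight. -/
theorem ac0_threshold_weight :
    ∃ c C : ℝ, 0 < c ∧ 0 < C ∧ ∃ n₀ : ℕ, ∀ n : ℕ, n₀ ≤ n →
      ∃ F : (Fin n → Bool) → Bool, IsOrED F ∧
        ∀ q : Finset (Fin 3 × Fin n) → ℤ,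
          (∀ x, 0 < bval (selComp F x) * polyOf (fun S => (q S : ℝ)) x) →
          (2 : ℝ) ^ (c * (n : ℝ) ^ ((2 : ℝ) / 5) / (Real.logb 2 (n : ℝ)) ^ C)
            ≤ ((∑ S : Finset (Fin 3 × Fin n), |q S| : ℤ) : ℝ) := by
  refine ⟨1 / 15360, 2, by norm_num, by norm_num, 3 * 4 * 32 ^ 4, fun n hn => ?_⟩
  let P : ℕ → Prop := fun m => 3 * m * 32 ^ m ≤ n
  obtain ⟨m, hmdef⟩ : ∃ m, m = Nat.findGreatest P n := ⟨_, rfl⟩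
  have hm4 : 4 ≤ m := by
    rw [hmdef]
    exact Nat.le_findGreatest (le_trans (by norm_num) hn) hn
  have h1 : 3 * m * 32 ^ m ≤ n := by
    have : P (Nat.findGreatest P n) := Nat.findGreatest_spec (m := 4)
      (le_trans (by norm_num) hn) hn
    rw [← hmdef] at this
    exact this
  have h2 : n < 3 * (m + 1) * 32 ^ (m + 1) := by
    by_contra hcon
    have hcon : P (m + 1) := not_lt.mp hcon
    have hle : m + 1 ≤ n := by
      have : 1 ≤ 32 ^ m := Nat.one_le_pow _ _ (by norm_num)
      nlinarith
    exact Nat.findGreatest_is_greatest (by omega) hle hcon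
  have hcard : 4 ^ m * (2 ^ (3 * m) * (3 * m)) ≤ n := by
    refine le_trans (le_of_eq ?_) h1
    rw [pow_mul, show (32 : ℕ) = 4 * 2 ^ 3 by norm_num, mul_pow]
    ring
  obtain ⟨e⟩ : Nonempty (Fin (4 ^ m) × (Fin (2 ^ (3 * m)) × Fin (3 * m)) ↪ Fin n) := by
    apply Function.Embedding.nonempty_of_card_le
    simpa using hcard
  refine ⟨fun x => orBlock (4 ^ m) (ED (3 * m)) (fun p => x (e p)),
    ⟨4 ^ m, 3 * m, e, e.injective, hcard, fun x => rfl⟩, fun q hq => ?_⟩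
  have hW := weight_bound n m (4 ^ m / (40 * m)) (by omega) (Nat.mul_div_le _ _) e e.injective
    _ (fun x => rfl) q hq
  have hE := exponent_bound n m (4 ^ m / (40 * m)) hm4 h1 h2 rfl
  push_cast
  refine le_trans ?_ hW
  rw [← Real.rpow_natCast]
  exact Real.rpow_le_rpow_of_exponent_le (by norm_num) hE

end
end

section
/- For every integer d ≥ 2 there exists a constant c > 0 such that for every integer M ≥ 2, with n = M^d, the depth-d AND-OR tree AND-OR_{d,n} on n variables satisfies deg̃_{1/3}(AND-OR_{d,n}) ≥ c·n^{1/2}/(log₂n)^{(d−2)/2}. -/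
open Finset

noncomputable section

/-- The coefficient family `c` has degree at most `d`. -/
def degLE {ι : Type*} (c : Finset ι → ℝ) (d : ℕ) : Prop :=
  ∀ S : Finset ι, d < S.card → c S = 0

/-- `p` is a pointwise `ε`-approximation to the Boolean function `f`. -/
def IsApprox {ι : Type*} (f : (ι → Bool) → Bool) (p : (ι → Bool) → ℝ) (ε : ℝ) : Prop :=
  ∀ x, |p x - bval (f x)| ≤ ε

/-- The `ε`-approximate degree `deg̃_ε(f)`. -/
def adeg {ι : Type*} [Fintype ι] (ε : ℝ) (f : (ι → Bool) → Bool) : ℕ :=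
  sInf {d | ∃ c : Finset ι → ℝ, degLE c d ∧ IsApprox f (polyOf c) ε}

/-- The depth-`D` alternating AND-OR tree with all fan-ins `M`, whose `M^D` leaves are
indexed by paths `Fin D → Fin M`; the root gate is AND if `g = true` and OR if
`g = false`, and gate types alternate down the tree. A gate is TRUE (`true`, i.e. `-1`)
according to the usual semantics: AND is TRUE iff all children are TRUE, OR is TRUE iff
some child is TRUE. -/
def AOT (M : ℕ) : (D : ℕ) → Bool → ((Fin D → Fin M) → Bool) → Bool
  | 0, _, x => x Fin.elim0
  | D + 1, g, x =>
      let sub : Fin M → Bool := fun i => AOT M D (!g) (fun path => x (Fin.cons i path))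
      if g then decide (∀ i, sub i = true) else decide (∃ i, sub i = true)


/-- Monomial with exponent vector `e`. -/
def mon {ι : Type*} [Fintype ι] (e : ι → ℕ) (x : ι → Bool) : ℝ := ∏ i, bval (x i) ^ e i

/-- The two weight functions agree on all monomials of degree less than `d`. -/
def MatchD {ι : Type*} [Fintype ι] [DecidableEq ι] (d : ℕ) (μ ν : (ι → Bool) → ℝ) : Prop :=
  ∀ e : ι → ℕ, ∑ i, e i < d → ∑ x, μ x * mon e x = ∑ x, ν x * mon e x

/-- Mass of the TRUE inputs. -/
def tmass {ι : Type*} [Fintype ι] [DecidableEq ι] (f : (ι → Bool) → Bool)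
    (μ : (ι → Bool) → ℝ) : ℝ := ∑ x, if f x then μ x else 0

/-- Probability weights. -/
def IsProb {α : Type*} [Fintype α] (μ : α → ℝ) : Prop := (∀ x, 0 ≤ μ x) ∧ ∑ x, μ x = 1

/-- `f` is hard for degree less than `d`, with FALSE-error `a` and TRUE-error `b`. -/
def Hard {ι : Type*} [Fintype ι] [DecidableEq ι] (f : (ι → Bool) → Bool) (d : ℕ)
    (a b : ℝ) : Prop :=
  ∃ μ ν : (ι → Bool) → ℝ, IsProb μ ∧ IsProb ν ∧ MatchD d μ ν ∧
    tmass f μ ≤ a ∧ 1 - b ≤ tmass f ν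

lemma Hard.mono {ι : Type*} [Fintype ι] [DecidableEq ι] {f : (ι → Bool) → Bool} {d : ℕ}
    {a b a' b' : ℝ} (h : Hard f d a b) (ha : a ≤ a') (hb : b ≤ b') : Hard f d a' b' := by
  obtain ⟨μ, ν, h1, h2, h3, h4, h5⟩ := h
  exact ⟨μ, ν, h1, h2, h3, by linarith, by linarith⟩

lemma bval_not (b : Bool) : bval (!b) = - bval b := by cases b <;> simp [bval]

lemma sum_not {ι : Type*} [Fintype ι] [DecidableEq ι] (F : (ι → Bool) → ℝ) :
    ∑ x : ι → Bool, F (fun i => !(x i)) = ∑ x, F x := by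
  let E : (ι → Bool) ≃ (ι → Bool) :=
    ⟨fun x i => !(x i), fun x i => !(x i), fun x => by simp, fun x => by simp⟩
  exact Equiv.sum_comp E F

lemma Hard.dual {ι : Type*} [Fintype ι] [DecidableEq ι] {f g : (ι → Bool) → Bool} {d : ℕ}
    {a b : ℝ} (h : Hard f d a b) (hg : ∀ x, g x = !(f fun i => !(x i))) : Hard g d b a := by
  obtain ⟨μ, ν, h1, h2, h3, h4, h5⟩ := h
  have key : ∀ ρ : (ι → Bool) → ℝ, IsProb ρ →
      tmass g (fun x => ρ (fun i => !(x i))) = 1 - tmass f ρ := by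
    intro ρ hρ
    have := sum_not (fun x => if f x then (0:ℝ) else ρ x)
    unfold tmass
    rw [eq_sub_iff_add_eq, ← hρ.2]
    rw [← sum_not (fun x => if f x then ρ x else (0:ℝ)), ← sum_not ρ, ← Finset.sum_add_distrib]
    refine Finset.sum_congr rfl fun x _ => ?_
    rw [hg]
    cases f (fun i => !(x i)) <;> simp
  refine ⟨fun x => ν (fun i => !(x i)), fun x => μ (fun i => !(x i)),
    ⟨fun x => h2.1 _, (sum_not ν).trans h2.2⟩, ⟨fun x => h1.1 _, (sum_not μ).trans h1.2⟩,
    ?_, ?_, ?_⟩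
  · intro e he
    have hm : ∀ x, mon e x = (∏ i, (-1 : ℝ) ^ e i) * mon e (fun i => !(x i)) := by
      intro x
      unfold mon
      rw [← Finset.prod_mul_distrib]
      refine Finset.prod_congr rfl fun i _ => ?_
      rw [bval_not, ← mul_pow]; simp
    have hh : ∀ ρ : (ι → Bool) → ℝ, ∑ x, ρ (fun i => !(x i)) * mon e x
        = (∏ i, (-1 : ℝ) ^ e i) * ∑ x, ρ x * mon e x := by
      intro ρ
      rw [← sum_not (fun x => ρ x * mon e x), Finset.mul_sum]
      refine Finset.sum_congr rfl fun x _ => ?_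
      rw [hm x]; ring
    rw [hh, hh, h3 e he]
  · rw [key ν h2]; linarith
  · rw [key μ h1]; linarith

lemma Hard.reindex {ι κ : Type*} [Fintype ι] [DecidableEq ι] [Fintype κ] [DecidableEq κ]
    {g : (κ → Bool) → Bool} {f : (ι → Bool) → Bool} {d : ℕ}
    {a b : ℝ} (h : Hard g d a b) (σ : ι → κ) (hg : ∀ x, f (fun i => x (σ i)) = g x) :
    Hard f d a b := by
  obtain ⟨μ, ν, h1, h2, h3, h4, h5⟩ := h
  let push : ((κ → Bool) → ℝ) → (ι → Bool) → ℝ :=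
    fun ρ y => ∑ x, if (fun i => x (σ i)) = y then ρ x else 0
  have key : ∀ (ρ : (κ → Bool) → ℝ) (F : (ι → Bool) → ℝ),
      ∑ y, push ρ y * F y = ∑ x, ρ x * F (fun i => x (σ i)) := by
    intro ρ F
    simp only [push, Finset.sum_mul]
    rw [Finset.sum_comm]
    refine Finset.sum_congr rfl fun x _ => ?_
    simp [ite_mul]
  have kp : ∀ ρ, IsProb ρ → IsProb (push ρ) := by
    intro ρ hρ
    refine ⟨fun y => Finset.sum_nonneg fun x _ => ?_, ?_⟩
    · split_ifs
      · exact hρ.1 x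
      · exact le_rfl
    · have := key ρ (fun _ => 1)
      simpa [hρ.2] using this
  have kt : ∀ ρ, tmass f (push ρ) = tmass g ρ := by
    intro ρ
    have := key ρ (fun y => if f y then 1 else 0)
    simpa [tmass, hg] using this
  refine ⟨push μ, push ν, kp _ h1, kp _ h2, ?_, by rw [kt]; exact h4, by rw [kt]; exact h5⟩
  intro e he
  rw [key, key]
  have hm : ∀ x : κ → Bool, mon e (fun i => x (σ i))
      = mon (fun k => ∑ i with σ i = k, e i) x := by
    intro x
    unfold mon
    rw [← Finset.prod_fiberwise (s := Finset.univ) (g := σ)]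
    refine Finset.prod_congr rfl fun k _ => ?_
    rw [← Finset.prod_pow_eq_pow_sum]
    refine Finset.prod_congr rfl fun i hi => ?_
    have := (Finset.mem_filter.1 hi).2
    simp only [this]
  simp only [hm]
  apply h3
  rw [Finset.sum_fiberwise]
  exact he

lemma chi_eq_mon {ι : Type*} [Fintype ι] [DecidableEq ι] (S : Finset ι) (x : ι → Bool) :
    chi S x = mon (fun i => if i ∈ S then 1 else 0) x := by
  unfold chi mon
  simp [pow_ite]

/-- Every function on the cube is a polynomial. -/
lemma exists_poly {ι : Type*} [Fintype ι] [DecidableEq ι] (g : (ι → Bool) → ℝ) :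
    ∃ c : Finset ι → ℝ, ∀ x, polyOf c x = g x := by
  refine ⟨fun S => ((2:ℝ) ^ Fintype.card ι)⁻¹ * ∑ y, g y * chi S y, fun x => ?_⟩
  have horth : ∀ y, ∑ S : Finset ι, chi S y * chi S x
      = if y = x then (2:ℝ) ^ Fintype.card ι else 0 := by
    intro y
    have h := Fintype.prod_add (fun i => bval (y i) * bval (x i)) (fun _ : ι => (1:ℝ))
    simp only [Finset.prod_const_one, mul_one, Finset.prod_mul_distrib] at h
    unfold chi
    rw [← h]
    split_ifs with hxy
    · subst hxy
      have : ∀ i, bval (y i) * bval (y i) + 1 = 2 := by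
        intro i; cases y i <;> norm_num [bval]
      simp [this, Finset.card_univ]
    · obtain ⟨i, hi⟩ := Function.ne_iff.1 hxy
      apply Finset.prod_eq_zero (Finset.mem_univ i)
      cases hy : y i <;> cases hx : x i <;> simp_all [bval]
  unfold polyOf
  simp only [mul_assoc, Finset.sum_mul]
  rw [← Finset.mul_sum, Finset.sum_comm]
  simp only [← Finset.mul_sum, horth]
  simp
  field_simp

lemma Hard.adeg_le {ι : Type*} [Fintype ι] [DecidableEq ι] {f : (ι → Bool) → Bool} {d : ℕ}
    {a b : ℝ} (h : Hard f d a b) (hab : a + b < 2/3) : d ≤ adeg (1/3) f := by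
  obtain ⟨μ, ν, h1, h2, h3, h4, h5⟩ := h
  unfold adeg
  apply le_csInf
  · obtain ⟨c, hc⟩ := exists_poly (fun x => bval (f x))
    refine ⟨Fintype.card ι, c, ?_, ?_⟩
    · intro S hS
      exact absurd (Finset.card_le_univ S) (not_le.2 hS)
    · intro x; rw [hc]; norm_num
  · rintro n ⟨c, hc, hp⟩
    by_contra hlt
    push Not at hlt
    have heq : ∑ x, μ x * polyOf c x = ∑ x, ν x * polyOf c x := by
      unfold polyOf
      simp only [Finset.mul_sum]
      rw [Finset.sum_comm, Finset.sum_comm (f := fun x S => ν x * (c S * chi S x))]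
      refine Finset.sum_congr rfl fun S _ => ?_
      simp only [mul_left_comm _ (c S)]
      rw [← Finset.mul_sum, ← Finset.mul_sum]
      by_cases hS : n < S.card
      · rw [hc S hS]; simp
      · congr 1
        simp only [chi_eq_mon]
        apply h3
        simp
        omega
    have hb : ∀ ρ : (ι → Bool) → ℝ, IsProb ρ →
        |∑ x, ρ x * polyOf c x - (1 - 2 * tmass f ρ)| ≤ 1/3 := by
      intro ρ hρ
      have : ∑ x, ρ x * polyOf c x - (1 - 2 * tmass f ρ)
          = ∑ x, ρ x * (polyOf c x - bval (f x)) := by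
        rw [← hρ.2]
        unfold tmass
        rw [Finset.mul_sum, ← Finset.sum_sub_distrib, ← Finset.sum_sub_distrib]
        refine Finset.sum_congr rfl fun x _ => ?_
        cases f x <;> simp [bval] <;> ring
      rw [this]
      refine (Finset.abs_sum_le_sum_abs _ _).trans ?_
      calc _ ≤ ∑ x, ρ x * (1/3) := by
            refine Finset.sum_le_sum fun x _ => ?_
            rw [abs_mul, abs_of_nonneg (hρ.1 x)]
            exact mul_le_mul_of_nonneg_left (hp x) (hρ.1 x)
        _ = 1/3 := by rw [← Finset.sum_mul, hρ.2]; norm_num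
    have e1 := abs_le.1 (hb μ h1)
    have e2 := abs_le.1 (hb ν h2)
    linarith [e1.1, e2.2]

/-! Composition -/

lemma sum_prod_blocks {κ ι : Type*} [Fintype κ] [DecidableEq κ] [Fintype ι] [DecidableEq ι]
    (F : κ → (ι → Bool) → ℝ) :
    ∑ x : κ × ι → Bool, ∏ k, F k (fun i => x (k, i)) = ∏ k, ∑ y, F k y := by
  rw [Fintype.prod_sum]
  exact Equiv.sum_comp (Equiv.curry κ ι Bool) (fun y => ∏ k, F k (y k))

lemma MatchD.prod {κ : Type*} [Fintype κ] [DecidableEq κ] {K : ℕ} {P N : (κ → Bool) → ℝ}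
    (h : MatchD K P N) (T : Finset κ) (hT : T.card < K) (g : κ → Bool → ℝ) :
    ∑ z, P z * ∏ k ∈ T, g k (z k) = ∑ z, N z * ∏ k ∈ T, g k (z k) := by
  have hg : ∀ z : κ → Bool, ∏ k ∈ T, g k (z k) = ∑ U ∈ T.powerset,
      ((∏ k ∈ U, ((g k false - g k true) / 2)) * ∏ k ∈ T \ U, ((g k false + g k true) / 2))
        * chi U z := by
    intro z
    have : ∀ k, g k (z k) = (g k false - g k true) / 2 * bval (z k)
        + (g k false + g k true) / 2 := by
      intro k; cases z k <;> simp [bval] <;> ring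
    simp only [this, Finset.prod_add, Finset.prod_mul_distrib, chi]
    refine Finset.sum_congr rfl fun U _ => ?_
    ring
  simp only [hg, Finset.mul_sum]
  rw [Finset.sum_comm, Finset.sum_comm (s := Finset.univ) (t := T.powerset)]
  refine Finset.sum_congr rfl fun U hU => ?_
  simp only [mul_left_comm (P _), mul_left_comm (N _)]
  rw [← Finset.mul_sum, ← Finset.mul_sum]
  congr 1
  simp only [chi_eq_mon]
  apply h
  have := Finset.card_le_card (Finset.mem_powerset.1 hU)
  simp
  omega

/-- AND of copies of `f`. -/
def andOf {κ ι : Type*} [Fintype κ] (f : (ι → Bool) → Bool) (x : κ × ι → Bool) : Bool :=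
  decide (∀ k, f (fun i => x (k, i)) = true)

lemma Hard.comp {κ ι : Type*} [Fintype κ] [DecidableEq κ] [Fintype ι] [DecidableEq ι]
    {f : (ι → Bool) → Bool} {d : ℕ} {a b : ℝ} (h : Hard f d a b)
    {K : ℕ} {P N : (κ → Bool) → ℝ} (hP : IsProb P) (hN : IsProb N) (hM : MatchD K P N)
    (a' b' : ℝ)
    (hP' : ∀ h : Bool → ℝ, (∀ b, 0 ≤ h b) → (∀ b, h b ≤ 1) → h false ≤ a →
      ∑ z, P z * ∏ k, h (z k) ≤ a')
    (hN' : ∀ h : Bool → ℝ, (∀ b, 0 ≤ h b) → (∀ b, h b ≤ 1) → 1 - b ≤ h true →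
      1 - b' ≤ ∑ z, N z * ∏ k, h (z k)) :
    Hard (andOf (κ := κ) f) (K * d) a' b' := by
  obtain ⟨μ, ν, h1, h2, h3, h4, h5⟩ := h
  let w : Bool → (ι → Bool) → ℝ := fun b => if b then ν else μ
  have hw : ∀ b, IsProb (w b) := by intro b; cases b <;> simpa [w]
  let cmp : ((κ → Bool) → ℝ) → (κ × ι → Bool) → ℝ :=
    fun P x => ∑ z, P z * ∏ k, w (z k) (fun i => x (k, i))
  have key : ∀ (Q : (κ → Bool) → ℝ) (F : κ → (ι → Bool) → ℝ),
      ∑ x, cmp Q x * ∏ k, F k (fun i => x (k, i))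
        = ∑ z, Q z * ∏ k, ∑ y, w (z k) y * F k y := by
    intro Q F
    simp only [cmp, Finset.sum_mul]
    rw [Finset.sum_comm]
    refine Finset.sum_congr rfl fun z _ => ?_
    simp only [mul_assoc, ← Finset.mul_sum, ← Finset.prod_mul_distrib]
    congr 1
    exact sum_prod_blocks (fun k y => w (z k) y * F k y)
  have kp : ∀ Q, IsProb Q → IsProb (cmp Q) := by
    intro Q hQ
    refine ⟨fun x => Finset.sum_nonneg fun z _ =>
      mul_nonneg (hQ.1 z) (Finset.prod_nonneg fun k _ => (hw _).1 _), ?_⟩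
    have := key Q (fun _ _ => 1)
    simpa [(hw _).2, hQ.2] using this
  have kt : ∀ Q, tmass (andOf f) (cmp Q) = ∑ z, Q z * ∏ k, tmass f (w (z k)) := by
    intro Q
    have := key Q (fun _ y => if f y then 1 else 0)
    simp only [mul_ite, mul_one, mul_zero] at this
    unfold tmass
    rw [← this]
    refine Finset.sum_congr rfl fun x _ => ?_
    rw [Finset.prod_ite_zero]
    simp [andOf]
  have t0 : ∀ b, 0 ≤ tmass f (w b) := fun b => Finset.sum_nonneg fun x _ => by
    split_ifs
    · exact (hw b).1 x
    · exact le_rfl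
  have t1 : ∀ b, tmass f (w b) ≤ 1 := fun b => by
    rw [← (hw b).2]
    refine Finset.sum_le_sum fun x _ => ?_
    split_ifs
    · exact le_rfl
    · exact (hw b).1 x
  refine ⟨cmp P, cmp N, kp _ hP, kp _ hN, ?_, ?_, ?_⟩
  · intro e he
    have hm : ∀ x : κ × ι → Bool, mon e x = ∏ k, mon (fun i => e (k, i)) (fun i => x (k, i)) := by
      intro x
      unfold mon
      rw [Fintype.prod_prod_type]
    simp only [hm]
    rw [key P (fun k => mon (fun i => e (k, i))), key N (fun k => mon (fun i => e (k, i)))]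
    let T : Finset κ := Finset.univ.filter fun k => d ≤ ∑ i, e (k, i)
    have hT : T.card < K := by
      have : T.card * d ≤ ∑ k, ∑ i, e (k, i) := by
        calc T.card * d = ∑ k ∈ T, d := by simp
          _ ≤ ∑ k ∈ T, ∑ i, e (k, i) :=
            Finset.sum_le_sum fun k hk => (Finset.mem_filter.1 hk).2
          _ ≤ _ := Finset.sum_le_sum_of_subset (Finset.subset_univ _)
      rw [Fintype.sum_prod_type] at he
      exact lt_of_mul_lt_mul_right (this.trans_lt he) (Nat.zero_le d)
    have hs : ∀ z : κ → Bool, ∏ k, ∑ y, w (z k) y * mon (fun i => e (k, i)) y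
        = (∏ k ∈ T, ∑ y, w (z k) y * mon (fun i => e (k, i)) y) *
          ∏ k ∈ Tᶜ, ∑ y, μ y * mon (fun i => e (k, i)) y := by
      intro z
      rw [← Finset.prod_mul_prod_compl T]
      congr 1
      refine Finset.prod_congr rfl fun k hk => ?_
      have hk' : ∑ i, e (k, i) < d := by simpa [T] using hk
      cases z k
      · simp [w]
      · simp [w, h3 _ hk']
    simp only [hs, ← mul_assoc, ← Finset.sum_mul]
    congr 1
    exact hM.prod T hT (fun k b => ∑ y, w b y * mon (fun i => e (k, i)) y)
  · rw [kt]
    exact hP' (fun b => tmass f (w b)) t0 t1 (by simpa [w] using h4)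
  · rw [kt]
    exact hN' (fun b => tmass f (w b)) t0 t1 (by simpa [w] using h5)

/-! The outer dual object for AND -/

/-- Product Bernoulli weights (FALSE with probability `p`). -/
def bern (m : ℕ) (p : ℝ) (z : Fin m → Bool) : ℝ := ∏ k, if z k then 1 - p else p

lemma bern_nonneg {m : ℕ} {p : ℝ} (h0 : 0 ≤ p) (h1 : p ≤ 1) (z : Fin m → Bool) :
    0 ≤ bern m p z := by
  refine Finset.prod_nonneg fun k _ => ?_
  split_ifs <;> linarith

lemma bern_mon (m : ℕ) (e : Fin m → ℕ) :
    ∃ Q : Polynomial ℝ, Q.natDegree ≤ ∑ k, e k ∧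
      ∀ p, ∑ z, bern m p z * mon e z = Q.eval p := by
  refine ⟨∏ k, if e k = 0 then 1 else
    (Polynomial.C ((-1 : ℝ) ^ e k) * (1 - Polynomial.X) + Polynomial.X), ?_, ?_⟩
  · refine (Polynomial.natDegree_prod_le _ _).trans (Finset.sum_le_sum fun k _ => ?_)
    split_ifs with h
    · simp
    · have : 1 ≤ e k := Nat.one_le_iff_ne_zero.2 h
      refine le_trans ?_ this
      compute_degree
  · intro p
    unfold bern mon
    simp only [← Finset.prod_mul_distrib]
    rw [← Fintype.prod_sum (fun k (b : Bool) => (if b then 1 - p else p) * bval b ^ e k),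
      Polynomial.eval_prod]
    refine Finset.prod_congr rfl fun k _ => ?_
    split_ifs with h
    · simp [h]
    · simp [bval]; ring

lemma sum_bern (m : ℕ) (p : ℝ) : ∑ z, bern m p z = 1 := by
  unfold bern
  rw [← Fintype.prod_sum (fun (_ : Fin m) (b : Bool) => (if b then 1 - p else p))]
  simp

lemma bern_true (m : ℕ) (p : ℝ) : bern m p (fun _ => true) = (1 - p) ^ m := by
  simp [bern]

lemma bern_zero_of_ne (m : ℕ) (z : Fin m → Bool) (hz : z ≠ fun _ => true) : bern m 0 z = 0 := by
  obtain ⟨i, hi⟩ := Function.ne_iff.1 hz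
  apply Finset.prod_eq_zero (Finset.mem_univ i)
  simp at hi
  simp [hi]

lemma alt_sum (n : ℕ) (P : Polynomial ℝ) (hP : P.natDegree < n) :
    ∑ j ∈ Finset.range (n + 1), ((-1 : ℝ) ^ j * (n.choose j : ℝ)) * P.eval (j : ℝ) = 0 := by
  have h := Polynomial.fwdDiff_iter_eq_zero_of_degree_lt hP
  have h2 := congrFun h 0
  rw [fwdDiff_iter_eq_sum_shift] at h2
  simp only [Pi.zero_apply] at h2
  have h3 : ∑ j ∈ Finset.range (n + 1), ((-1 : ℝ) ^ j * (n.choose j : ℝ)) * P.eval (j : ℝ)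
      = (-1) ^ n * ∑ x ∈ Finset.range (n + 1), ((-1 : ℤ) ^ (n - x) * (n.choose x : ℤ)) •
        P.eval (0 + x • (1:ℝ)) := by
    rw [Finset.mul_sum]
    refine Finset.sum_congr rfl fun j hj => ?_
    have hj' : j ≤ n := by simpa [Nat.lt_succ_iff] using hj
    have : (-1 : ℝ) ^ n * (-1) ^ (n - j) = (-1) ^ j := by
      obtain ⟨r, rfl⟩ := Nat.exists_eq_add_of_le hj'
      rw [Nat.add_sub_cancel_left, pow_add, mul_assoc, ← mul_pow]; simp
    rw [← this]
    simp
    ring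
  rw [h3, h2, mul_zero]

/-- node positions -/
def nodeAt (k j : ℕ) : ℝ := 100 * ((j : ℝ) - k) ^ 2

/-- node weights -/
def wt (k j : ℕ) : ℝ :=
  (-(-1 : ℝ) ^ k / ((2 * k).choose k : ℝ)) * ((-1) ^ j * ((2 * k).choose j : ℝ))
    / (nodeAt k j - 1)

lemma node_ne (k j : ℕ) : nodeAt k j - 1 ≠ 0 := by
  unfold nodeAt
  rcases eq_or_ne j k with h | h
  · subst h; simp
  · have : (1:ℝ) ≤ ((j : ℝ) - k) ^ 2 := by
      have h' : (1:ℤ) ≤ ((j : ℤ) - k) ^ 2 := by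
        have : (j : ℤ) - k ≠ 0 := by omega
        have := sq_pos_of_ne_zero this
        omega
      exact_mod_cast h'
    intro h2; linarith

lemma wt_self (k : ℕ) : wt k k = 1 := by
  unfold wt nodeAt
  have : ((2 * k).choose k : ℝ) ≠ 0 := by
    exact_mod_cast (Nat.choose_pos (by omega)).ne'
  have h2 : (-1 : ℝ) ^ k * (-1) ^ k = 1 := by rw [← mul_pow]; simp
  simp
  field_simp
  rw [pow_two]; exact h2

lemma wt_annih (k : ℕ) (q : Polynomial ℝ) (hq : q.natDegree ≤ k) :
    ∑ j ∈ Finset.range (2 * k + 1), wt k j * (q.eval (nodeAt k j) - q.eval 1) = 0 := by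
  rcases Nat.eq_zero_or_pos k with rfl | hk
  · rw [Polynomial.eq_C_of_natDegree_le_zero hq]; simp
  obtain ⟨r, hr⟩ := Polynomial.X_sub_C_dvd_sub_C_eval (p := q) (a := 1)
  have hev : ∀ x, q.eval x - q.eval 1 = (x - 1) * r.eval x := by
    intro x
    have := congrArg (Polynomial.eval x) hr
    simpa using this
  have hrd : r.natDegree < k := by
    by_cases hr0 : r = 0
    · simp [hr0, hk]
    · have h1 := congrArg Polynomial.natDegree hr
      rw [Polynomial.natDegree_sub_C, Polynomial.natDegree_mul (Polynomial.X_sub_C_ne_zero 1) hr0,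
        Polynomial.natDegree_X_sub_C] at h1
      omega
  let P : Polynomial ℝ := r.comp (Polynomial.C 100 * (Polynomial.X - Polynomial.C (k : ℝ)) ^ 2)
  have hPd : P.natDegree < 2 * k := by
    have h1 : P.natDegree ≤ r.natDegree * 2 := by
      refine Polynomial.natDegree_comp_le.trans (Nat.mul_le_mul_left _ ?_)
      compute_degree
    omega
  have hP := alt_sum (2 * k) P hPd
  have : ∀ j, wt k j * (q.eval (nodeAt k j) - q.eval 1)
      = (-(-1 : ℝ) ^ k / ((2 * k).choose k : ℝ)) *
        (((-1) ^ j * ((2 * k).choose j : ℝ)) * P.eval (j : ℝ)) := by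
    intro j
    rw [hev]
    have hn := node_ne k j
    have hPe : P.eval (j : ℝ) = r.eval (nodeAt k j) := by simp [P, nodeAt]
    rw [hPe]
    unfold wt
    generalize r.eval (nodeAt k j) = R
    generalize -(-1 : ℝ) ^ k / ((2 * k).choose k : ℝ) = A
    field_simp
  simp only [this, ← Finset.mul_sum, hP, mul_zero]

lemma wt_abs_le (k j : ℕ) (h : j ≠ k) : |wt k j| ≤ 1 / 99 * (((j : ℝ) - k) ^ 2)⁻¹ := by
  have h1 : (1:ℝ) ≤ ((j : ℝ) - k) ^ 2 := by
    have h' : (1:ℤ) ≤ ((j : ℤ) - k) ^ 2 := by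
      have : (j : ℤ) - k ≠ 0 := by omega
      have := sq_pos_of_ne_zero this
      omega
    exact_mod_cast h'
  have hc : ((2 * k).choose j : ℝ) ≤ ((2 * k).choose k : ℝ) := by
    exact_mod_cast Nat.choose_le_centralBinom j k
  have hcp : (0:ℝ) < ((2 * k).choose k : ℝ) := by
    exact_mod_cast (Nat.choose_pos (by omega))
  unfold wt nodeAt
  rw [abs_div, abs_mul, abs_div, abs_neg, abs_mul]
  simp only [abs_pow, abs_neg, abs_one, one_pow, one_mul, Nat.abs_cast]
  have hd : 99 * ((j : ℝ) - k) ^ 2 ≤ |100 * ((j : ℝ) - k) ^ 2 - 1| := by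
    rw [abs_of_nonneg (by linarith)]; linarith
  calc _ ≤ 1 / |100 * ((j : ℝ) - k) ^ 2 - 1| := by
        gcongr
        rw [one_div, inv_mul_le_iff₀ hcp]; linarith
    _ ≤ 1 / (99 * ((j : ℝ) - k) ^ 2) := by gcongr
    _ = _ := by rw [one_div, mul_inv]; norm_num

lemma sum_inv_sq_le_s14 (k : ℕ) : ∑ i ∈ Finset.range k, (((i : ℝ) + 1) ^ 2)⁻¹ ≤ 2 := by
  have h := sum_Ioo_inv_sq_le (α := ℝ) 0 (k + 1)
  have h2 : ∑ i ∈ Finset.range k, (((i : ℝ) + 1) ^ 2)⁻¹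
      = ∑ i ∈ Finset.Ioo 0 (k + 1), ((i : ℝ) ^ 2)⁻¹ := by
    have : Finset.Ioo 0 (k + 1) = Finset.Ico 1 (k + 1) := by ext; simp; omega
    rw [this, Finset.sum_Ico_eq_sum_range]
    simp [add_comm]
  rw [h2]
  simpa using h

lemma sum_wt_le (k : ℕ) : ∑ j ∈ (Finset.range (2 * k + 1)).erase k, |wt k j| ≤ 4 / 99 := by
  have hs : ∑ j ∈ (Finset.range (2 * k + 1)).erase k, (((j : ℝ) - k) ^ 2)⁻¹ ≤ 4 := by
    have h0 : ∑ j ∈ (Finset.range (2 * k + 1)).erase k, (((j : ℝ) - k) ^ 2)⁻¹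
        = ∑ j ∈ Finset.range (2 * k + 1), (((j : ℝ) - k) ^ 2)⁻¹ := by
      apply Finset.sum_erase; simp
    have h1 : 2 * k + 1 = k + 1 + k := by ring
    rw [h0, h1, Finset.sum_range_add, Finset.sum_range_succ]
    have h2 : ∑ j ∈ Finset.range k, (((j : ℝ) - k) ^ 2)⁻¹
        = ∑ i ∈ Finset.range k, (((i : ℝ) + 1) ^ 2)⁻¹ := by
      rw [← Finset.sum_range_reflect]
      refine Finset.sum_congr rfl fun j hj => ?_
      have hj' : j < k := by simpa using hj
      congr 1
      rw [Nat.sub_sub, Nat.cast_sub (by omega)]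
      push_cast; ring
    have h3 : ∑ j ∈ Finset.range k, ((((k + 1 + j : ℕ) : ℝ) - k) ^ 2)⁻¹
        = ∑ i ∈ Finset.range k, (((i : ℝ) + 1) ^ 2)⁻¹ := by
      refine Finset.sum_congr rfl fun j hj => ?_
      congr 1
      push_cast; ring
    rw [h2, h3]
    have := sum_inv_sq_le_s14 k
    simp
    linarith
  calc _ ≤ ∑ j ∈ (Finset.range (2 * k + 1)).erase k, 1 / 99 * (((j : ℝ) - k) ^ 2)⁻¹ :=
        Finset.sum_le_sum fun j hj => wt_abs_le k j (Finset.ne_of_mem_erase hj)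
    _ ≤ _ := by rw [← Finset.mul_sum]; linarith

lemma exists_outer (m : ℕ) (hm : 1 ≤ m) : ∃ (K : ℕ) (P N : (Fin m → Bool) → ℝ),
    Real.sqrt m / 10 ≤ K ∧ IsProb P ∧ IsProb N ∧ MatchD K P N ∧
      P (fun _ => true) = 0 ∧ 9 / 10 ≤ N (fun _ => true) := by
  obtain ⟨k, hk1, hk2⟩ : ∃ k : ℕ, 100 * (k * k) ≤ m ∧ m ≤ 100 * ((k + 1) * (k + 1)) := by
    refine ⟨Nat.sqrt (m / 100), ?_, ?_⟩
    · have := Nat.sqrt_le (m / 100); omega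
    · have := Nat.lt_succ_sqrt (m / 100)
      simp only [Nat.succ_eq_add_one] at this
      omega
  have hmpos : (0:ℝ) < m := by exact_mod_cast hm
  let I := Finset.range (2 * k + 1)
  have hkI : k ∈ I := by simp [I]; omega
  let W : ℝ := -∑ j ∈ I, wt k j
  let ω : (Fin m → Bool) → ℝ := fun z =>
    ∑ j ∈ I, wt k j * bern m (nodeAt k j / m) z + W * bern m (1 / m) z
  have hs := sum_wt_le k
  have hn0 : ∀ j, 0 ≤ nodeAt k j / m := fun j => by unfold nodeAt; positivity
  have hn1 : ∀ j ∈ I, nodeAt k j / m ≤ 1 := by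
    intro j hj
    rw [div_le_one hmpos]
    have hj' : j ≤ 2 * k := by simpa [I, Nat.lt_succ_iff] using hj
    have h1 : (j : ℝ) ≤ 2 * k := by exact_mod_cast hj'
    have h2 : (100 : ℝ) * (k * k) ≤ m := by exact_mod_cast hk1
    have h3 : (0:ℝ) ≤ j := by positivity
    unfold nodeAt
    nlinarith
  have hmi0 : (0:ℝ) ≤ 1 / m := by positivity
  have hmi1 : (1:ℝ) / m ≤ 1 := by rw [div_le_one hmpos]; exact_mod_cast hm
  have hsumw : |∑ j ∈ I.erase k, wt k j| ≤ 4 / 99 := (Finset.abs_sum_le_sum_abs _ _).trans hs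
  have hW : W = -(1 + ∑ j ∈ I.erase k, wt k j) := by
    simp only [W]; rw [← Finset.add_sum_erase I _ hkI, wt_self]
  have hsw := abs_le.1 hsumw
  have hωdec : ∀ z, ω z = bern m 0 z + ∑ j ∈ I.erase k, wt k j * bern m (nodeAt k j / m) z
      + W * bern m (1 / m) z := by
    intro z
    simp only [ω]
    rw [← Finset.add_sum_erase I _ hkI, wt_self]
    simp [nodeAt]
  have hann : ∀ e : Fin m → ℕ, ∑ i, e i < k + 1 → ∑ z, ω z * mon e z = 0 := by
    intro e he
    obtain ⟨Q, hQd, hQ⟩ := bern_mon m e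
    let q := Q.comp (Polynomial.C ((1:ℝ) / m) * Polynomial.X)
    have hqd : q.natDegree ≤ k := by
      have h1 : q.natDegree ≤ Q.natDegree * 1 := by
        refine Polynomial.natDegree_comp_le.trans (Nat.mul_le_mul_left _ ?_)
        compute_degree
      omega
    have hqe : ∀ x, q.eval x = Q.eval (x / m) := by
      intro x; simp [q]; congr 1; ring
    have h := wt_annih k q hqd
    have h2 : ∑ z, ω z * mon e z
        = ∑ j ∈ I, wt k j * q.eval (nodeAt k j) + W * q.eval 1 := by
      simp only [ω, add_mul, Finset.sum_mul, Finset.sum_add_distrib]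
      rw [Finset.sum_comm]
      simp only [mul_assoc, ← Finset.mul_sum, hQ, hqe]
    rw [h2, ← h]
    simp only [mul_sub, Finset.sum_sub_distrib, W, ← Finset.sum_mul, I]
    ring
  have hsum0 : ∑ z, ω z = 0 := by
    have := hann (fun _ => 0) (by simp)
    simpa [mon] using this
  have htrue : 1 / 2 - 6 / 99 ≤ ω (fun _ => true) := by
    rw [hωdec]
    have h1 : bern m 0 (fun _ => true) = 1 := by simp [bern_true]
    have h2 : -(4 / 99) ≤ ∑ j ∈ I.erase k, wt k j * bern m (nodeAt k j / m) (fun _ => true) := by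
      have : |∑ j ∈ I.erase k, wt k j * bern m (nodeAt k j / m) (fun _ => true)| ≤ 4 / 99 := by
        refine (Finset.abs_sum_le_sum_abs _ _).trans (le_trans (Finset.sum_le_sum fun j hj => ?_) hs)
        have hj' := hn1 j (Finset.mem_of_mem_erase hj)
        rw [abs_mul, bern_true, abs_pow]
        have : |1 - nodeAt k j / m| ≤ 1 := by
          rw [abs_le]; constructor <;> linarith [hn0 j]
        exact mul_le_of_le_one_right (abs_nonneg _) (pow_le_one₀ (abs_nonneg _) this)
      exact (abs_le.1 this).1
    have h3 : bern m (1 / m) (fun _ => true) ≤ 1 / 2 := by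
      rw [bern_true]
      exact (Real.one_sub_div_pow_le_exp_neg (by exact_mod_cast hm)).trans
        Real.exp_neg_one_lt_half.le
    have h4 : 0 ≤ bern m (1 / m) (fun _ => true) := bern_nonneg hmi0 hmi1 _
    have h5 : -(1 + 4/99) ≤ W := by rw [hW]; linarith
    rw [h1]
    nlinarith
  have hother : ∑ z ∈ Finset.univ.erase (fun _ => true), max (ω z) 0 ≤ 4 / 99 := by
    calc _ ≤ ∑ z ∈ Finset.univ.erase (fun _ => true),
          ∑ j ∈ I.erase k, |wt k j| * bern m (nodeAt k j / m) z := by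
          refine Finset.sum_le_sum fun z hz => ?_
          have hz' := bern_zero_of_ne m z (Finset.ne_of_mem_erase hz)
          have hb : ∀ j ∈ I.erase k, 0 ≤ bern m (nodeAt k j / m) z := fun j hj =>
            bern_nonneg (hn0 j) (hn1 j (Finset.mem_of_mem_erase hj)) z
          apply max_le
          · rw [hωdec, hz']
            have h4 : 0 ≤ bern m (1 / m) z := bern_nonneg hmi0 hmi1 _
            have h5 : W ≤ 0 := by rw [hW]; linarith
            have h6 : W * bern m (1 / m) z ≤ 0 := mul_nonpos_of_nonpos_of_nonneg h5 h4
            have h7 : ∑ j ∈ I.erase k, wt k j * bern m (nodeAt k j / m) z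
                ≤ ∑ j ∈ I.erase k, |wt k j| * bern m (nodeAt k j / m) z :=
              Finset.sum_le_sum fun j hj =>
                mul_le_mul_of_nonneg_right (le_abs_self _) (hb j hj)
            linarith
          · exact Finset.sum_nonneg fun j hj => mul_nonneg (abs_nonneg _) (hb j hj)
      _ = ∑ j ∈ I.erase k, |wt k j| *
          ∑ z ∈ Finset.univ.erase (fun _ => true), bern m (nodeAt k j / m) z := by
          rw [Finset.sum_comm]; simp only [Finset.mul_sum]
      _ ≤ ∑ j ∈ I.erase k, |wt k j| * 1 := by
          refine Finset.sum_le_sum fun j hj => mul_le_mul_of_nonneg_left ?_ (abs_nonneg _)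
          rw [← sum_bern m (nodeAt k j / m)]
          exact Finset.sum_le_sum_of_subset_of_nonneg (Finset.erase_subset _ _)
            fun z _ _ => bern_nonneg (hn0 j) (hn1 j (Finset.mem_of_mem_erase hj)) z
      _ ≤ _ := by simpa using hs
  let A : ℝ := ∑ z, max (ω z) 0
  have hA : A = ω (fun _ => true) + ∑ z ∈ Finset.univ.erase (fun _ => true), max (ω z) 0 := by
    simp only [A]
    rw [← Finset.add_sum_erase _ _ (Finset.mem_univ (fun _ => true)), max_eq_left (by linarith)]
  have hoth0 : 0 ≤ ∑ z ∈ Finset.univ.erase (fun _ : Fin m => true), max (ω z) 0 :=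
    Finset.sum_nonneg fun z _ => le_max_right _ _
  have hApos : 0 < A := by linarith
  have hdiff : ∀ z, max (ω z) 0 - max (-ω z) 0 = ω z := by
    intro z
    rcases le_total 0 (ω z) with h | h
    · rw [max_eq_left h, max_eq_right (by linarith)]; ring
    · rw [max_eq_right h, max_eq_left (by linarith)]; ring
  have hA2 : ∑ z, max (-ω z) 0 = A := by
    have : A - ∑ z, max (-ω z) 0 = 0 := by
      refine Eq.trans ?_ hsum0
      simp only [A]
      rw [← Finset.sum_sub_distrib]
      exact Finset.sum_congr rfl fun z _ => hdiff z
    linarith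
  refine ⟨k + 1, fun z => max (-ω z) 0 / A, fun z => max (ω z) 0 / A, ?_, ?_, ?_, ?_, ?_, ?_⟩
  · rw [div_le_iff₀ (by norm_num)]
    apply Real.sqrt_le_iff.2
    constructor
    · positivity
    · have : (m : ℝ) ≤ 100 * ((k + 1) * (k + 1)) := by exact_mod_cast hk2
      push_cast; nlinarith
  · exact ⟨fun z => div_nonneg (le_max_right _ _) hApos.le, by
      rw [← Finset.sum_div, hA2, div_self hApos.ne']⟩
  · exact ⟨fun z => div_nonneg (le_max_right _ _) hApos.le, by
      rw [← Finset.sum_div]; exact div_self hApos.ne'⟩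
  · intro e he
    have h := hann e he
    have h2 : ∑ z, max (ω z) 0 / A * mon e z - ∑ z, max (-ω z) 0 / A * mon e z
        = (∑ z, ω z * mon e z) / A := by
      rw [← Finset.sum_sub_distrib, Finset.sum_div]
      refine Finset.sum_congr rfl fun z _ => ?_
      nth_rw 3 [← hdiff z]
      ring
    rw [h, zero_div] at h2
    linarith
  · have : max (-ω (fun _ => true)) 0 = 0 := max_eq_right (by linarith)
    simp only [this, zero_div]
  · simp only []
    rw [max_eq_left (by linarith), le_div_iff₀ hApos]
    linarith

/-! The recursion along the tree -/

lemma Hard.gate {ι : Type*} [Fintype ι] [DecidableEq ι] {f : (ι → Bool) → Bool} {d : ℕ}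
    {a b : ℝ} (h : Hard f d a b) (_ : 0 ≤ a) (_ : 0 ≤ b) (m : ℕ) (hm : 1 ≤ m) :
    ∃ K : ℕ, Real.sqrt m / 10 ≤ K ∧
      Hard (andOf (κ := Fin m) f) (K * d) a (1 / 10 + m * b) := by
  obtain ⟨K, P, N, hK, hP, hN, hM, hPt, hNt⟩ := exists_outer m hm
  refine ⟨K, hK, h.comp hP hN hM a _ ?_ ?_⟩
  · intro g g0 g1 gf
    calc _ ≤ ∑ z, P z * a := by
          refine Finset.sum_le_sum fun z _ => ?_
          by_cases hz : z = fun _ => true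
          · rw [hz, hPt]; simp
          · obtain ⟨i, hi⟩ := Function.ne_iff.1 hz
            simp at hi
            refine mul_le_mul_of_nonneg_left ?_ (hP.1 z)
            rw [← Finset.mul_prod_erase _ _ (Finset.mem_univ i), hi]
            refine (mul_le_of_le_one_right (g0 _) ?_).trans gf
            exact Finset.prod_le_one (fun _ _ => g0 _) (fun _ _ => g1 _)
      _ = a := by rw [← Finset.sum_mul, hP.2, one_mul]
  · intro g g0 g1 gt
    have h1 : N (fun _ => true) * g true ^ m ≤ ∑ z, N z * ∏ k, g (z k) := by
      have := Finset.single_le_sum (f := fun z => N z * ∏ k, g (z k))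
        (fun z _ => mul_nonneg (hN.1 z) (Finset.prod_nonneg fun _ _ => g0 _))
        (Finset.mem_univ (fun _ => true))
      simpa using this
    have h2 : 1 - m * b ≤ g true ^ m := by
      have := one_add_mul_le_pow (a := g true - 1) (by linarith [g0 true]) m
      have h3 : (m : ℝ) * (-b) ≤ m * (g true - 1) :=
        mul_le_mul_of_nonneg_left (by linarith) (by positivity)
      have h4 : 1 + (g true - 1) = g true := by ring
      rw [h4] at this
      linarith
    have h5 : g true ^ m ≤ 1 := pow_le_one₀ (g0 _) (g1 _)
    have h6 : 0 ≤ g true ^ m := pow_nonneg (g0 _) _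
    nlinarith

lemma isProb_single {α : Type*} [Fintype α] [DecidableEq α] (a : α) :
    IsProb (fun x => if x = a then (1:ℝ) else 0) :=
  ⟨fun x => by
    by_cases h : x = a <;> simp [h], by simp⟩

lemma match_one {ι : Type*} [Fintype ι] [DecidableEq ι] {μ ν : (ι → Bool) → ℝ}
    (h1 : IsProb μ) (h2 : IsProb ν) : MatchD 1 μ ν := by
  intro e he
  have : ∀ i, e i = 0 := by
    have : ∑ i, e i = 0 := by omega
    simpa using this
  simp [mon, this, h1.2, h2.2]

lemma Hard.amp {ι : Type*} [Fintype ι] [DecidableEq ι] {f : (ι → Bool) → Bool} {d : ℕ}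
    {a b : ℝ} (h : Hard f d a b) (t : ℕ) :
    Hard (andOf (κ := Fin t) f) d (a ^ t) (t * b) := by
  have h1 := isProb_single (fun _ : Fin t => false)
  have h2 := isProb_single (fun _ : Fin t => true)
  have := h.comp h1 h2 (match_one h1 h2) (a ^ t) (t * b) ?_ ?_
  · simpa using this
  · intro g g0 g1 gf
    simp
    exact pow_le_pow_left₀ (g0 _) gf t
  · intro g g0 g1 gt
    simp
    have := one_add_mul_le_pow (a := g true - 1) (by linarith [g0 true]) t
    have h3 : (t : ℝ) * (-b) ≤ t * (g true - 1) :=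
      mul_le_mul_of_nonneg_left (by linarith) (by positivity)
    have h4 : 1 + (g true - 1) = g true := by ring
    rw [h4] at this
    linarith

lemma AOT_dual (M D : ℕ) (g : Bool) (x : (Fin D → Fin M) → Bool) :
    AOT M D (!g) x = !(AOT M D g fun i => !(x i)) := by
  induction D generalizing g with
  | zero => simp [AOT]
  | succ D ih =>
    have h1 := ih (!g)
    cases g
    · simp only [AOT, Bool.not_false, Bool.not_true] at h1 ⊢
      simp only [h1, if_true, Bool.false_eq_true, if_false]
      rw [← decide_not]
      simp
    · simp only [AOT, Bool.not_false, Bool.not_true] at h1 ⊢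
      simp only [h1, if_true, Bool.false_eq_true, if_false]
      rw [← decide_not]
      simp

lemma hard_leaf (M : ℕ) (g : Bool) : Hard (AOT M 0 g) 1 0 0 := by
  have h1 := isProb_single (fun _ : Fin 0 → Fin M => false)
  have h2 := isProb_single (fun _ : Fin 0 → Fin M => true)
  refine ⟨_, _, h1, h2, match_one h1 h2, ?_, ?_⟩
  · unfold tmass
    refine (Finset.sum_eq_zero fun x _ => ?_).le
    simp only [AOT]
    by_cases h4 : x = fun _ => false
    · simp [h4]
    · simp [h4]
  · have := Finset.single_le_sum (f := fun x => if AOT M 0 g x then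
      (if x = (fun _ => true) then (1:ℝ) else 0) else 0)
      (fun x _ => by split_ifs <;> norm_num) (Finset.mem_univ (fun _ => true))
    simpa [AOT, tmass] using this

lemma Hard.tree_gate {M D d : ℕ} {a b : ℝ}
    (h : Hard (andOf (κ := Fin M) (AOT M D false)) d a b) : Hard (AOT M (D + 1) true) d a b := by
  refine h.reindex (fun p : Fin (D + 1) → Fin M => (p 0, Fin.tail p)) fun x => ?_
  simp [AOT, andOf]

lemma Hard.tree_gate2 {M D d m t : ℕ} {a b : ℝ} (hmt : m * t ≤ M) (hm : 1 ≤ m) (ht : 1 ≤ t)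
    (h : Hard (andOf (κ := Fin m) (andOf (κ := Fin t) (AOT M D false))) d a b) :
    Hard (AOT M (D + 1) true) d a b := by
  obtain ⟨φ, hφ⟩ : ∃ φ : Fin M → Fin m × Fin t, Function.Surjective φ := by
    have : Nonempty (Fin m × Fin t) := ⟨(⟨0, hm⟩, ⟨0, ht⟩)⟩
    obtain ⟨e⟩ := Function.Embedding.nonempty_of_card_le (α := Fin m × Fin t) (β := Fin M)
      (by simpa using hmt)
    exact ⟨Function.invFun e, Function.invFun_surjective e.injective⟩
  refine h.reindex
    (fun p : Fin (D + 1) → Fin M => ((φ (p 0)).1, ((φ (p 0)).2, Fin.tail p))) fun x => ?_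
  simp [AOT, andOf]
  constructor
  · intro H k l
    obtain ⟨i, hi⟩ := hφ (k, l)
    have := H i
    rwa [hi] at this
  · intro H i
    exact H _ _

lemma Hard.flip {M D d : ℕ} {a b : ℝ} (h : Hard (AOT M D true) d a b) :
    Hard (AOT M D false) d b a := h.dual fun x => AOT_dual M D true x

lemma hard_level (M t m : ℕ) (hM : 2 ≤ M) (ht : 10 * M ≤ 5 ^ t) (ht1 : 1 ≤ t) (hm : 1 ≤ m)
    (hmt : m * t ≤ M) (D : ℕ) : ∃ d : ℕ,
      Real.sqrt M / 10 * (Real.sqrt m / 10) ^ D ≤ d ∧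
      Hard (AOT M (D + 1) false) d (1 / 5) (1 / (10 * M)) := by
  have hMpos : (0:ℝ) < M := by positivity
  induction D with
  | zero =>
    obtain ⟨K, hK, hH⟩ := (hard_leaf M false).gate le_rfl le_rfl M (by omega)
    refine ⟨K * 1, by simpa using hK, (hH.tree_gate.flip).mono (by norm_num) (by positivity)⟩
  | succ D ih =>
    obtain ⟨d, hd, hH⟩ := ih
    obtain ⟨K, hK, hH2⟩ := (hH.amp t).gate (by positivity) (by positivity) m hm
    refine ⟨K * d, ?_, (hH2.tree_gate2 hmt hm ht1).flip.mono ?_ ?_⟩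
    · push_cast
      rw [pow_succ, ← mul_assoc, mul_comm]
      exact mul_le_mul hK hd (by positivity) (by positivity)
    · have h1 : (m : ℝ) * t ≤ M := by exact_mod_cast hmt
      have h2 : (m : ℝ) * (t * (1 / (10 * M))) ≤ 1 / 10 := by
        rw [← mul_assoc, mul_one_div, div_le_div_iff₀ (by positivity) (by norm_num)]
        linarith
      linarith
    · have h1 : (10 : ℝ) * M ≤ 5 ^ t := by exact_mod_cast ht
      rw [one_div_pow]
      exact one_div_le_one_div_of_le (by positivity) h1

lemma exists_t (M : ℕ) (hM : 2 ≤ M) : ∃ t : ℕ, 10 * M ≤ 5 ^ t ∧ 1 ≤ t ∧ t ≤ M ∧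
    (t : ℝ) ≤ 6 * Real.logb 2 M := by
  refine ⟨Nat.clog 5 (10 * M), Nat.le_pow_clog (by norm_num) _, ?_, ?_, ?_⟩
  · exact Nat.clog_pos (by norm_num) (by omega)
  · apply Nat.clog_le_of_le_pow
    induction M, hM using Nat.le_induction with
    | base => norm_num
    | succ n hn ih => rw [pow_succ]; omega
  · have hpos : 1 ≤ Nat.clog 5 (10 * M) := Nat.clog_pos (by norm_num) (by omega)
    have h1 : 5 ^ (Nat.clog 5 (10 * M)).pred < 10 * M :=
      Nat.pow_pred_clog_lt_self (by norm_num) (by omega)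
    obtain ⟨s, hs⟩ := Nat.exists_eq_add_of_le hpos
    rw [hs] at h1 ⊢
    have h1' : 5 ^ s < 10 * M := by simpa [Nat.pred, add_comm] using h1
    have h2 : 10 * M ≤ M ^ 5 := by
      have : 2 ^ 4 ≤ M ^ 4 := Nat.pow_le_pow_left hM 4
      nlinarith
    have h3 : (2:ℝ) ^ s ≤ (M : ℝ) ^ 5 := by
      have : 2 ^ s ≤ M ^ 5 :=
        (Nat.pow_le_pow_left (by norm_num : 2 ≤ 5) s).trans (h1'.le.trans h2)
      exact_mod_cast this
    have hM' : (2:ℝ) ≤ M := by exact_mod_cast hM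
    have h4 := Real.logb_le_logb_of_le (b := 2) (by norm_num) (by positivity) h3
    rw [Real.logb_pow, Real.logb_pow, Real.logb_self_eq_one (by norm_num)] at h4
    have h5 : 1 ≤ Real.logb 2 M := by
      have := Real.logb_le_logb_of_le (b := 2) (by norm_num) (by norm_num) hM'
      rwa [Real.logb_self_eq_one (by norm_num)] at this
    push_cast at h4 ⊢
    linarith

lemma tree_bound (D M : ℕ) (hM : 2 ≤ M) :
    ∃ m : ℕ, (M : ℝ) ≤ 16 * m * Real.logb 2 M ∧
      Real.sqrt M / 10 * (Real.sqrt M / 10) * (Real.sqrt m / 10) ^ D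
        ≤ adeg (1/3) (AOT M (D + 2) true) := by
  obtain ⟨t, ht, ht1, htM, htl⟩ := exists_t M hM
  have hm : 1 ≤ M / t := Nat.div_pos htM ht1
  obtain ⟨d, hd, hH⟩ := hard_level M t (M / t) hM ht ht1 hm (Nat.div_mul_le_self M t) D
  have hMpos : (0:ℝ) < M := by positivity
  obtain ⟨K, hK, hH2⟩ := hH.gate (by norm_num) (by positivity) M (by omega)
  have hlast := hH2.tree_gate.adeg_le (by
    have : (M : ℝ) * (1 / (10 * M)) = 1 / 10 := by field_simp
    rw [this]; norm_num)
  refine ⟨M / t, ?_, ?_⟩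
  · have h1 : M ≤ 2 * (t * (M / t)) := by
      have h2 := Nat.div_add_mod M t
      have h3 := Nat.mod_lt M ht1
      have h4 : t * 1 ≤ t * (M / t) := Nat.mul_le_mul_left t hm
      omega
    have h1' : (M : ℝ) ≤ 2 * (t * ((M / t : ℕ) : ℝ)) := by exact_mod_cast h1
    have h5 : (0:ℝ) ≤ ((M / t : ℕ) : ℝ) := by positivity
    have h6 : (0:ℝ) ≤ t := by positivity
    nlinarith
  · calc _ = Real.sqrt M / 10 * (Real.sqrt M / 10 * (Real.sqrt ((M / t : ℕ) : ℝ) / 10) ^ D) := by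
          ring
      _ ≤ (K : ℝ) * d := mul_le_mul hK hd (by positivity) (by positivity)
      _ ≤ _ := by exact_mod_cast hlast

/-- for every depth `D ≥ 2` there is a constant `c > 0` such that for
every fan-in `M ≥ 2`, the depth-`D` AND-OR tree on `n = M^D` variables has
`deg̃_{1/3} ≥ c · n^{1/2} / (log₂ n)^{(D-2)/2}`. -/
theorem and_or_tree_approx_degree :
    ∀ D : ℕ, 2 ≤ D → ∃ c : ℝ, 0 < c ∧ ∀ M : ℕ, 2 ≤ M →
      c * ((M ^ D : ℕ) : ℝ) ^ ((1 : ℝ) / 2)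
          / (Real.logb 2 ((M ^ D : ℕ) : ℝ)) ^ (((D : ℝ) - 2) / 2)
        ≤ (adeg (1/3) (AOT M D true) : ℝ) := by
  intro D hD
  obtain ⟨E, rfl⟩ := Nat.exists_eq_add_of_le' hD
  refine ⟨1 / (100 * 40 ^ E), by positivity, fun M hM => ?_⟩
  obtain ⟨m, hm, hb⟩ := tree_bound E M hM
  refine le_trans ?_ hb
  have hM' : (2:ℝ) ≤ M := by exact_mod_cast hM
  have hl : 1 ≤ Real.logb 2 M := by
    have := Real.logb_le_logb_of_le (b := 2) (by norm_num) (by norm_num) hM'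
    rwa [Real.logb_self_eq_one (by norm_num)] at this
  set L := Real.logb 2 ((M ^ (E + 2) : ℕ) : ℝ) with hL
  have hLM : Real.logb 2 M ≤ L := by
    rw [hL]; push_cast; rw [Real.logb_pow]; push_cast
    have : (0:ℝ) ≤ E := by positivity
    nlinarith
  have hLpos : 0 < L := by linarith
  have h1 : ((M ^ (E + 2) : ℕ) : ℝ) ^ ((1 : ℝ) / 2) = Real.sqrt M ^ (E + 2) := by
    rw [← Real.sqrt_eq_rpow]; push_cast
    rw [Real.sqrt_eq_iff_mul_self_eq (by positivity) (by positivity), ← mul_pow,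
      Real.mul_self_sqrt (by positivity)]
  have h2 : L ^ ((((E + 2 : ℕ) : ℝ) - 2) / 2) = Real.sqrt L ^ E := by
    rw [Real.sqrt_eq_rpow, ← Real.rpow_natCast, ← Real.rpow_mul hLpos.le]
    congr 1; push_cast; ring
  rw [h1, h2]
  have hsL : 0 < Real.sqrt L := Real.sqrt_pos.2 hLpos
  have h3 : Real.sqrt M / (40 * Real.sqrt L) ≤ Real.sqrt m / 10 := by
    rw [div_le_div_iff₀ (by positivity) (by norm_num)]
    have h4 : Real.sqrt M ≤ 4 * (Real.sqrt m * Real.sqrt L) := by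
      rw [← Real.sqrt_mul (by positivity)]
      apply Real.sqrt_le_iff.2
      refine ⟨by positivity, ?_⟩
      rw [mul_pow, Real.sq_sqrt (by positivity)]
      have : (0:ℝ) ≤ m := by positivity
      nlinarith
    nlinarith
  calc _ = Real.sqrt M / 10 * (Real.sqrt M / 10) * (Real.sqrt M / (40 * Real.sqrt L)) ^ E := by
        rw [div_pow, mul_pow, pow_add]
        field_simp
        ring
    _ ≤ _ := by
        gcongr

end
end

section
/- Fix an integer d ≥ 0. Let f : {-1,1}^m → {-1,1} be a Boolean function whose degree-d one-sided non-constant (3/4)-approximate weight satisfies W*_{3/4}(f, d) > w, and let t ≥ 1 be an integer. Let F = OR_t(f,…,f) : ({-1,1}^m)^t → {-1,1}. Then every real polynomial of degree at most d that approximates F pointwise to error 1 − 2^{−t} has weight greater than 2^{−5t}·w; that is, W_{1−2^{−t}}(F, d) > 2^{−5t}·w. -/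
open Finset

noncomputable section

/-- `p` is an `ε`-one-sided approximation to the Boolean function `f`. -/
def IsOneSided {ι : Type*} (f : (ι → Bool) → Bool) (p : (ι → Bool) → ℝ) (ε : ℝ) : Prop :=
  (∀ x, f x = false → |p x - 1| ≤ ε) ∧ (∀ x, f x = true → p x ≤ -1 + ε)

/-- The weight of a polynomial: the `ℓ₁`-norm of its coefficients. -/
def weight {ι : Type*} [Fintype ι] (c : Finset ι → ℝ) : ℝ := ∑ S : Finset ι, |c S|

/-- The non-constant weight of a polynomial: the `ℓ₁`-norm of its coefficients excluding
the constant term. -/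
def ncweight {ι : Type*} [Fintype ι] [DecidableEq ι] (c : Finset ι → ℝ) : ℝ :=
  ∑ S ∈ Finset.univ.filter (fun S : Finset ι => S ≠ ∅), |c S|

lemma polyOf_single {ι : Type*} [Fintype ι] [DecidableEq ι] (S : Finset ι) (a : ℝ) (x : ι → Bool) :
    polyOf (fun T => if T = S then a else 0) x = a * chi S x := by
  simp [polyOf]

lemma ncweight_single {ι : Type*} [Fintype ι] [DecidableEq ι] (S : Finset ι) (a : ℝ) :
    ncweight (fun T => if T = S then a else 0) ≤ |a| := by
  unfold ncweight
  calc _ ≤ ∑ T : Finset ι, |if T = S then a else 0| :=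
        Finset.sum_le_sum_of_subset_of_nonneg (Finset.filter_subset _ _)
          (fun _ _ _ => abs_nonneg _)
    _ = |a| := by
        rw [Finset.sum_eq_single S]
        · simp
        · intro T _ h; simp [h]
        · simp

lemma ncweight_empty {ι : Type*} [Fintype ι] [DecidableEq ι] (a : ℝ) :
    ncweight (fun T : Finset ι => if T = ∅ then a else 0) = 0 := by
  unfold ncweight
  apply Finset.sum_eq_zero
  intro T hT
  simp only [Finset.mem_filter] at hT
  simp [hT.2]

lemma duality (m d : ℕ) (f : (Fin m → Bool) → Bool) (w : ℝ) (hw : 0 < w)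
    (hf : ∀ c : Finset (Fin m) → ℝ, degLE c d →
      IsOneSided f (polyOf c) (3/4) → w < ncweight c) :
    ∃ μ ν : (Fin m → Bool) → ℝ, (∀ x, 0 ≤ μ x) ∧ (∀ x, 0 ≤ ν x) ∧ ∑ x, μ x = 1 ∧
      ∑ x, ν x = 1 ∧ (∀ x, f x = true → μ x = 0) ∧
      ∑ x, ν x * (if f x = true then 0 else 1) ≤ 3/8 ∧
      ∀ S : Finset (Fin m), S.card ≤ d →
        |∑ x, μ x * chi S x - ∑ x, ν x * chi S x| ≤ 3 / (4 * w) := by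
  classical
  let K : Set ((Fin m → Bool) → ℝ) := {g | ∃ c, degLE c d ∧ ncweight c ≤ w ∧ g = polyOf c}
  let C : Set ((Fin m → Bool) → ℝ) :=
    Set.univ.pi (fun x => if f x = true then Set.Iio (-1/4 : ℝ) else Set.Ioo (1/4) (7/4))
  have hKc : Convex ℝ K := by
    rintro _ ⟨c, hc1, hc2, rfl⟩ _ ⟨e, he1, he2, rfl⟩ a b ha hb hab
    refine ⟨fun S => a * c S + b * e S, ?_, ?_, ?_⟩
    · intro S hS
      simp [hc1 S hS, he1 S hS]
    · calc ncweight (fun S => a * c S + b * e S) ≤ a * ncweight c + b * ncweight e := by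
            unfold ncweight
            rw [Finset.mul_sum, Finset.mul_sum, ← Finset.sum_add_distrib]
            apply Finset.sum_le_sum
            intro S _
            calc _ ≤ |a * c S| + |b * e S| := abs_add_le _ _
              _ = _ := by rw [abs_mul, abs_mul, abs_of_nonneg ha, abs_of_nonneg hb]
        _ ≤ a * w + b * w := by gcongr
        _ = w := by rw [← add_mul, hab, one_mul]
    · funext x
      simp only [polyOf, Pi.add_apply, Pi.smul_apply, smul_eq_mul, Finset.mul_sum,
        ← Finset.sum_add_distrib]
      apply Finset.sum_congr rfl
      intros; ring
  have hCc : Convex ℝ C := by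
    apply convex_pi
    intro x _
    split_ifs
    · exact convex_Iio _
    · exact convex_Ioo _ _
  have hCo : IsOpen C := by
    apply isOpen_set_pi Set.finite_univ
    intro x _
    split_ifs
    · exact isOpen_Iio
    · exact isOpen_Ioo
  have memC : ∀ g : (Fin m → Bool) → ℝ, g ∈ C ↔
      ∀ x, (f x = true → g x < -1/4) ∧ (f x = false → 1/4 < g x ∧ g x < 7/4) := by
    intro g
    simp only [C, Set.mem_univ_pi]
    apply forall_congr'
    intro x
    cases h : f x <;> simp
  have hdisj : Disjoint C K := by
    rw [Set.disjoint_left]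
    rintro g hg ⟨c, hc1, hc2, rfl⟩
    rw [memC] at hg
    refine absurd (hf c hc1 ⟨?_, ?_⟩) (not_lt.mpr hc2)
    · intro x hx
      have := (hg x).2 hx
      rw [abs_le]
      constructor <;> linarith
    · intro x hx
      have := (hg x).1 hx
      linarith
  obtain ⟨L, u, hLC, hLK⟩ := geometric_hahn_banach_open hCc hCo hKc hdisj
  set l : (Fin m → Bool) → ℝ := fun x => L (Pi.single x 1) with hl
  have hL : ∀ g, L g = ∑ x, g x * l x := by
    intro g
    have := LinearMap.pi_apply_eq_sum_univ (L : ((Fin m → Bool) → ℝ) →ₗ[ℝ] ℝ) g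
    simp only [ContinuousLinearMap.coe_coe, smul_eq_mul] at this
    rw [this]
    apply Finset.sum_congr rfl
    intro x _
    rw [hl]
    congr 2
    funext y
    simp [Pi.single_apply, eq_comm]
  have hK1 : ∀ a : ℝ, u ≤ a * ∑ x, l x := by
    intro a
    have := hLK (fun _ => a) ⟨fun T => if T = ∅ then a else 0, ?_, ?_, ?_⟩
    · rwa [hL, ← Finset.mul_sum] at this
    · intro S hS
      have : S ≠ ∅ := by rintro rfl; simp at hS
      simp [this]
    · rw [ncweight_empty]; exact hw.le
    · funext x
      rw [polyOf_single]
      simp [chi]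
  have hK2 : ∀ (S : Finset (Fin m)), S.card ≤ d → ∀ a : ℝ, |a| ≤ w →
      u ≤ a * ∑ x, chi S x * l x := by
    intro S hS a ha
    have := hLK (fun x => a * chi S x) ⟨fun T => if T = S then a else 0, ?_, ?_, ?_⟩
    · rw [hL] at this
      rw [Finset.mul_sum]
      simpa [mul_assoc] using this
    · intro T hT
      have : T ≠ S := by rintro rfl; omega
      simp [this]
    · exact (ncweight_single S a).trans ha
    · funext x
      rw [polyOf_single]
  have hu : u ≤ 0 := by simpa using hK1 0
  have hL1 : ∑ x, l x = 0 := by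
    by_contra h
    have := hK1 ((u - 1) / ∑ x, l x)
    rw [div_mul_cancel₀ _ h] at this
    linarith
  let g0 : (Fin m → Bool) → ℝ := fun x => if f x = true then -3/8 else if 0 ≤ l x then 13/8 else 3/8
  have hg0 : L g0 < u := by
    apply hLC
    rw [memC]
    intro x
    simp only [g0]
    refine ⟨fun h => ?_, fun h => ?_⟩
    · simp only [h, if_true]; norm_num
    · simp only [h]
      split_ifs <;> norm_num at *
  have hB : ∀ x, f x = true → 0 ≤ l x := by
    intro x0 hx0
    by_contra hneg
    push Not at hneg
    have hs : 0 ≤ (u - L g0) / (-l x0) := div_nonneg (by linarith) (by linarith)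
    have h1 : L (g0 - ((u - L g0) / (-l x0)) • (Pi.single x0 (1:ℝ) : (Fin m → Bool) → ℝ)) < u := by
      apply hLC
      rw [memC]
      intro x
      by_cases hx : x = x0
      · subst hx
        refine ⟨fun _ => ?_, fun h => by simp [hx0] at h⟩
        have hgv : g0 x = -3/8 := by simp only [g0, hx0, if_true]
        simp only [Pi.sub_apply, Pi.smul_apply, Pi.single_eq_same, smul_eq_mul]
        rw [hgv]
        linarith
      · simp only [Pi.sub_apply, Pi.smul_apply, Pi.single_eq_of_ne hx, smul_zero, sub_zero, g0]
        refine ⟨fun h => ?_, fun h => ?_⟩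
        · simp only [h, if_true]; norm_num
        · simp only [h]
          split_ifs <;> norm_num at *
    rw [map_sub, map_smul] at h1
    have h2 : (u - L g0) / (-l x0) * l x0 = -(u - L g0) := by
      rw [div_neg, neg_mul, div_mul_cancel₀ _ hneg.ne]
    simp only [smul_eq_mul] at h1
    change L g0 - (u - L g0) / (-l x0) * l x0 < u at h1
    linarith
  let n : (Fin m → Bool) → ℝ := fun x => if f x = true then 0 else max (-l x) 0
  let p : (Fin m → Bool) → ℝ := fun x => if f x = true then 0 else max (l x) 0
  let b : (Fin m → Bool) → ℝ := fun x => if f x = true then l x else 0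
  have hn0 : ∀ x, 0 ≤ n x := by intro x; simp only [n]; split_ifs <;> simp
  have hp0 : ∀ x, 0 ≤ p x := by intro x; simp only [p]; split_ifs <;> simp
  have hb0 : ∀ x, 0 ≤ b x := by
    intro x; simp only [b]; split_ifs with h
    · exact hB x h
    · exact le_rfl
  have hlx : ∀ x, l x = p x + b x - n x := by
    intro x; simp only [p, b, n]
    split_ifs
    · ring
    · rcases le_total 0 (l x) with h | h
      · rw [max_eq_left h, max_eq_right (by linarith)]; ring
      · rw [max_eq_right h, max_eq_left (by linarith)]; ring
  have hgx : ∀ x, g0 x * l x = 13/8 * p x - 3/8 * n x - 3/8 * b x := by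
    intro x; simp only [p, b, n, g0]
    split_ifs with h1 h2
    · ring
    · rw [max_eq_left h2, max_eq_right (by linarith)]; ring
    · push Not at h2
      rw [max_eq_right h2.le, max_eq_left (by linarith)]; ring
  have hN0 : 0 ≤ ∑ x, n x := Finset.sum_nonneg fun x _ => hn0 x
  have hP0 : 0 ≤ ∑ x, p x := Finset.sum_nonneg fun x _ => hp0 x
  have hb0' : 0 ≤ ∑ x, b x := Finset.sum_nonneg fun x _ => hb0 x
  have hsum : ∑ x, p x + ∑ x, b x = ∑ x, n x := by
    have : ∑ x, (p x + b x - n x) = 0 := by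
      rw [← hL1]; exact Finset.sum_congr rfl fun x _ => (hlx x).symm
    rw [Finset.sum_sub_distrib, Finset.sum_add_distrib] at this
    linarith
  have hg0' : 13/8 * ∑ x, p x - 3/8 * ∑ x, n x - 3/8 * ∑ x, b x < u := by
    rw [hL, Finset.sum_congr rfl fun x _ => hgx x, Finset.sum_sub_distrib,
      Finset.sum_sub_distrib, ← Finset.mul_sum, ← Finset.mul_sum, ← Finset.mul_sum] at hg0
    exact hg0
  set N := ∑ x, n x with hN
  have hNpos : 0 < N := by
    rcases hN0.lt_or_eq with h | h
    · exact h
    · exfalso; linarith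
  refine ⟨fun x => n x / N, fun x => (p x + b x) / N, fun x => div_nonneg (hn0 x) hN0,
    fun x => div_nonneg (add_nonneg (hp0 x) (hb0 x)) hN0, ?_, ?_, ?_, ?_, ?_⟩
  · rw [← Finset.sum_div, ← hN, div_self hNpos.ne']
  · rw [← Finset.sum_div, Finset.sum_add_distrib, hsum, div_self hNpos.ne']
  · intro x hx; simp [n, hx]
  · have : ∑ x, (p x + b x) / N * (if f x = true then 0 else 1) = (∑ x, p x) / N := by
      rw [Finset.sum_div]
      apply Finset.sum_congr rfl
      intro x _
      simp only [p, b]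
      split_ifs <;> simp
    rw [this, div_le_iff₀ hNpos]
    linarith
  · intro S hS
    have e : ∑ x, n x / N * chi S x - ∑ x, (p x + b x) / N * chi S x
        = -(∑ x, chi S x * l x) / N := by
      rw [← Finset.sum_sub_distrib, neg_div, Finset.sum_div, ← Finset.sum_neg_distrib]
      apply Finset.sum_congr rfl
      intro x _
      rw [hlx]; ring
    have h1 := hK2 S hS w (by rw [abs_of_pos hw])
    have h2 := hK2 S hS (-w) (by rw [abs_neg, abs_of_pos hw])
    rw [e, abs_div, abs_neg, abs_of_pos hNpos, div_le_div_iff₀ hNpos (by positivity)]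
    have h3 : w * |∑ x, chi S x * l x| ≤ 3/4 * N := by
      rcases abs_cases (∑ x, chi S x * l x) with ⟨h, _⟩ | ⟨h, _⟩ <;> rw [h] <;> linarith
    linarith

lemma abs_prod_sub_prod {ι : Type*} (s : Finset ι) (a b : ι → ℝ) (δ : ℝ)
    (ha : ∀ i, |a i| ≤ 1) (hb : ∀ i, |b i| ≤ 1) (hab : ∀ i, |a i - b i| ≤ δ) :
    |∏ i ∈ s, a i - ∏ i ∈ s, b i| ≤ s.card * δ := by
  classical
  induction s using Finset.induction_on with
  | empty => simp
  | insert i s hi ih =>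
    rw [Finset.prod_insert hi, Finset.prod_insert hi, Finset.card_insert_of_notMem hi]
    have hp : |∏ i ∈ s, b i| ≤ 1 := by
      rw [Finset.abs_prod]
      exact Finset.prod_le_one (fun _ _ => abs_nonneg _) (fun i _ => hb i)
    calc _ = |a i * (∏ i ∈ s, a i - ∏ i ∈ s, b i) + (a i - b i) * ∏ i ∈ s, b i| := by
          congr 1; ring
      _ ≤ |a i| * |∏ i ∈ s, a i - ∏ i ∈ s, b i| + |a i - b i| * |∏ i ∈ s, b i| := by
          rw [← abs_mul, ← abs_mul]; exact abs_add_le _ _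
      _ ≤ 1 * (s.card * δ) + δ * 1 := by
          have : 0 ≤ δ := (abs_nonneg _).trans (hab i)
          gcongr
          · exact ha i
          · exact hab i
      _ = _ := by push_cast; ring

/-- Section of a set at block `i`. -/
def secAt {t m : ℕ} (S : Finset (Fin t × Fin m)) (i : Fin t) : Finset (Fin m) :=
  Finset.univ.filter (fun j => (i, j) ∈ S)

lemma card_secAt {t m : ℕ} (S : Finset (Fin t × Fin m)) (i : Fin t) :
    (secAt S i).card ≤ S.card := by
  apply Finset.card_le_card_of_injOn (fun j => (i, j))
  · intro j hj
    simpa [secAt] using hj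
  · intro j _ k _ h
    simpa using h

lemma chi_secAt {t m : ℕ} (S : Finset (Fin t × Fin m)) (y : Fin t → Fin m → Bool) :
    chi S (fun q => y q.1 q.2) = ∏ i, chi (secAt S i) (y i) := by
  unfold chi secAt
  simp only [Finset.prod_filter]
  rw [← Fintype.prod_prod_type' (f := fun i j => if (i, j) ∈ S then bval (y i j) else 1),
    ← Finset.prod_filter]
  congr 1
  ext; simp

lemma sum_prod_pi {t m : ℕ} (h : Fin t → (Fin m → Bool) → ℝ) :
    ∑ y : Fin t → Fin m → Bool, ∏ i, h i (y i) = ∏ i, ∑ x, h i x := by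
  rw [Finset.prod_univ_sum, Fintype.piFinset_univ]

lemma exp_poly {t m : ℕ} (c : Finset (Fin t × Fin m) → ℝ) (μ : (Fin m → Bool) → ℝ) :
    ∑ y : Fin t → Fin m → Bool, (∏ i, μ (y i)) * polyOf c (fun q => y q.1 q.2)
      = ∑ S, c S * ∏ i, ∑ x, μ x * chi (secAt S i) x := by
  simp only [polyOf, Finset.mul_sum]
  rw [Finset.sum_comm]
  apply Finset.sum_congr rfl
  intro S _
  rw [← sum_prod_pi (fun i x => μ x * chi (secAt S i) x), Finset.mul_sum]
  apply Finset.sum_congr rfl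
  intro y _
  rw [chi_secAt, Finset.prod_mul_distrib]
  ring

lemma abs_exp_chi {m : ℕ} (μ : (Fin m → Bool) → ℝ) (h0 : ∀ x, 0 ≤ μ x) (h1 : ∑ x, μ x = 1)
    (S : Finset (Fin m)) : |∑ x, μ x * chi S x| ≤ 1 := by
  calc _ ≤ ∑ x, |μ x * chi S x| := Finset.abs_sum_le_sum_abs _ _
    _ = ∑ x, μ x := by
      apply Finset.sum_congr rfl
      intro x _
      rw [abs_mul, abs_chi, mul_one, abs_of_nonneg (h0 x)]
    _ = 1 := h1
    _ ≤ 1 := le_rfl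

lemma key_bound (m d t : ℕ) (ht : 1 ≤ t)
    (f : (Fin m → Bool) → Bool) (w : ℝ) (hw : 0 < w)
    (hf : ∀ c : Finset (Fin m) → ℝ, degLE c d →
      IsOneSided f (polyOf c) (3/4) → w < ncweight c)
    (c : Finset (Fin t × Fin m) → ℝ) (hc : degLE c d)
    (ha : IsApprox (orBlock t f) (polyOf c) (1 - (1/2) ^ t)) :
    2 * (1/2 : ℝ) ^ t - 2 * (3/8) ^ t ≤ weight c * (t * (3 / (4 * w))) := by
  obtain ⟨μ, ν, hμ0, hν0, hμ1, hν1, hμf, hνf, hch⟩ := duality m d f w hw hf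
  have hM : (1/2 : ℝ) ^ t ≤
      ∑ y : Fin t → Fin m → Bool, (∏ i, μ (y i)) * polyOf c (fun q => y q.1 q.2) := by
    have e : (1/2 : ℝ) ^ t = ∑ y : Fin t → Fin m → Bool, (∏ i, μ (y i)) * (1/2 : ℝ) ^ t := by
      rw [← Finset.sum_mul, sum_prod_pi (fun _ => μ)]
      simp [hμ1]
    rw [e]
    apply Finset.sum_le_sum
    intro y _
    by_cases hy : ∃ i, f (y i) = true
    · obtain ⟨i, hi⟩ := hy
      rw [Finset.prod_eq_zero (Finset.mem_univ i) (hμf _ hi)]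
      simp
    · apply mul_le_mul_of_nonneg_left _ (Finset.prod_nonneg fun i _ => hμ0 _)
      have h := ha (fun q => y q.1 q.2)
      have ho : orBlock t f (fun q => y q.1 q.2) = false := by
        simp only [orBlock, decide_eq_false_iff_not]; exact hy
      rw [ho, abs_le] at h
      simp only [bval] at h
      norm_num at h ⊢
      linarith [h.1]
  have hNu : ∑ y : Fin t → Fin m → Bool, (∏ i, ν (y i)) * polyOf c (fun q => y q.1 q.2)
      ≤ 2 * (3/8) ^ t - (1/2 : ℝ) ^ t := by
    calc _ ≤ ∑ y : Fin t → Fin m → Bool, (∏ i, ν (y i)) *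
          (2 * ∏ i, (if f (y i) = true then (0:ℝ) else 1) - (1/2 : ℝ) ^ t) := by
          apply Finset.sum_le_sum
          intro y _
          apply mul_le_mul_of_nonneg_left _ (Finset.prod_nonneg fun i _ => hν0 _)
          have h := ha (fun q => y q.1 q.2)
          by_cases hy : ∃ i, f (y i) = true
          · have ho : orBlock t f (fun q => y q.1 q.2) = true := by
              simp only [orBlock, decide_eq_true_eq]; exact hy
            obtain ⟨i, hi⟩ := hy
            rw [Finset.prod_eq_zero (Finset.mem_univ i) (by simp [hi])]
            rw [ho, abs_le] at h
            simp only [bval, if_true] at h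
            linarith [h.2]
          · have ho : orBlock t f (fun q => y q.1 q.2) = false := by
              simp only [orBlock, decide_eq_false_iff_not]; exact hy
            push Not at hy
            rw [Finset.prod_eq_one (fun i _ => by simp [hy i])]
            rw [ho, abs_le] at h
            have hb : bval false = 1 := by simp [bval]
            rw [hb] at h
            linarith [h.2]
      _ = 2 * (∑ x, ν x * (if f x = true then 0 else 1)) ^ t - (1/2 : ℝ) ^ t := by
          have e1 : (∑ x, ν x * (if f x = true then (0:ℝ) else 1)) ^ t
              = ∑ y : Fin t → Fin m → Bool,
                (∏ i, ν (y i)) * ∏ i, (if f (y i) = true then (0:ℝ) else 1) := by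
            simp only [← Finset.prod_mul_distrib]
            rw [sum_prod_pi (fun _ x => ν x * (if f x = true then (0:ℝ) else 1))]
            simp
          have e2 : ∑ y : Fin t → Fin m → Bool, (∏ i, ν (y i)) = 1 := by
            rw [sum_prod_pi (fun _ => ν)]; simp [hν1]
          rw [e1]
          simp only [mul_sub, Finset.sum_sub_distrib]
          rw [← Finset.sum_mul, e2, one_mul, Finset.mul_sum]
          congr 1
          apply Finset.sum_congr rfl
          intros; ring
      _ ≤ _ := by
          gcongr
          apply Finset.sum_nonneg
          intro x _
          apply mul_nonneg (hν0 x)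
          split_ifs <;> norm_num
  rw [exp_poly] at hM hNu
  have hD : ∑ S, c S * ∏ i, ∑ x, μ x * chi (secAt S i) x
      - ∑ S, c S * ∏ i, ∑ x, ν x * chi (secAt S i) x ≤ weight c * (t * (3 / (4 * w))) := by
    rw [← Finset.sum_sub_distrib, weight, Finset.sum_mul]
    apply Finset.sum_le_sum
    intro S _
    by_cases hS : d < S.card
    · simp [hc S hS]
    · rw [← mul_sub]
      refine (le_abs_self _).trans ?_
      rw [abs_mul]
      apply mul_le_mul_of_nonneg_left _ (abs_nonneg _)
      have := abs_prod_sub_prod Finset.univ (fun i : Fin t => ∑ x, μ x * chi (secAt S i) x)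
        (fun i => ∑ x, ν x * chi (secAt S i) x) (3 / (4 * w))
        (fun i => abs_exp_chi μ hμ0 hμ1 _) (fun i => abs_exp_chi ν hν0 hν1 _)
        (fun i => hch _ ((card_secAt S i).trans (not_lt.mp hS)))
      simpa using this
  linarith

/-- if every degree-`d` `(3/4)`-one-sided approximation to `f` has
non-constant weight greater than `w` (i.e. `W*_{3/4}(f, d) > w`), then every degree-`d`
polynomial approximating `OR_t(f, …, f)` pointwise to error `1 - 2^{-t}` has weight
greater than `2^{-5t}·w`. -/
theorem weight_hardness_amplification (m d t : ℕ) (ht : 1 ≤ t)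
    (f : (Fin m → Bool) → Bool) (w : ℝ)
    (hf : ∀ c : Finset (Fin m) → ℝ, degLE c d →
      IsOneSided f (polyOf c) (3/4) → w < ncweight c) :
    ∀ c : Finset (Fin t × Fin m) → ℝ, degLE c d →
      IsApprox (orBlock t f) (polyOf c) (1 - (1/2) ^ t) →
      (1/2) ^ (5 * t) * w < weight c := by
  intro c hc ha
  rcases le_or_gt w 0 with hw | hw
  · have h0 : 0 < weight c := by
      have hnn : 0 ≤ weight c := Finset.sum_nonneg fun _ _ => abs_nonneg _
      rcases hnn.lt_or_eq with h | h
      · exact h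
      · exfalso
        have hz : ∀ S, c S = 0 := by
          intro S
          have := (Finset.sum_eq_zero_iff_of_nonneg (fun S _ => abs_nonneg (c S))).mp h.symm S
            (Finset.mem_univ S)
          exact abs_eq_zero.mp this
        have h1 := ha (fun _ => false)
        have hp : polyOf c (fun _ => false) = 0 := by simp [polyOf, hz]
        rw [hp, zero_sub, abs_neg, abs_bval] at h1
        have : (0:ℝ) < (1/2) ^ t := by positivity
        linarith
    have : (1/2 : ℝ) ^ (5 * t) * w ≤ 0 := mul_nonpos_of_nonneg_of_nonpos (by positivity) hw
    linarith
  · have h := key_bound m d t ht f w hw hf c hc ha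
    have ht0 : (0:ℝ) < t := by exact_mod_cast ht
    have hA : (0:ℝ) < (1/2) ^ t := by positivity
    have h38 : (3/8 : ℝ) ^ t ≤ 3/4 * (1/2) ^ t := by
      have : (3/8 : ℝ) ^ t = (3/4) ^ t * (1/2) ^ t := by rw [← mul_pow]; norm_num
      rw [this]
      gcongr
      calc (3/4 : ℝ) ^ t ≤ (3/4) ^ 1 := pow_le_pow_of_le_one (by norm_num) (by norm_num) ht
        _ = 3/4 := by norm_num
    have h1 : 1/2 * (1/2 : ℝ) ^ t ≤ weight c * (t * (3 / (4 * w))) := by linarith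
    have h2 : 2 / 3 * (1/2 : ℝ) ^ t * w ≤ weight c * t := by
      have e : weight c * (t * (3 / (4 * w))) = weight c * t * 3 / (4 * w) := by ring
      rw [e, le_div_iff₀ (by positivity)] at h1
      linarith
    have htt : (t : ℝ) * (1/2) ^ t ≤ 1 := by
      have : (t : ℝ) < 2 ^ t := by exact_mod_cast Nat.lt_two_pow_self
      rw [one_div, inv_pow, ← div_eq_mul_inv, div_le_one (by positivity)]
      exact this.le
    have hA1 : (1/2 : ℝ) ^ t ≤ 1/2 := by
      calc (1/2 : ℝ) ^ t ≤ (1/2) ^ 1 := pow_le_pow_of_le_one (by norm_num) (by norm_num) ht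
        _ = 1/2 := by norm_num
    have e5 : (1/2 : ℝ) ^ (5 * t) = ((1/2) ^ t) ^ 5 := by rw [mul_comm, pow_mul]
    rw [e5]
    set A := (1/2 : ℝ) ^ t
    have h3 : A ^ 5 * w * t < weight c * t := by
      refine lt_of_lt_of_le ?_ h2
      have h4 : A ^ 3 ≤ (1/2) ^ 3 := by gcongr
      calc A ^ 5 * w * t = A ^ 3 * (t * A) * (A * w) := by ring
        _ ≤ (1/2) ^ 3 * 1 * (A * w) := by gcongr
        _ < 2 / 3 * (A * w) := by
            have : 0 < A * w := by positivity
            linarith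
        _ = _ := by ring
    exact lt_of_mul_lt_mul_right h3 ht0.le


end
end

section
/- There exist constants c₁, c₂ > 0 such that for all integers n ≥ 2 and d with 1 ≤ d ≤ c₁·n/(log₂n)², the function AND_n satisfies W*_{3/4}(AND_n, d) ≥ 2^{c₂·n/d}; that is, every real polynomial of degree at most d that is a (3/4)-one-sided approximation to AND_n has non-constant weight at least 2^{c₂·n/d}. -/
open Finset

noncomputable section

/-- The AND function: TRUE (`true`, i.e. `-1`) iff all inputs are TRUE. -/
def ANDf (n : ℕ) (x : Fin n → Bool) : Bool := decide (∀ i, x i = true)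

open Polynomial in
lemma degree_Cmul_le (a : ℝ) (p : ℝ[X]) : (C a * p).degree ≤ p.degree := by
  rw [← smul_eq_C_mul]
  exact degree_smul_le a p

open Polynomial in
lemma cheb_deriv_bound (m k : ℕ) :
    0 ≤ (derivative^[k] (Chebyshev.T ℝ m)).eval 1 ∧
      (derivative^[k] (Chebyshev.T ℝ m)).eval 1 ≤ ((m : ℝ) ^ 2) ^ k := by
  induction k with
  | zero => simp
  | succ k ih =>
    obtain ⟨h0, h1⟩ := ih
    by_cases hk : k < m
    · have hr := Chebyshev.iterate_derivative_T_eval_one_recurrence (R := ℝ) (m : ℤ) k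
      push_cast at hr
      set A := (derivative^[k + 1] (Chebyshev.T ℝ (m : ℤ))).eval 1
      set D := (derivative^[k] (Chebyshev.T ℝ (m : ℤ))).eval 1
      have hkm : (k : ℝ) ≤ m := by exact_mod_cast hk.le
      have hk0 : (0 : ℝ) ≤ k := Nat.cast_nonneg k
      have hs : (0 : ℝ) ≤ (m : ℝ) ^ 2 - (k : ℝ) ^ 2 := by nlinarith
      have hA : 0 ≤ A := by
        have : 0 ≤ (2 * (k : ℝ) + 1) * A := by rw [hr]; positivity
        exact nonneg_of_mul_nonneg_right this (by positivity)
      refine ⟨hA, ?_⟩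
      calc A ≤ (2 * (k : ℝ) + 1) * A := by nlinarith
        _ = ((m : ℝ) ^ 2 - (k : ℝ) ^ 2) * D := hr
        _ ≤ (m : ℝ) ^ 2 * D := by gcongr; nlinarith [sq_nonneg (k : ℝ)]
        _ ≤ (m : ℝ) ^ 2 * ((m : ℝ) ^ 2) ^ k := by gcongr
        _ = _ := by ring
    · have : derivative^[k + 1] (Chebyshev.T ℝ (m : ℤ)) = 0 := by
        apply iterate_derivative_eq_zero_of_degree_lt
        rw [Chebyshev.degree_T, Int.natAbs_natCast]
        exact_mod_cast (by omega : m < k + 1)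
      rw [this]
      simp

open Polynomial in
lemma deriv_bound {m : ℕ} {Q : ℝ[X]} {B : ℝ} (hB : 0 < B) (hdeg : Q.degree ≤ m)
    (hb : ∀ x ∈ Set.Icc (-1 : ℝ) 1, |Q.eval x| ≤ B) (k : ℕ) :
    |(derivative^[k] Q).eval 1| ≤ B * ((m : ℝ) ^ 2) ^ k := by
  have key : ∀ s : ℝ, |s| = 1 → s * (derivative^[k] Q).eval 1 ≤ B * ((m : ℝ) ^ 2) ^ k := by
    intro s hs
    have h := Chebyshev.eval_iterate_derivative_le_of_forall_abs_le_one (n := m)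
      (P := C (s / B) * Q) (k := k) (x := 1) le_rfl
      ((degree_Cmul_le _ _).trans hdeg) (by
        intro x hx
        have := hb x hx
        rw [eval_mul, eval_C, abs_mul, abs_div, hs, abs_of_pos hB, one_div, inv_mul_le_iff₀ hB]
        simpa using this)
    rw [iterate_derivative_C_mul, eval_mul, eval_C] at h
    have h2 := h.trans (cheb_deriv_bound m k).2
    rw [div_mul_eq_mul_div, div_le_iff₀ hB] at h2
    linarith
  rw [abs_le]
  have h1 := key 1 (by simp)
  have h2 := key (-1) (by simp)
  constructor <;> linarith

open Polynomial in
lemma markov_jump {m : ℕ} {Q : ℝ[X]} {B δ : ℝ} (hB : 0 < B) (hdeg : Q.degree ≤ m)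
    (hb : ∀ x ∈ Set.Icc (-1 : ℝ) 1, |Q.eval x| ≤ B) (hδ : 0 ≤ δ) (hm : (m : ℝ) ^ 2 * δ ≤ 1) :
    |Q.eval 1 - Q.eval (1 - δ)| ≤ B * (2 * ((m : ℝ) ^ 2 * δ)) := by
  have hx0 : 0 ≤ (m : ℝ) ^ 2 * δ := by positivity
  set N := Q.natDegree
  have h1 : Q.eval (1 - δ) = ∑ k ∈ Finset.range (N + 1), (hasseDeriv k Q).eval 1 * (-δ) ^ k := by
    have h := taylor_eval (R := ℝ) 1 Q (-δ)
    rw [show -δ + 1 = 1 - δ by ring] at h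
    rw [← h, eval_eq_sum_range, natDegree_taylor]
    simp [taylor_coeff, N]
  rw [Finset.sum_range_succ'] at h1
  simp only [hasseDeriv_zero, pow_zero, mul_one] at h1
  have h2 : |Q.eval 1 - Q.eval (1 - δ)| ≤
      ∑ k ∈ Finset.range N, B * (((m : ℝ) ^ 2 * δ) ^ (k + 1) / ((k + 1).factorial : ℝ)) := by
    rw [h1]
    simp only [LinearMap.id_coe, id_eq]
    rw [sub_add_cancel_right, abs_neg]
    refine (Finset.abs_sum_le_sum_abs _ _).trans (Finset.sum_le_sum fun k _ => ?_)
    have hh := deriv_bound hB hdeg hb (k + 1)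
    rw [← factorial_smul_hasseDeriv] at hh
    have hf : (0 : ℝ) < ((k + 1).factorial : ℝ) := by positivity
    rw [LinearMap.smul_apply, eval_smul, nsmul_eq_mul] at hh
    rw [abs_mul, abs_of_pos hf] at hh
    rw [abs_mul, abs_pow, abs_neg, abs_of_nonneg hδ, mul_pow, ← mul_div_assoc, le_div_iff₀ hf]
    calc _ = (((k + 1).factorial : ℝ) * |eval 1 ((hasseDeriv (k + 1)) Q)|) * δ ^ (k + 1) := by ring
      _ ≤ (B * ((m : ℝ) ^ 2) ^ (k + 1)) * δ ^ (k + 1) := by gcongr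
      _ = _ := by ring
  refine h2.trans ?_
  rw [← Finset.mul_sum]
  gcongr
  have h3 := Real.sum_le_exp_of_nonneg hx0 (N + 1)
  rw [Finset.sum_range_succ'] at h3
  have h4 := Real.abs_exp_sub_one_le (x := (m : ℝ) ^ 2 * δ) (by rwa [abs_of_nonneg hx0])
  rw [abs_of_nonneg hx0] at h4
  have h5 := (abs_le.mp h4).2
  simp only [pow_zero, Nat.factorial_zero, Nat.cast_one, div_one] at h3
  linarith

/-- Truncated binomial expansion. -/
lemma trunc_err (e m : ℕ) {a r u : ℝ} (ha : 0 ≤ a) (hr : 0 ≤ r) (hu : |u| ≤ 1) :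
    |(a + r * u) ^ e - ∑ k ∈ range (m + 1), (e.choose k : ℝ) * a ^ (e - k) * r ^ k * u ^ k|
      ≤ (a + 2 * r) ^ e / 2 ^ m := by
  set N := max (e + 1) (m + 1)
  have hext : ∀ y : ℝ, (a + y) ^ e = ∑ k ∈ range N, (e.choose k : ℝ) * a ^ (e - k) * y ^ k := by
    intro y
    rw [add_comm, add_pow]
    have hsub : range (e + 1) ⊆ range N := range_subset_range.mpr (le_max_left _ _)
    rw [← Finset.sum_subset hsub]
    · refine Finset.sum_congr rfl fun k _ => by ring
    · intro k _ hk
      rw [Nat.choose_eq_zero_of_lt (by simpa using hk)]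
      simp
  have hsub : range (m + 1) ⊆ range N := range_subset_range.mpr (le_max_right _ _)
  have h1 : (a + r * u) ^ e - ∑ k ∈ range (m + 1), (e.choose k : ℝ) * a ^ (e - k) * r ^ k * u ^ k
      = ∑ k ∈ range N \ range (m + 1), (e.choose k : ℝ) * a ^ (e - k) * r ^ k * u ^ k := by
    rw [hext, sub_eq_iff_eq_add, Finset.sum_sdiff hsub]
    refine Finset.sum_congr rfl fun k _ => by rw [mul_pow]; ring
  rw [h1, hext, Finset.sum_div]
  refine (Finset.abs_sum_le_sum_abs _ _).trans ?_
  refine le_trans ?_ (Finset.sum_le_sum_of_subset_of_nonneg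
    (Finset.sdiff_subset (t := range (m + 1))) ?_)
  · refine Finset.sum_le_sum fun k hk => ?_
    have hk' : m ≤ k := by
      simp at hk; omega
    rw [abs_mul, abs_pow, abs_of_nonneg (by positivity : (0 : ℝ) ≤ (e.choose k : ℝ) * a ^ (e - k) * r ^ k)]
    rw [le_div_iff₀ (by positivity)]
    have h2 : |u| ^ k ≤ 1 := pow_le_one₀ (abs_nonneg _) hu
    have h3 : (2 : ℝ) ^ m ≤ 2 ^ k := pow_le_pow_right₀ (by norm_num) hk'
    calc (e.choose k : ℝ) * a ^ (e - k) * r ^ k * |u| ^ k * 2 ^ m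
        ≤ (e.choose k : ℝ) * a ^ (e - k) * r ^ k * 1 * 2 ^ k := by gcongr
      _ = _ := by rw [mul_pow]; ring
  · intro k _ _
    positivity

open Polynomial in
lemma weight_jump {ι : Type*} [Fintype ι] (b : ι → ℝ) (e : ι → ℕ) (d m : ℕ) {V B r h : ℝ}
    (hd : ∀ i, d < e i → b i = 0) (hV : ∑ i, |b i| ≤ V) (hB : 0 < B)
    (hb : ∀ x ∈ Set.Icc (-1 : ℝ) 1, |∑ i, b i * x ^ e i| ≤ B)
    (hr0 : 0 < r) (hr1 : r ≤ 1) (hh0 : 0 ≤ h) (hh2 : h ≤ 2 * r)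
    (hm : (m : ℝ) ^ 2 * (h / r) ≤ 1) :
    |∑ i, b i * (1 : ℝ) ^ e i - ∑ i, b i * (1 - h) ^ e i| ≤
      2 * (V * ((1 + r) ^ d / 2 ^ m)) +
        (B + V * ((1 + r) ^ d / 2 ^ m)) * (2 * ((m : ℝ) ^ 2 * (h / r))) := by
  have hV0 : 0 ≤ V := le_trans (Finset.sum_nonneg fun i _ => abs_nonneg _) hV
  set E := V * ((1 + r) ^ d / 2 ^ m) with hE
  have hE0 : 0 ≤ E := by positivity
  set Q : ℝ[X] := ∑ i, C (b i) * ∑ k ∈ range (m + 1),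
    C (((e i).choose k : ℝ) * (1 - r) ^ (e i - k) * r ^ k) * X ^ k with hQ
  have hQe : ∀ u, Q.eval u = ∑ i, b i * ∑ k ∈ range (m + 1),
      ((e i).choose k : ℝ) * (1 - r) ^ (e i - k) * r ^ k * u ^ k := by
    intro u
    simp only [hQ, eval_finsetSum, eval_mul, eval_C, eval_pow, eval_X]
  have hdeg : Q.degree ≤ m := by
    refine (degree_sum_le _ _).trans (Finset.sup_le fun i _ => ?_)
    refine (degree_Cmul_le _ _).trans ?_
    refine (degree_sum_le _ _).trans (Finset.sup_le fun k hk => ?_)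
    refine (degree_C_mul_X_pow_le _ _).trans ?_
    have : k ≤ m := by simp at hk; omega
    exact_mod_cast this
  have herr : ∀ u : ℝ, |u| ≤ 1 → |∑ i, b i * (1 - r + r * u) ^ e i - Q.eval u| ≤ E := by
    intro u hu
    rw [hQe, ← Finset.sum_sub_distrib]
    refine (Finset.abs_sum_le_sum_abs _ _).trans ?_
    calc _ ≤ ∑ i, |b i| * ((1 + r) ^ d / 2 ^ m) := by
          refine Finset.sum_le_sum fun i _ => ?_
          rw [← mul_sub, abs_mul]
          by_cases hi : d < e i
          · simp [hd i hi]
          · gcongr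
            refine (trunc_err (e i) m (by linarith) hr0.le hu).trans ?_
            rw [show 1 - r + 2 * r = 1 + r by ring]
            gcongr
            · linarith
            · omega
      _ = (∑ i, |b i|) * ((1 + r) ^ d / 2 ^ m) := by rw [Finset.sum_mul]
      _ ≤ E := by rw [hE]; gcongr
  have hQb : ∀ u ∈ Set.Icc (-1 : ℝ) 1, |Q.eval u| ≤ B + E := by
    intro u hu
    have h1 := herr u (abs_le.mpr hu)
    have h2 := hb (1 - r + r * u) ⟨by nlinarith [hu.1, hu.2], by nlinarith [hu.1, hu.2]⟩
    rw [abs_le] at *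
    constructor <;> linarith [h1.1, h1.2, h2.1, h2.2]
  have hj := markov_jump (by linarith) hdeg hQb (by positivity) hm
  have h1 := herr 1 (by simp)
  have h2 := herr (1 - h / r) (by
    have : h / r ≤ 2 := by rw [div_le_iff₀ hr0]; linarith
    have : 0 ≤ h / r := by positivity
    rw [abs_le]; constructor <;> linarith)
  rw [show 1 - r + r * 1 = (1 : ℝ) by ring] at h1
  rw [show 1 - r + r * (1 - h / r) = (1 : ℝ) - h by field_simp; ring] at h2
  rw [abs_le] at *
  constructor <;> linarith [h1.1, h1.2, h2.1, h2.2, hj.1, hj.2]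

/-- product weight -/
def pw (n : ℕ) (t : ℝ) (x : Fin n → Bool) : ℝ :=
  ∏ i, if x i then (1 + t) / 2 else (1 - t) / 2

lemma pw_sum_chi (n : ℕ) (t : ℝ) (S : Finset (Fin n)) :
    ∑ x, pw n t x * chi S x = (-t) ^ S.card := by
  have h : ∀ x : Fin n → Bool, pw n t x * chi S x =
      ∏ i, ((if x i then (1 + t) / 2 else (1 - t) / 2) * (if i ∈ S then bval (x i) else 1)) := by
    intro x
    rw [Finset.prod_mul_distrib, pw, chi, Finset.prod_ite_mem, Finset.univ_inter]
  simp_rw [h]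
  rw [← Fintype.prod_sum (f := fun i (b : Bool) =>
    (if b then (1 + t) / 2 else (1 - t) / 2) * (if i ∈ S then bval b else 1))]
  have h2 : ∀ i : Fin n, ∑ b : Bool, (if b then (1 + t) / 2 else (1 - t) / 2) *
      (if i ∈ S then bval b else 1) = if i ∈ S then -t else 1 := by
    intro i
    by_cases hi : i ∈ S <;> simp [hi, bval] <;> ring
  simp_rw [h2]
  rw [Finset.prod_ite_mem, Finset.univ_inter, Finset.prod_const]

lemma pw_sum (n : ℕ) (t : ℝ) : ∑ x, pw n t x = 1 := by
  have := pw_sum_chi n t ∅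
  simpa [chi] using this

lemma pw_sum_poly (n : ℕ) (t : ℝ) (c : Finset (Fin n) → ℝ) :
    ∑ x, pw n t x * polyOf c x = ∑ S, c S * (-1) ^ S.card * t ^ S.card := by
  simp_rw [polyOf, Finset.mul_sum]
  rw [Finset.sum_comm]
  refine Finset.sum_congr rfl fun S _ => ?_
  rw [mul_assoc, ← mul_pow, neg_one_mul, ← pw_sum_chi, Finset.mul_sum]
  refine Finset.sum_congr rfl fun x _ => by ring

lemma pw_nonneg (n : ℕ) {t : ℝ} (h : t ∈ Set.Icc (-1 : ℝ) 1) (x) : 0 ≤ pw n t x := by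
  refine Finset.prod_nonneg fun i _ => ?_
  split_ifs <;> linarith [h.1, h.2]

lemma poly_bounds (n : ℕ) (c : Finset (Fin n) → ℝ) (hc : IsOneSided (ANDf n) (polyOf c) (3/4)) :
    ∃ M : ℝ, 1/4 ≤ M ∧ ∀ t ∈ Set.Icc (-1 : ℝ) 1,
      -M * ((1 + t) / 2) ^ n + (1/4) * (1 - ((1 + t) / 2) ^ n) ≤
        ∑ S, c S * (-1) ^ S.card * t ^ S.card ∧
      ∑ S, c S * (-1) ^ S.card * t ^ S.card ≤
        -M * ((1 + t) / 2) ^ n + (7/4) * (1 - ((1 + t) / 2) ^ n) := by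
  obtain ⟨h1, h2⟩ := hc
  set o : Fin n → Bool := fun _ => true with ho
  have h3 := h2 o (by simp [ANDf, o])
  refine ⟨-polyOf c o, by linarith, fun t ht => ?_⟩
  have hw : pw n t o = ((1 + t) / 2) ^ n := by simp [pw, o, div_pow]
  rw [← pw_sum_poly, ← hw]
  have hs : ∑ x ∈ univ.erase o, pw n t x = 1 - pw n t o := by
    rw [← pw_sum n t, ← Finset.add_sum_erase _ _ (Finset.mem_univ o)]; ring
  rw [← Finset.add_sum_erase _ _ (Finset.mem_univ o), ← hs]
  have hx : ∀ x ∈ univ.erase o, |polyOf c x - 1| ≤ 3/4 := by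
    intro x hx
    apply h1
    have hne : x ≠ o := Finset.ne_of_mem_erase hx
    simp only [ANDf, decide_eq_false_iff_not]
    intro h
    exact hne (funext h)
  have e1 : ∑ x ∈ univ.erase o, pw n t x * (1/4) ≤ ∑ x ∈ univ.erase o, pw n t x * polyOf c x := by
    refine Finset.sum_le_sum fun x h => ?_
    have := (abs_le.mp (hx x h)).1
    exact mul_le_mul_of_nonneg_left (by linarith) (pw_nonneg n ht x)
  have e2 : ∑ x ∈ univ.erase o, pw n t x * polyOf c x ≤ ∑ x ∈ univ.erase o, pw n t x * (7/4) := by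
    refine Finset.sum_le_sum fun x h => ?_
    have := (abs_le.mp (hx x h)).2
    exact mul_le_mul_of_nonneg_left (by linarith) (pw_nonneg n ht x)
  rw [← Finset.sum_mul] at e1 e2
  constructor <;> linarith

/-- Normalised univariate polynomial. -/
lemma normalized (n d : ℕ) (hn : 2 ≤ n) (c : Finset (Fin n) → ℝ) (hdeg : degLE c d)
    (hc : IsOneSided (ANDf n) (polyOf c) (3/4)) :
    ∃ b : Finset (Fin n) → ℝ, (∀ S, d < S.card → b S = 0) ∧ ∑ S, |b S| ≤ 4 * ncweight c + 7 ∧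
      (∀ x ∈ Set.Icc (-1 : ℝ) 1, |∑ S, b S * x ^ S.card| ≤ 7) ∧
      3/4 ≤ |∑ S, b S * (1 : ℝ) ^ S.card - ∑ S, b S * (1 - 4 / (n : ℝ)) ^ S.card| := by
  obtain ⟨M, hM, hb⟩ := poly_bounds n c hc
  have hM0 : 0 < M := by linarith
  have hn' : (2 : ℝ) ≤ n := by exact_mod_cast hn
  have hP : ∀ t : ℝ, ∑ S : Finset (Fin n), (c S * (-1) ^ S.card / M) * t ^ S.card =
      (∑ S : Finset (Fin n), c S * (-1) ^ S.card * t ^ S.card) / M := by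
    intro t
    rw [Finset.sum_div]
    refine Finset.sum_congr rfl fun S _ => by ring
  have hbd : ∀ x ∈ Set.Icc (-1 : ℝ) 1,
      |∑ S : Finset (Fin n), (c S * (-1) ^ S.card / M) * x ^ S.card| ≤ 7 := by
    intro x hx
    obtain ⟨l, u⟩ := hb x hx
    have g0 : 0 ≤ ((1 + x) / 2) ^ n := pow_nonneg (by linarith [hx.1]) _
    have g1 : ((1 + x) / 2) ^ n ≤ 1 := pow_le_one₀ (by linarith [hx.1]) (by linarith [hx.2])
    rw [hP, abs_div, abs_of_pos hM0, div_le_iff₀ hM0, abs_le]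
    constructor <;> nlinarith
  refine ⟨fun S => c S * (-1) ^ S.card / M, ?_, ?_, hbd, ?_⟩
  · intro S hS
    simp [hdeg S hS]
  · have h0 := hbd 0 (by simp)
    have e : ∑ S : Finset (Fin n), (c S * (-1) ^ S.card / M) * (0 : ℝ) ^ S.card = c ∅ / M := by
      rw [Finset.sum_eq_single ∅]
      · simp
      · intro S _ hS
        have : S.card ≠ 0 := by simpa using hS
        simp [this]
      · simp
    rw [e] at h0
    have h1 : ∀ S : Finset (Fin n), |c S * (-1) ^ S.card / M| = |c S| / M := by
      intro S
      rw [abs_div, abs_mul, abs_pow, abs_neg, abs_one, one_pow, mul_one, abs_of_pos hM0]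
    simp_rw [h1]
    rw [← Finset.add_sum_erase _ _ (Finset.mem_univ (∅ : Finset (Fin n)))]
    have h2 : |c ∅| / M ≤ 7 := by rwa [abs_div, abs_of_pos hM0] at h0
    have h3 : ∑ S ∈ univ.erase (∅ : Finset (Fin n)), |c S| / M = ncweight c / M := by
      rw [ncweight, Finset.sum_div, Finset.filter_ne']
    have h4 : 0 ≤ ncweight c := Finset.sum_nonneg fun _ _ => abs_nonneg _
    have h5 : ncweight c / M ≤ 4 * ncweight c := by
      rw [div_le_iff₀ hM0]; nlinarith
    rw [h3]; linarith
  · have hn0 : (0 : ℝ) < n := by linarith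
    have h4n : 4 / (n : ℝ) ≤ 2 := by rw [div_le_iff₀ hn0]; linarith
    have h4n0 : 0 < 4 / (n : ℝ) := by positivity
    have a1 := hb 1 (by simp)
    have a2 := hb (1 - 4 / (n : ℝ)) ⟨by linarith, by linarith⟩
    have g0 : 0 ≤ ((1 + (1 - 4 / (n : ℝ))) / 2) ^ n := pow_nonneg (by linarith) _
    have g1 : ((1 + (1 - 4 / (n : ℝ))) / 2) ^ n ≤ 1/4 := by
      have q1 : (1 + (1 - 4 / (n : ℝ))) / 2 ≤ Real.exp (-(2 / (n : ℝ))) := by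
        have := Real.add_one_le_exp (-(2 / (n : ℝ)))
        have e : (1 + (1 - 4 / (n : ℝ))) / 2 = -(2 / (n : ℝ)) + 1 := by ring
        linarith
      have q2 : ((1 + (1 - 4 / (n : ℝ))) / 2) ^ n ≤ (Real.exp (-(2 / (n : ℝ)))) ^ n :=
        pow_le_pow_left₀ (by linarith) q1 n
      rw [← Real.exp_nat_mul, show (n : ℝ) * -(2 / (n : ℝ)) = -2 by field_simp] at q2
      refine q2.trans ?_
      rw [Real.exp_neg, show (2 : ℝ) = 1 + 1 by norm_num, Real.exp_add]
      have : (2 : ℝ) ≤ Real.exp 1 := by linarith [Real.exp_one_gt_d9]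
      rw [inv_le_comm₀ (by positivity) (by norm_num)]
      norm_num
      nlinarith
    rw [hP, hP, ← sub_div, abs_div, abs_of_pos hM0, le_div_iff₀ hM0, abs_sub_comm]
    refine le_trans ?_ (le_abs_self _)
    have u1 := a1.2
    norm_num at u1
    have u1' : ∑ S : Finset (Fin n), c S * (-1) ^ S.card * (1 : ℝ) ^ S.card ≤ -M := by
      simpa using u1
    nlinarith [a2.1]

/-- there are constants `c₁, c₂ > 0` such that for all `n ≥ 2` and
`1 ≤ d ≤ c₁·n/(log₂ n)²`, `W*_{3/4}(AND_n, d) ≥ 2^{c₂·n/d}`: every degree-`d`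
`(3/4)`-one-sided approximation to `AND_n` has non-constant weight at least
`2^{c₂·n/d}`. -/
theorem and_one_sided_weight :
    ∃ c₁ c₂ : ℝ, 0 < c₁ ∧ 0 < c₂ ∧
      ∀ n d : ℕ, 2 ≤ n → 1 ≤ d → (d : ℝ) ≤ c₁ * n / (Real.logb 2 (n : ℝ)) ^ 2 →
        ∀ c : Finset (Fin n) → ℝ, degLE c d → IsOneSided (ANDf n) (polyOf c) (3/4) →
          (2 : ℝ) ^ (c₂ * n / d) ≤ ncweight c := by
  refine ⟨1/100000, 1/10000, by norm_num, by norm_num, ?_⟩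
  intro n d hn hd hdn c hdeg hc
  by_contra! hW
  obtain ⟨b, hb0, hbV, hbB, hbj⟩ := normalized n d hn c hdeg hc
  have hn' : (2 : ℝ) ≤ n := by exact_mod_cast hn
  have hn0 : (0 : ℝ) < n := by linarith
  have hd' : (1 : ℝ) ≤ d := by exact_mod_cast hd
  have hd0 : (0 : ℝ) < d := by linarith
  have hlog : 1 ≤ Real.logb 2 (n : ℝ) := by
    rw [Real.le_logb_iff_rpow_le (by norm_num) hn0]; simpa using hn'
  have hdn2 : (100000 : ℝ) * d ≤ n := by
    have h1 : (1/100000 : ℝ) * n / (Real.logb 2 (n : ℝ)) ^ 2 ≤ 1/100000 * n :=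
      div_le_self (by positivity) (by nlinarith)
    linarith
  by_cases hcase : (d : ℝ) ^ 2 * 8000 ≤ n
  · -- small degree: apply the Markov bound directly
    set P : Polynomial ℝ := ∑ S, Polynomial.C (b S) * Polynomial.X ^ S.card with hP
    have hPe : ∀ x, P.eval x = ∑ S, b S * x ^ S.card := by
      intro x
      simp [hP, Polynomial.eval_finsetSum]
    have hPd : P.degree ≤ d := by
      refine (Polynomial.degree_sum_le _ _).trans (Finset.sup_le fun S _ => ?_)
      by_cases hS : d < S.card
      · simp [hb0 S hS]
      · refine (Polynomial.degree_C_mul_X_pow_le _ _).trans ?_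
        exact_mod_cast not_lt.mp hS
    have hsm : (d : ℝ) ^ 2 * (4 / (n : ℝ)) ≤ 1/2000 := by
      rw [← mul_div_assoc, div_le_iff₀ hn0]; linarith
    have := markov_jump (δ := 4 / (n : ℝ)) (by norm_num : (0 : ℝ) < 7) hPd
      (fun x hx => by rw [hPe]; exact hbB x hx) (by positivity) (by linarith)
    rw [hPe, hPe] at this
    linarith
  · push Not at hcase
    set L : ℝ := n / d with hL
    have hL0 : 100000 ≤ L := by rw [hL, le_div_iff₀ hd0]; exact hdn2
    have hLd : L * d = n := by rw [hL]; field_simp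
    set r : ℝ := L / (8000 * d) with hr
    have hr0 : 0 < r := by positivity
    have hr1 : r ≤ 1 := by
      rw [hr, div_le_one (by positivity)]
      have : L * d ≤ 8000 * d * d := by rw [hLd]; nlinarith
      exact le_of_mul_le_mul_right this hd0
    set m : ℕ := ⌈L / 2048⌉₊ with hm
    have hm1 : L / 2048 ≤ m := Nat.le_ceil _
    have hm2 : (m : ℝ) ≤ L / 2048 * (49/48) := by
      have := Nat.ceil_lt_add_one (by positivity : 0 ≤ L / 2048)
      rw [← hm] at this
      linarith
    have hhr : 4 / (n : ℝ) / r = 32000 / L ^ 2 := by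
      rw [hr, ← hLd]; field_simp; norm_num
    have hmh : (m : ℝ) ^ 2 * (4 / (n : ℝ) / r) ≤ 1/100 := by
      rw [hhr, ← mul_div_assoc, div_le_iff₀ (by positivity)]
      have : (m : ℝ) ^ 2 ≤ (L / 2048 * (49/48)) ^ 2 := by gcongr
      nlinarith
    have hh2 : 4 / (n : ℝ) ≤ 2 * r := by
      have : 4 / (n : ℝ) / r ≤ 2 := by
        rw [hhr, div_le_iff₀ (by positivity)]; nlinarith
      rwa [div_le_iff₀ hr0] at this
    have hj := weight_jump b (fun S => S.card) d m (h := 4 / (n : ℝ)) hb0 hbV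
      (by norm_num : (0 : ℝ) < 7) hbB hr0 hr1 (by positivity) hh2 (by linarith)
    have hV : 4 * ncweight c + 7 ≤ 11 * Real.exp (L / 10000) := by
      have h1 : (2 : ℝ) ^ ((1/10000 : ℝ) * n / d) ≤ Real.exp (L / 10000) := by
        rw [Real.rpow_def_of_pos (by norm_num), Real.exp_le_exp]
        have e : (1/10000 : ℝ) * n / d = L / 10000 := by rw [hL]; ring
        rw [e]
        nlinarith [Real.log_two_lt_d9]
      have h2 : 1 ≤ Real.exp (L / 10000) := Real.one_le_exp (by positivity)
      linarith
    have hE : (4 * ncweight c + 7) * ((1 + r) ^ d / 2 ^ m) ≤ 1/8 := by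
      have h1 : (1 + r) ^ d ≤ Real.exp (L / 8000) := by
        have q := Real.add_one_le_exp r
        calc (1 + r) ^ d ≤ (Real.exp r) ^ d := by gcongr; linarith
          _ = Real.exp (L / 8000) := by
            rw [← Real.exp_nat_mul]; congr 1; rw [hr]; field_simp
      have h2 : Real.exp (0.69 * (L / 2048)) ≤ 2 ^ m := by
        rw [← Real.rpow_natCast, Real.rpow_def_of_pos (by norm_num), Real.exp_le_exp]
        have := Real.log_two_gt_d9
        calc 0.69 * (L / 2048) ≤ Real.log 2 * (L / 2048) := by gcongr; linarith
          _ ≤ Real.log 2 * m := by gcongr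
      have h3 : (4 * ncweight c + 7) * ((1 + r) ^ d / 2 ^ m) ≤
          11 * Real.exp (L / 10000) * (Real.exp (L / 8000) / Real.exp (0.69 * (L / 2048))) := by
        gcongr
      refine h3.trans ?_
      rw [mul_assoc, ← Real.exp_sub, ← Real.exp_add]
      have h4 : L / 10000 + (L / 8000 - 0.69 * (L / 2048)) ≤ -10 := by linarith
      have h5 : Real.exp (L / 10000 + (L / 8000 - 0.69 * (L / 2048))) ≤ Real.exp (-10) :=
        Real.exp_le_exp.mpr h4
      have h6 : Real.exp (-10) ≤ 1/88 := by
        rw [Real.exp_neg, inv_le_comm₀ (by positivity) (by norm_num)]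
        have e : Real.exp 10 = Real.exp 1 ^ 10 := by rw [← Real.exp_nat_mul]; norm_num
        rw [e]
        have : (2 : ℝ) ^ 10 ≤ Real.exp 1 ^ 10 := by
          gcongr; linarith [Real.exp_one_gt_d9]
        norm_num at this ⊢
        linarith
      linarith
    have hq0 : 0 ≤ (m : ℝ) ^ 2 * (4 / (n : ℝ) / r) := by positivity
    have hfin := hbj.trans hj
    nlinarith

end
end
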